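/- arXiv:1706.02340 — 7 statements merged into one kernel-verified Lean document; each statement's English description precedes it below -/
import Mathlib

section
/- Let p be a prime and let G be a non-abelian finite p-group of order p^n with commutator subgroup G' of order p^k and d = d(G). If |M(G)| attains the bound, i.e. |M(G)| = p^{(1/2)(d-1)(n+k-2)+1}, then G is capable: there exists a group H such that G is isomorphic to H/Z(H). -/
/-- The minimal number of elements required to generate a group `G`. -/
noncomputable def minGens (G : Type*) [Group G] : ℕ :=
  sInf {n | ∃ S : Finset G, S.card = n ∧ Subgroup.closure (S : Set G) = ⊤}

/-- The cardinality of the Hopf quotient `(R ∩ [F,F]) / [R,F]` associated to a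
presentation `π : F → G` with kernel `R = ker π`. -/
noncomputable def hopfCard {F G : Type*} [Group F] [Group G] (π : F →* G) : ℕ :=
  Nat.card ((π.ker ⊓ commutator F : Subgroup F) ⧸
    (⁅π.ker, (⊤ : Subgroup F)⁆.subgroupOf (π.ker ⊓ commutator F)))

/-- The order of the Schur multiplier `M(G)`, computed by Hopf's formula from the
canonical free presentation `FreeGroup G → G`. -/
noncomputable def schurCard (G : Type*) [Group G] : ℕ :=
  hopfCard (FreeGroup.lift (id : G → G))

namespace SchurB

open Subgroup
open scoped commutatorElement

universe u

theorem normal_of_le_cent {A : Type*} [Group A] {L : Subgroup A} (h : L ≤ center A) : L.Normal :=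
  ⟨fun n hn g => by rw [mem_center_iff.1 (h hn) g, mul_inv_cancel_right]; exact hn⟩

theorem card_closure_le_comm {A : Type*} [CommGroup A] {ι : Type*} [Fintype ι] (f : ι → A)
    (m : ι → ℕ) (hm : ∀ i, 0 < m i) (hf : ∀ i, f i ^ m i = 1) :
    Finite (closure (Set.range f)) ∧ Nat.card (closure (Set.range f)) ≤ ∏ i, m i := by
  classical
  let φ : (∀ i, zpowers (f i)) →* A :=
    ∏ i, (zpowers (f i)).subtype.comp (Pi.evalMonoidHom (fun i => zpowers (f i)) i)
  have hfin : ∀ i, Finite (zpowers (f i)) := fun i =>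
    (isOfFinOrder_iff_pow_eq_one.2 ⟨m i, hm i, hf i⟩).finite_zpowers
  have hle : closure (Set.range f) ≤ φ.range := by
    rw [closure_le]
    rintro _ ⟨i, rfl⟩
    refine ⟨Pi.mulSingle i ⟨f i, mem_zpowers _⟩, ?_⟩
    simp only [φ, MonoidHom.finsetProd_apply, MonoidHom.comp_apply, Pi.evalMonoidHom_apply]
    rw [Finset.prod_eq_single i]
    · simp
    · intro j _ hj
      simp [Pi.mulSingle_eq_of_ne hj]
    · simp
  have : Finite φ.range := Set.finite_range φ
  refine ⟨Set.Finite.subset (Set.finite_range φ) hle, ?_⟩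
  calc Nat.card (closure (Set.range f)) ≤ Nat.card φ.range := Nat.card_mono (Set.toFinite _) hle
    _ ≤ Nat.card (∀ i, zpowers (f i)) :=
        Nat.card_le_card_of_surjective _ φ.rangeRestrict_surjective
    _ = ∏ i, Nat.card (zpowers (f i)) := Nat.card_pi
    _ ≤ ∏ i, m i := by
        refine Finset.prod_le_prod' fun i _ => ?_
        rw [Nat.card_zpowers]
        exact orderOf_le_of_pow_eq_one (hm i) (hf i)

theorem card_closure_le {A : Type*} [Group A] {ι : Type*} [Fintype ι] (f : ι → A)
    (m : ι → ℕ) (hm : ∀ i, 0 < m i) (hf : ∀ i, f i ^ m i = 1) (hc : ∀ i, f i ∈ center A) :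
    Finite (closure (Set.range f)) ∧ Nat.card (closure (Set.range f)) ≤ ∏ i, m i := by
  let _ : CommGroup (center A) :=
    { (inferInstance : Group (center A)) with
      mul_comm := fun a b => Subtype.ext (mem_center_iff.1 b.2 a) }
  have h := card_closure_le_comm (A := center A) (fun i => ⟨f i, hc i⟩) m hm
    (fun i => Subtype.ext (by simpa using hf i))
  have e : closure (Set.range f) =
      (closure (Set.range (fun i => (⟨f i, hc i⟩ : center A)))).map (center A).subtype := by
    rw [MonoidHom.map_closure, ← Set.range_comp]; rfl
  let eq := (Subgroup.equivMapOfInjective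
    (closure (Set.range (fun i => (⟨f i, hc i⟩ : center A)))) _ (center A).subtype_injective).toEquiv
  rw [e]
  have := h.1
  exact ⟨Finite.of_equiv _ eq, (Nat.card_congr eq).symm.trans_le h.2⟩

theorem commutator_pow_eq_one {E : Type*} [Group E] {a s : E} {q : ℕ} (ht : ⁅a, s⁆ ∈ center E)
    (ha : a ^ q ∈ center E) : ⁅a, s⁆ ^ q = 1 := by
  set t := ⁅a, s⁆ with htd
  have h1 : a * s = t * s * a := by rw [htd, commutatorElement_def]; group
  have key : ∀ n : ℕ, a ^ n * s = t ^ n * s * a ^ n := by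
    intro n
    induction n with
    | zero => simp
    | succ n ih =>
      have hc : a * t ^ n = t ^ n * a := (mem_center_iff.1 (pow_mem ht n) a)
      calc a ^ (n+1) * s = a * (a ^ n * s) := by rw [pow_succ', mul_assoc]
        _ = (a * t ^ n) * s * a ^ n := by rw [ih]; group
        _ = t ^ n * (a * s) * a ^ n := by rw [hc]; group
        _ = t ^ (n+1) * s * a ^ (n+1) := by rw [h1, pow_succ, pow_succ' a]; group
  have h2 := key q
  rw [← mem_center_iff.1 ha s, mul_assoc] at h2
  exact (mul_eq_right.1 h2.symm)

theorem commutator_mul_of_commute {E : Type*} [Group E] {x y u v : E} (hux : Commute u x)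
    (huy : Commute u y) (hvx : Commute v x) (hvy : Commute v y) (huv : Commute u v) :
    ⁅u * x, v * y⁆ = ⁅x, y⁆ := by
  rw [commutatorElement_def, commutatorElement_def]
  rw [eq_comm, eq_mul_inv_iff_mul_eq, eq_mul_inv_iff_mul_eq]
  have e1 : v * y * (u * x) = u * v * (y * x) := by
    rw [mul_assoc, ← mul_assoc y, ← huy.eq, mul_assoc, ← mul_assoc, huv.eq]
  have e2 : u * x * (v * y) = u * v * (x * y) := by
    rw [mul_assoc, ← mul_assoc x, ← hvx.eq, mul_assoc, ← mul_assoc]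
  rw [e2, mul_assoc, e1]
  have h : Commute (u * v) (x * y * x⁻¹ * y⁻¹) := by
    have a1 := hux.mul_left hvx
    have a2 := huy.mul_left hvy
    exact ((a1.mul_right a2).mul_right a1.inv_right).mul_right a2.inv_right
  rw [← mul_assoc, ← h.eq]; group

/-- If `a` commutes with everything modulo `L`, then `[N, E] ≤ L`. -/
theorem comm_le_of {E : Type*} [Group E] {C N L : Subgroup E} (hC : C ≤ center E) [L.Normal]
    {a : E} (hN : ∀ g ∈ N, ∃ i : ℤ, ∃ c ∈ C, g = a ^ i * c) (ha : ∀ g, ⁅a, g⁆ ∈ L) :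
    ⁅N, (⊤ : Subgroup E)⁆ ≤ L := by
  rw [commutator_le]
  intro g hg h _
  obtain ⟨i, c, hc, rfl⟩ := hN g hg
  have h1 : Commute (a : E ⧸ L) (h : E ⧸ L) := by
    rw [← commutatorElement_eq_one_iff_commute]
    exact (QuotientGroup.eq_one_iff _).2 (ha h)
  have h2 : Commute (c : E ⧸ L) (h : E ⧸ L) := by
    have := mem_center_iff.1 (hC hc) h
    exact (congrArg (QuotientGroup.mk : E → E ⧸ L) this).symm
  rw [← QuotientGroup.eq_one_iff]
  have := commutatorElement_eq_one_iff_commute.2 ((h1.zpow_left i).mul_left h2)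
  exact this

/-- the elements commuting with `a` modulo `L` form a subgroup. -/
def commMod {E : Type*} [Group E] (L : Subgroup E) [L.Normal] (a : E) : Subgroup E :=
  (centralizer {(a : E ⧸ L)}).comap (QuotientGroup.mk' L)

theorem mem_commMod' {E : Type*} [Group E] {L : Subgroup E} [L.Normal] {a g : E} :
    g ∈ commMod L a ↔ Commute (a : E ⧸ L) (g : E ⧸ L) := by
  simp only [commMod, mem_comap, mem_centralizer_singleton_iff]
  exact Iff.rfl.trans eq_comm

theorem mem_commMod {E : Type*} [Group E] {L : Subgroup E} [L.Normal] {a g : E} :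
    g ∈ commMod L a ↔ ⁅a, g⁆ ∈ L := by
  rw [mem_commMod', ← commutatorElement_eq_one_iff_commute, ← QuotientGroup.eq_one_iff]
  rfl

theorem le_commMod {E : Type*} [Group E] {C L : Subgroup E} [L.Normal] {a : E}
    (hC : C ≤ center E) : C ≤ commMod L a := by
  intro c hc
  rw [mem_commMod]
  have : ⁅a, c⁆ = 1 := commutatorElement_eq_one_iff_mul_comm.2 (mem_center_iff.1 (hC hc) a)
  rw [this]; exact one_mem _

theorem card_K_le {E : Type*} [Group E] {C N : Subgroup E} {p d : ℕ} (hp : p.Prime)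
    (hC : C ≤ center E)
    {a : E} (hN : ∀ g ∈ N, ∃ i : ℤ, ∃ c ∈ C, g = a ^ i * c) (ha : ∀ g, ⁅a, g⁆ ∈ C)
    (hap : a ^ p ∈ C) (S : Finset E) (hS : S.card ≤ d) (hgen : closure (S : Set E) ⊔ C = ⊤) :
    Nat.card (⁅N, (⊤ : Subgroup E)⁆ : Subgroup E) ≤ p ^ d := by
  let f : S → E := fun s => ⁅a, (s : E)⁆
  have hf : ∀ s, f s ∈ center E := fun s => hC (ha _)
  have hpow : ∀ s, f s ^ p = 1 := fun s => commutator_pow_eq_one (hf s) (hC hap)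
  have hLc : closure (Set.range f) ≤ center E := by
    rw [closure_le]; rintro _ ⟨s, rfl⟩; exact hf s
  have : (closure (Set.range f)).Normal := normal_of_le_cent hLc
  obtain ⟨hfin, hcard⟩ := card_closure_le f (fun _ => p) (fun _ => hp.pos) hpow hf
  simp only [Finset.prod_const, Finset.card_univ, Fintype.card_coe] at hcard
  have hall : ∀ g, ⁅a, g⁆ ∈ closure (Set.range f) := by
    have : (⊤ : Subgroup E) ≤ commMod (closure (Set.range f)) a := by
      rw [← hgen, sup_le_iff]
      refine ⟨?_, le_commMod hC⟩
      rw [closure_le]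
      intro s hs
      exact mem_commMod.2 (subset_closure ⟨⟨s, hs⟩, rfl⟩)
    intro g; exact mem_commMod.1 (this (mem_top g))
  have hle := comm_le_of hC hN hall
  calc _ ≤ Nat.card (closure (Set.range f)) := Nat.card_mono (Set.toFinite _) hle
    _ ≤ p ^ S.card := hcard
    _ ≤ p ^ d := Nat.pow_le_pow_right hp.pos hS

theorem card_K_le_sq {E : Type*} [Group E] {C N : Subgroup E} {p : ℕ} (hp : p.Prime)
    (hC : C ≤ center E)
    {a : E} (hN : ∀ g ∈ N, ∃ i : ℤ, ∃ c ∈ C, g = a ^ i * c) (ha : ∀ g, ⁅a, g⁆ ∈ C)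
    (hap : a ^ p ∈ C) (hEN : _root_.commutator E ≤ N) (hEC : ¬ _root_.commutator E ≤ C) :
    Nat.card (⁅N, (⊤ : Subgroup E)⁆ : Subgroup E) ≤ p ^ 2 := by
  obtain ⟨x, y, hxy⟩ : ∃ x y : E, ⁅x, y⁆ ∉ C := by
    by_contra! h
    apply hEC
    rw [_root_.commutator_def, commutator_le]
    exact fun x _ y _ => h x y
  have hmem : ∀ g h : E, ⁅g, h⁆ ∈ _root_.commutator E := fun g h =>
    commutator_mem_commutator (mem_top g) (mem_top h)
  let f : Fin 2 → E := ![⁅a, x⁆, ⁅a, y⁆]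
  have hf : ∀ s, f s ∈ center E := by
    intro s; fin_cases s <;> exact hC (ha _)
  have hpow : ∀ s, f s ^ p = 1 := by
    intro s; fin_cases s <;> exact commutator_pow_eq_one (hC (ha _)) (hC hap)
  have hLc : closure (Set.range f) ≤ center E := by
    rw [closure_le]; rintro _ ⟨s, rfl⟩; exact hf s
  have : (closure (Set.range f)).Normal := normal_of_le_cent hLc
  obtain ⟨hfin, hcard⟩ := card_closure_le f (fun _ => p) (fun _ => hp.pos) hpow hf
  simp only [Finset.prod_const, Finset.card_univ, Fintype.card_fin] at hcard
  set L := closure (Set.range f) with hL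
  have hax : Commute (a : E ⧸ L) (x : E ⧸ L) :=
    mem_commMod'.1 (mem_commMod.2 (subset_closure ⟨0, rfl⟩))
  have hay : Commute (a : E ⧸ L) (y : E ⧸ L) :=
    mem_commMod'.1 (mem_commMod.2 (subset_closure ⟨1, rfl⟩))
  have hCc : ∀ c ∈ C, ∀ g : E, Commute (c : E ⧸ L) (g : E ⧸ L) := fun c hc g =>
    (mem_commMod'.1 (le_commMod (L := L) (a := g) hC hc)).symm
  -- elements of `N` commute with everything commuting with `a`
  have hNc : ∀ n ∈ N, ∀ g : E, Commute (a : E ⧸ L) (g : E ⧸ L) →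
      Commute (n : E ⧸ L) (g : E ⧸ L) := by
    intro n hn g hg
    obtain ⟨i, c, hc, rfl⟩ := hN n hn
    exact (hg.zpow_left i).mul_left (hCc c hc g)
  have hNN : ∀ n ∈ N, ∀ n' ∈ N, Commute (n : E ⧸ L) (n' : E ⧸ L) := by
    intro n hn n' hn'
    exact hNc n hn n' (hNc n' hn' a (Commute.refl _)).symm
  have hxyg : ∀ g : E, Commute ((⁅x, y⁆ : E) : E ⧸ L) (g : E ⧸ L) := by
    intro g
    have hu := hEN (hmem g x)
    have hv := hEN (hmem g y)
    have h := commutator_mul_of_commute (hNc _ hu x hax) (hNc _ hu y hay)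
      (hNc _ hv x hax) (hNc _ hv y hay) (hNN _ hu _ hv)
    have e1 : ((⁅g, x⁆ : E) : E ⧸ L) * (x : E ⧸ L) = (g : E ⧸ L) * x * (g : E ⧸ L)⁻¹ := by
      rw [← QuotientGroup.mk_inv, ← QuotientGroup.mk_mul, ← QuotientGroup.mk_mul,
        ← QuotientGroup.mk_mul, commutatorElement_def]; congr 1; group
    have e2 : ((⁅g, y⁆ : E) : E ⧸ L) * (y : E ⧸ L) = (g : E ⧸ L) * y * (g : E ⧸ L)⁻¹ := by
      rw [← QuotientGroup.mk_inv, ← QuotientGroup.mk_mul, ← QuotientGroup.mk_mul,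
        ← QuotientGroup.mk_mul, commutatorElement_def]; congr 1; group
    rw [e1, e2] at h
    have e3 : ⁅(g : E ⧸ L) * x * (g : E ⧸ L)⁻¹, (g : E ⧸ L) * y * (g : E ⧸ L)⁻¹⁆
      = g * ⁅(x : E ⧸ L), (y : E ⧸ L)⁆ * (g : E ⧸ L)⁻¹ := by
      simp only [commutatorElement_def]; group
    rw [e3, mul_inv_eq_iff_eq_mul] at h
    exact h.symm
  obtain ⟨i, c, hc, hic⟩ := hN _ (hEN (hmem x y))
  have hpi : ¬ (p : ℤ) ∣ i := by
    rintro ⟨j, rfl⟩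
    apply hxy
    rw [hic, zpow_mul, zpow_natCast]
    exact mul_mem (zpow_mem hap _) hc
  have hcop : IsCoprime i (p : ℤ) :=
    ((Nat.prime_iff_prime_int.1 hp).coprime_iff_not_dvd.2 hpi).symm
  obtain ⟨r, s, hrs⟩ := hcop
  have hall : ∀ g, ⁅a, g⁆ ∈ L := by
    intro g
    rw [← mem_commMod, mem_commMod']
    have h1 : Commute ((a ^ i : E) : E ⧸ L) (g : E ⧸ L) := by
      have : (a ^ i : E) = ⁅x, y⁆ * c⁻¹ := by rw [hic]; group
      rw [this]
      exact (hxyg g).mul_left (hCc c⁻¹ (inv_mem hc) g)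
    have h2 : Commute ((a ^ p : E) : E ⧸ L) (g : E ⧸ L) := hCc _ hap g
    have h3 : (a : E) = (a ^ i) ^ r * (a ^ p) ^ s := by
      rw [← zpow_mul, ← zpow_natCast, ← zpow_mul, ← zpow_add]
      rw [mul_comm i, mul_comm (p : ℤ), hrs, zpow_one]
    rw [h3]
    exact (h1.zpow_left r).mul_left (h2.zpow_left s)
  have hle := comm_le_of hC hN hall
  calc _ ≤ Nat.card L := Nat.card_mono (Set.toFinite _) hle
    _ ≤ p ^ 2 := hcard

theorem zrank_le {p : ℕ} (hp : p.Prime) {ι : Type*} [Fintype ι] (n : ι → ℕ) (hpn : ∀ i, p ∣ n i)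
    (T : Finset (∀ i, Multiplicative (ZMod (n i))))
    (hT : Subgroup.closure (T : Set (∀ i, Multiplicative (ZMod (n i)))) = ⊤) :
    Fintype.card ι ≤ T.card := by
  classical
  have : Fact p.Prime := ⟨hp⟩
  let ψ : (∀ i, Multiplicative (ZMod (n i))) → (ι → ZMod p) :=
    fun v i => ZMod.castHom (hpn i) (ZMod p) (Multiplicative.toAdd (v i))
  let V := Submodule.span (ZMod p) ((T.image ψ : Finset (ι → ZMod p)) : Set (ι → ZMod p))
  have hV : ∀ v, ψ v ∈ V := by
    intro v
    have hv : v ∈ Subgroup.closure (T : Set (∀ i, Multiplicative (ZMod (n i)))) := by rw [hT]; trivial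
    induction hv using closure_induction with
    | mem x hx => exact Submodule.subset_span (by simpa using ⟨x, hx, rfl⟩)
    | one =>
      have : ψ 1 = 0 := by ext i; simp [ψ]
      rw [this]; exact V.zero_mem
    | mul x y _ _ hx hy =>
      have : ψ (x * y) = ψ x + ψ y := by ext i; exact map_add (ZMod.castHom (hpn i) (ZMod p)) _ _
      rw [this]; exact V.add_mem hx hy
    | inv x _ hx =>
      have : ψ x⁻¹ = - ψ x := by ext i; exact map_neg (ZMod.castHom (hpn i) (ZMod p)) _
      rw [this]; exact V.neg_mem hx
  have hVtop : V = ⊤ := by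
    rw [eq_top_iff]
    intro w _
    have hs : ∀ i, ∃ u, ZMod.castHom (hpn i) (ZMod p) u = w i := fun i =>
      ZMod.castHom_surjective (hpn i) (w i)
    choose u hu using hs
    have : ψ (fun i => Multiplicative.ofAdd (u i)) = w := by
      ext i; exact hu i
    rw [← this]; exact hV _
  have h1 := finrank_span_finset_le_card (R := ZMod p) (T.image ψ)
  have h2 : Module.finrank (ZMod p) V = Fintype.card ι := by
    rw [hVtop, finrank_top, Module.finrank_fintype_fun_eq_card]
  calc Fintype.card ι = Module.finrank (ZMod p) V := h2.symm
    _ ≤ (T.image ψ).card := h1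
    _ ≤ T.card := Finset.card_image_le

theorem prod_pairs {ι : Type*} [Fintype ι] [LinearOrder ι] (n : ι → ℕ) :
    (∏ q : {q : ι × ι // q.1 < q.2}, min (n q.1.1) (n q.1.2)) ^ 2
      ≤ (∏ i, n i) ^ (Fintype.card ι - 1) := by
  classical
  have e1 : (∏ q : {q : ι × ι // q.1 < q.2}, n q.1.1) =
      ∏ q ∈ Finset.univ.filter (fun q : ι × ι => q.1 < q.2), n q.1 :=
    (Finset.prod_subtype (Finset.univ.filter (fun q : ι × ι => q.1 < q.2)) (by simp)
      (fun q => n q.1)).symm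
  have e2 : (∏ q : {q : ι × ι // q.1 < q.2}, n q.1.2) =
      ∏ q ∈ Finset.univ.filter (fun q : ι × ι => q.2 < q.1), n q.1 := by
    rw [← Finset.prod_subtype (Finset.univ.filter (fun q : ι × ι => q.1 < q.2)) (by simp)
      (fun q => n q.2)]
    refine Finset.prod_bij' (fun q _ => q.swap) (fun q _ => q.swap) ?_ ?_ ?_ ?_ ?_ <;> simp
  have e3 : (∏ q ∈ Finset.univ.filter (fun q : ι × ι => q.1 < q.2), n q.1) *
      (∏ q ∈ Finset.univ.filter (fun q : ι × ι => q.2 < q.1), n q.1)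
      = ∏ q ∈ Finset.univ.filter (fun q : ι × ι => q.1 ≠ q.2), n q.1 := by
    rw [← Finset.prod_union]
    · congr 1
      ext q
      simp [lt_or_lt_iff_ne]
    · rw [Finset.disjoint_left]
      intro q h1 h2
      simp only [Finset.mem_filter] at h1 h2
      exact lt_asymm h1.2 h2.2
  have e4 : (∏ q ∈ Finset.univ.filter (fun q : ι × ι => q.1 ≠ q.2), n q.1)
      = (∏ i, n i) ^ (Fintype.card ι - 1) := by
    rw [Finset.prod_filter, ← Finset.univ_product_univ, Finset.prod_product,
      ← Finset.prod_pow]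
    refine Finset.prod_congr rfl fun i _ => ?_
    rw [← Finset.prod_filter]
    change ∏ a ∈ Finset.univ.filter (fun a => i ≠ a), n i = _
    rw [Finset.prod_const]
    congr 1
    rw [Finset.filter_ne]
    simp
  rw [← e4, ← e3, ← e1, ← e2, ← Finset.prod_mul_distrib, ← Finset.prod_pow]
  refine Finset.prod_le_prod' fun q _ => ?_
  rw [sq]
  exact Nat.mul_le_mul (min_le_left _ _) (min_le_right _ _)

theorem boundAb {E : Type*} [Group E] {C : Subgroup E} {p m d : ℕ} (hp : p.Prime)
    (hC : C ≤ center E) (hEC : _root_.commutator E ≤ C) (h1 : C.index = p ^ m)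
    (S : Finset E) (hS : S.card ≤ d) (hgen : closure (S : Set E) ⊔ C = ⊤) :
    Nat.card (_root_.commutator E) ^ 2 ≤ p ^ ((d - 1) * m) := by
  classical
  have hCn : C.Normal := normal_of_le_cent hC
  let _ : CommGroup (E ⧸ C) :=
    { (inferInstance : Group (E ⧸ C)) with
      mul_comm := by
        intro a b
        induction a using QuotientGroup.induction_on with | _ a => ?_
        induction b using QuotientGroup.induction_on with | _ b => ?_
        exact mem_commMod'.1 (mem_commMod.2
          (hEC (commutator_mem_commutator (mem_top a) (mem_top b)))) }
  have hcardG : Nat.card (E ⧸ C) = p ^ m := h1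
  have hfinG : Finite (E ⧸ C) := Nat.finite_of_card_ne_zero (by
    rw [hcardG]; exact pow_ne_zero _ hp.ne_zero)
  obtain ⟨ι, _, n, hn, ⟨e⟩⟩ := CommGroup.equiv_prod_multiplicative_zmod_of_finite (E ⧸ C)
  let _ : LinearOrder ι := LinearOrder.lift' (Fintype.equivFin ι) (Fintype.equivFin ι).injective
  have hprod : ∏ i, n i = p ^ m := by
    rw [← hcardG, Nat.card_congr e.toEquiv, Nat.card_pi]
    refine Finset.prod_congr rfl fun i _ => ?_
    exact (Nat.card_zmod (n i)).symm
  have hpn : ∀ i, p ∣ n i := by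
    intro i
    have : n i ∣ p ^ m := hprod ▸ Finset.dvd_prod_of_mem n (Finset.mem_univ i)
    obtain ⟨j, _, hj⟩ := (Nat.dvd_prime_pow hp).1 this
    have := hn i
    rcases j with _ | j
    · simp at hj; omega
    · rw [hj]; exact dvd_pow_self p (Nat.succ_ne_zero j)
  -- the rank
  let φ : E →* (∀ i, Multiplicative (ZMod (n i))) := e.toMonoidHom.comp (QuotientGroup.mk' C)
  have hφs : Function.Surjective φ := e.surjective.comp (QuotientGroup.mk'_surjective C)
  have hφk : ∀ g, φ g = 1 ↔ g ∈ C := by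
    intro g
    simp [φ]
  have hmapC : C.map φ = ⊥ := by
    rw [eq_bot_iff]
    rintro _ ⟨g, hg, rfl⟩
    exact (hφk g).2 hg
  have hcardι : Fintype.card ι ≤ d := by
    refine (zrank_le hp n hpn (S.image φ) ?_).trans (Finset.card_image_le.trans hS)
    rw [Finset.coe_image, ← MonoidHom.map_closure, ← map_top_of_surjective φ hφs, ← hgen,
      Subgroup.map_sup, hmapC, sup_bot_eq]
  have hx : ∀ i : ι, ∃ y, φ y = Pi.mulSingle i (Multiplicative.ofAdd (1 : ZMod (n i))) :=
    fun i => hφs _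
  choose x hx using hx
  have hxn : ∀ i, x i ^ n i ∈ C := by
    intro i
    rw [← hφk, map_pow, hx, ← Pi.mulSingle_pow, ← ofAdd_nsmul]
    simp
  have hxgen : closure (Set.range x) ⊔ C = ⊤ := by
    rw [eq_top_iff]
    intro g _
    have hmem : φ g ∈ (closure (Set.range x)).map φ := by
      rw [← Finset.univ_prod_mulSingle (φ g)]
      refine prod_mem fun i _ => ?_
      refine ⟨x i ^ (Multiplicative.toAdd (φ g i)).val, pow_mem (Subgroup.subset_closure (Set.mem_range_self i)) _, ?_⟩
      have : NeZero (n i) := ⟨by have := hn i; omega⟩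
      rw [map_pow, hx, ← Pi.mulSingle_pow, ← ofAdd_nsmul]
      simp
    obtain ⟨y, hy, hyg⟩ := hmem
    have : y⁻¹ * g ∈ C := by rw [← hφk, map_mul, map_inv, hyg, inv_mul_cancel]
    have h := mul_mem_sup hy this
    rwa [mul_inv_cancel_left] at h
  let f : {q : ι × ι // q.1 < q.2} → E := fun q => ⁅x q.1.1, x q.1.2⁆
  have hcen : ∀ a b : E, ⁅a, b⁆ ∈ center E := fun a b =>
    hC (hEC (commutator_mem_commutator (mem_top a) (mem_top b)))
  have hfc : ∀ q, f q ∈ center E := fun q => hcen _ _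
  have hfp : ∀ q, f q ^ (min (n q.1.1) (n q.1.2)) = 1 := by
    intro q
    rcases min_choice (n q.1.1) (n q.1.2) with h | h <;> rw [h]
    · exact commutator_pow_eq_one (hcen _ _) (hC (hxn _))
    · have := commutator_pow_eq_one (hcen (x q.1.2) (x q.1.1)) (hC (hxn q.1.2))
      rw [← commutatorElement_inv, inv_pow, inv_eq_one] at this
      exact this
  obtain ⟨hfin, hcard⟩ := card_closure_le f _
    (fun q => by have := hn q.1.1; have := hn q.1.2; exact lt_min (by omega) (by omega)) hfp hfc
  have hLc : closure (Set.range f) ≤ center E := by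
    rw [closure_le]; rintro _ ⟨s, rfl⟩; exact hfc s
  have : (closure (Set.range f)).Normal := normal_of_le_cent hLc
  set L := closure (Set.range f) with hL
  have hsymm : ∀ a b : E, a ∈ commMod L b → b ∈ commMod L a := fun a b h =>
    mem_commMod'.2 (mem_commMod'.1 h).symm
  have hxx : ∀ i j, x j ∈ commMod L (x i) := by
    intro i j
    rcases lt_trichotomy i j with h | h | h
    · exact mem_commMod.2 (subset_closure ⟨⟨(i, j), h⟩, rfl⟩)
    · subst h; exact mem_commMod'.2 (Commute.refl _)
    · exact hsymm _ _ (mem_commMod.2 (subset_closure ⟨⟨(j, i), h⟩, rfl⟩))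
  have htop : ∀ g, (∀ i, x i ∈ commMod L g) → ∀ h, h ∈ commMod L g := by
    intro g hg h
    have : (⊤ : Subgroup E) ≤ commMod L g := by
      rw [← hxgen, sup_le_iff]
      refine ⟨?_, le_commMod hC⟩
      rw [closure_le]
      rintro _ ⟨i, rfl⟩
      exact hg i
    exact this (mem_top h)
  have hle : _root_.commutator E ≤ L := by
    rw [_root_.commutator_def, commutator_le]
    intro g _ h _
    rw [← mem_commMod]
    exact htop g (fun i => hsymm _ _ (htop (x i) (fun j => hxx i j) g)) h
  calc Nat.card (_root_.commutator E) ^ 2 ≤ Nat.card L ^ 2 :=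
        Nat.pow_le_pow_left (Nat.card_mono (Set.toFinite _) hle) 2
    _ ≤ (∏ q : {q : ι × ι // q.1 < q.2}, min (n q.1.1) (n q.1.2)) ^ 2 :=
        Nat.pow_le_pow_left hcard 2
    _ ≤ (p ^ m) ^ (Fintype.card ι - 1) := hprod ▸ prod_pairs n
    _ ≤ (p ^ m) ^ (d - 1) := Nat.pow_le_pow_right (pow_pos hp.pos _) (by omega)
    _ = _ := by rw [← pow_mul, mul_comm]

theorem exists_central_order_p {G : Type*} [Group G] [Finite G] {p : ℕ} (hp : p.Prime)
    (hG : IsPGroup p G) (Q : Subgroup G) [Q.Normal] (hQ : Q ≠ ⊥) :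
    ∃ z ∈ Q, z ∈ center G ∧ orderOf z = p := by
  have : Fact p.Prime := ⟨hp⟩
  have hQn : Nontrivial Q := (nontrivial_iff_ne_bot Q).2 hQ
  have hdvd : p ∣ Nat.card Q := by
    rcases (hG.to_subgroup Q).card_eq_or_dvd with h | h
    · exact absurd h (Finite.one_lt_card (α := Q)).ne'
    · exact h
  have hGc : IsPGroup p (ConjAct G) := hG.of_equiv ConjAct.toConjAct
  obtain ⟨b, hb, hb1⟩ := hGc.exists_fixed_point_of_prime_dvd_card_of_fixed_point Q hdvd
    (a := 1) (by intro g; exact smul_one g)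
  have hbc : (b : G) ∈ center G := by
    rw [mem_center_iff]
    intro g
    have := congrArg Subtype.val (hb (ConjAct.toConjAct g))
    rw [ConjAct.Subgroup.val_conj_smul, ConjAct.toConjAct_smul] at this
    exact mul_inv_eq_iff_eq_mul.1 this
  have hne : Q ⊓ center G ≠ ⊥ := by
    intro h
    have : (b : G) ∈ Q ⊓ center G := ⟨b.2, hbc⟩
    rw [h, mem_bot] at this
    exact hb1 (Subtype.ext this.symm)
  have : Nontrivial (Q ⊓ center G : Subgroup G) := (nontrivial_iff_ne_bot _).2 hne
  have hdvd : p ∣ Nat.card (Q ⊓ center G : Subgroup G) := by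
    rcases (hG.to_subgroup (Q ⊓ center G)).card_eq_or_dvd with h | h
    · exact absurd h (Finite.one_lt_card (α := (Q ⊓ center G : Subgroup G))).ne'
    · exact h
  obtain ⟨z, hz⟩ := exists_prime_orderOf_dvd_card' p hdvd
  exact ⟨z, z.2.1, z.2.2, by rw [← hz]; exact Subgroup.orderOf_coe z⟩

theorem exists_step {E : Type*} [Group E] {C : Subgroup E} {p t m : ℕ} (hp : p.Prime)
    (hC : C ≤ center E) (h1 : C.index = p ^ (t + 1))
    (h2 : (C ⊔ _root_.commutator E).index = p ^ m) (hm : m ≤ t) :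
    ∃ (a : E) (N : Subgroup E), N.Normal ∧ C ≤ N ∧ N ≤ C ⊔ _root_.commutator E ∧
      N.index = p ^ t ∧ (∀ g ∈ N, ∃ i : ℤ, ∃ c ∈ C, g = a ^ i * c) ∧ (∀ g, ⁅a, g⁆ ∈ C) ∧
      a ^ p ∈ C := by
  have hCn : C.Normal := normal_of_le_cent hC
  have hcardG : Nat.card (E ⧸ C) = p ^ (t + 1) := h1
  have hfinG : Finite (E ⧸ C) := Nat.finite_of_card_ne_zero (by
    rw [hcardG]; exact pow_ne_zero _ hp.ne_zero)
  have hpG : IsPGroup p (E ⧸ C) := IsPGroup.of_card hcardG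
  let q := QuotientGroup.mk' C
  have hqs : Function.Surjective q := QuotientGroup.mk'_surjective C
  have hqk : q.ker = C := QuotientGroup.ker_mk' C
  let Q := (C ⊔ _root_.commutator E).map q
  have hQn : Q.Normal := Subgroup.Normal.map inferInstance q hqs
  have hQ : Q ≠ ⊥ := by
    intro h
    have : C ⊔ _root_.commutator E ≤ C := by
      exact ((Subgroup.map_eq_bot_iff _).1 h).trans hqk.le
    have e : C ⊔ _root_.commutator E = C := le_antisymm this le_sup_left
    rw [e, h1] at h2
    have := Nat.pow_right_injective hp.two_le h2
    omega
  obtain ⟨z, hzQ, hzc, hzo⟩ := exists_central_order_p hp hpG Q hQ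
  obtain ⟨a, rfl⟩ := hqs z
  have hzn : (zpowers (q a)).Normal := normal_of_le_cent (by rw [zpowers_le]; exact hzc)
  refine ⟨a, (zpowers (q a)).comap q, inferInstance, ?_, ?_, ?_, ?_, ?_, ?_⟩
  · exact hqk.symm.trans_le (MonoidHom.ker_le_comap _ _)
  · have : zpowers (q a) ≤ Q := by rw [zpowers_le]; exact hzQ
    refine (comap_mono this).trans ?_
    rw [comap_map_eq, hqk]
    simp
  · rw [index_comap_of_surjective _ hqs]
    have h := card_mul_index (zpowers (q a))
    rw [Nat.card_zpowers, hzo, hcardG, pow_succ'] at h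
    exact Nat.eq_of_mul_eq_mul_left hp.pos h
  · intro g hg
    obtain ⟨i, hi⟩ := mem_zpowers_iff.1 hg
    refine ⟨i, (a ^ i)⁻¹ * g, ?_, by group⟩
    rw [← hqk, MonoidHom.mem_ker, map_mul, map_inv, map_zpow, hi, inv_mul_cancel]
  · intro g
    rw [← mem_commMod, mem_commMod']
    exact (mem_center_iff.1 hzc (q g)).symm
  · rw [← hqk, MonoidHom.mem_ker, map_pow, ← hzo, pow_orderOf_eq_one]

theorem quot_step {E : Type*} [Group E] {C N : Subgroup E} [N.Normal]
    (hCN : C ≤ N) (hNE : N ≤ C ⊔ _root_.commutator E) :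
    N.map (QuotientGroup.mk' ⁅N, (⊤ : Subgroup E)⁆) ≤ center (E ⧸ ⁅N, (⊤ : Subgroup E)⁆) ∧
    (N.map (QuotientGroup.mk' ⁅N, (⊤ : Subgroup E)⁆)).index = N.index ∧
    (N.map (QuotientGroup.mk' ⁅N, (⊤ : Subgroup E)⁆) ⊔
      _root_.commutator (E ⧸ ⁅N, (⊤ : Subgroup E)⁆)).index = (C ⊔ _root_.commutator E).index ∧
    Nat.card (_root_.commutator E) =
      Nat.card (_root_.commutator (E ⧸ ⁅N, (⊤ : Subgroup E)⁆)) *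
        Nat.card (⁅N, (⊤ : Subgroup E)⁆ : Subgroup E) := by
  set K := ⁅N, (⊤ : Subgroup E)⁆ with hK
  have hKN : K ≤ N := commutator_le_left N ⊤
  have hKE : K ≤ _root_.commutator E := commutator_mono le_top le_rfl
  have hqs : Function.Surjective (QuotientGroup.mk' K) := QuotientGroup.mk'_surjective K
  have hqk : (QuotientGroup.mk' K).ker = K := QuotientGroup.ker_mk' K
  have hcomm : _root_.commutator (E ⧸ K) = (_root_.commutator E).map (QuotientGroup.mk' K) := by
    rw [_root_.commutator_def, _root_.commutator_def, map_commutator,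
      map_top_of_surjective _ hqs]
  have hsup : N ⊔ _root_.commutator E = C ⊔ _root_.commutator E :=
    le_antisymm (sup_le hNE le_sup_right) (sup_le_sup_right hCN _)
  refine ⟨?_, ?_, ?_, ?_⟩
  · rintro _ ⟨n, hn, rfl⟩
    rw [mem_center_iff]
    intro g
    obtain ⟨g, rfl⟩ := hqs g
    have : g ∈ commMod K n := mem_commMod.2 (commutator_mem_commutator hn (mem_top g))
    exact (mem_commMod'.1 this).symm
  · exact index_map_eq _ hqs (hqk.trans_le hKN)
  · rw [hcomm, ← Subgroup.map_sup, hsup]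
    exact index_map_eq _ hqs (hqk.trans_le (hKE.trans le_sup_right))
  · rw [hcomm, ← relIndex_ker, hqk, ← relIndex_bot_left K, mul_comm,
      relIndex_mul_relIndex _ _ _ bot_le hKE, relIndex_bot_left]

theorem boundNonab {p d : ℕ} (hp : p.Prime) (hd : 1 ≤ d) (k : ℕ) : ∀ (m : ℕ) (E : Type u) [Group E]
    (C : Subgroup E) (_ : C ≤ center E) (_ : C.index = p ^ (m + k + 1))
    (_ : (C ⊔ _root_.commutator E).index = p ^ m)
    (S : Finset E) (_ : S.card ≤ d) (_ : closure (S : Set E) ⊔ C = ⊤),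
    Nat.card (_root_.commutator E) ^ 2 ≤ p ^ ((d - 1) * (m + 2 * k) + 4 + 2 * k) := by
  classical
  induction k with
  | zero =>
    intro m E _ C hC h1 h2 S hS hgen
    obtain ⟨a, N, hNn, hCN, hNE, hNi, hN, ha, hap⟩ := exists_step hp hC h1 h2 le_rfl
    obtain ⟨q1, q2, q3, q4⟩ := quot_step hCN hNE
    have hNeq : _root_.commutator E ≤ N := by
      have hri : N.relIndex (C ⊔ _root_.commutator E) = 1 := by
        have h := relIndex_mul_index hNE
        rw [h2, hNi] at h
        exact Nat.eq_of_mul_eq_mul_right (pow_pos hp.pos m) (h.trans (one_mul _).symm)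
      exact le_sup_right.trans (relIndex_eq_one.1 hri)
    have hEC : ¬ _root_.commutator E ≤ C := by
      intro h
      rw [sup_eq_left.2 h, h1] at h2
      have := Nat.pow_right_injective hp.two_le h2
      omega
    have hK := card_K_le_sq hp hC hN ha hap hNeq hEC
    set K := ⁅N, (⊤ : Subgroup E)⁆ with hKdef
    have hqs : Function.Surjective (QuotientGroup.mk' K) := QuotientGroup.mk'_surjective K
    have hcomm : _root_.commutator (E ⧸ K) = (_root_.commutator E).map (QuotientGroup.mk' K) := by
      rw [_root_.commutator_def, _root_.commutator_def, map_commutator,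
        map_top_of_surjective _ hqs]
    have hb := boundAb hp q1 (hcomm.trans_le (map_mono hNeq)) (q2.trans hNi)
      (S.image (QuotientGroup.mk' K)) (Finset.card_image_le.trans hS) (by
        have hgN : closure (S : Set E) ⊔ N = ⊤ :=
          top_le_iff.1 (hgen.symm.trans_le (sup_le_sup_left hCN _))
        rw [Finset.coe_image, ← MonoidHom.map_closure, ← Subgroup.map_sup, hgN,
          map_top_of_surjective _ hqs])
    rw [q4, mul_pow]
    calc _ ≤ p ^ ((d - 1) * m) * (p ^ 2) ^ 2 :=
          Nat.mul_le_mul hb (Nat.pow_le_pow_left hK 2)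
      _ = _ := by rw [← pow_mul, ← pow_add]; simp
  | succ k ih =>
    intro m E _ C hC h1 h2 S hS hgen
    obtain ⟨a, N, hNn, hCN, hNE, hNi, hN, ha, hap⟩ :=
      exists_step hp hC (t := m + k + 1) h1 h2 (by omega)
    obtain ⟨q1, q2, q3, q4⟩ := quot_step hCN hNE
    have hK := card_K_le hp hC hN ha hap S hS hgen
    set K := ⁅N, (⊤ : Subgroup E)⁆ with hKdef
    have hqs : Function.Surjective (QuotientGroup.mk' K) := QuotientGroup.mk'_surjective K
    have hb := ih m (E ⧸ K) _ q1 (q2.trans hNi) (q3.trans h2)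
      (S.image (QuotientGroup.mk' K)) (Finset.card_image_le.trans hS) (by
        have hgN : closure (S : Set E) ⊔ N = ⊤ :=
          top_le_iff.1 (hgen.symm.trans_le (sup_le_sup_left hCN _))
        rw [Finset.coe_image, ← MonoidHom.map_closure, ← Subgroup.map_sup, hgN,
          map_top_of_surjective _ hqs])
    rw [q4, mul_pow]
    calc _ ≤ p ^ ((d - 1) * (m + 2 * k) + 4 + 2 * k) * (p ^ d) ^ 2 :=
          Nat.mul_le_mul hb (Nat.pow_le_pow_left hK 2)
      _ = _ := by
          rw [← pow_mul, ← pow_add]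
          congr 1
          obtain ⟨d, rfl⟩ := Nat.exists_eq_add_of_le' hd
          simp only [Nat.add_sub_cancel]
          ring

theorem capable_aux {p n k d : ℕ} (hp : p.Prime) (G : Type u) [Group G] [Finite G]
    (hG : Nat.card G = p ^ n) (hna : ∃ a b : G, a * b ≠ b * a)
    (hk : Nat.card (_root_.commutator G) = p ^ k)
    (hd : d = minGens G)
    (hM : schurCard G ^ 2 = p ^ ((d - 1) * (n + k - 2) + 2)) :
    ∃ (H : Type u) (_ : Group H), Nonempty (G ≃* H ⧸ Subgroup.center H) := by
  classical
  -- generators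
  obtain ⟨S, hScard, hSgen⟩ : ∃ S : Finset G, S.card = d ∧ closure (S : Set G) = ⊤ := by
    have hne : {n | ∃ S : Finset G, S.card = n ∧ closure (S : Set G) = ⊤}.Nonempty := by
      have := Fintype.ofFinite G
      exact ⟨_, Finset.univ, rfl, by simp⟩
    rw [hd]
    exact Nat.sInf_mem hne
  have hd2 : 2 ≤ d := by
    by_contra hlt
    obtain ⟨a, b, hab⟩ := hna
    have hle : S.card ≤ 1 := by omega
    have hcl : ∃ x, (⊤ : Subgroup G) ≤ zpowers x := by
      rcases Finset.card_le_one_iff_subset_singleton.1 hle with ⟨x, hx⟩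
      refine ⟨x, ?_⟩
      rw [← hSgen, closure_le]
      intro y hy
      rw [Finset.mem_singleton.1 (hx hy)]
      exact mem_zpowers x
    obtain ⟨x, hx⟩ := hcl
    obtain ⟨i, rfl⟩ := mem_zpowers_iff.1 (hx (mem_top a))
    obtain ⟨j, rfl⟩ := mem_zpowers_iff.1 (hx (mem_top b))
    exact hab (zpow_mul_comm x i j)
  have hk1 : 1 ≤ k := by
    rcases Nat.eq_zero_or_pos k with rfl | h
    · obtain ⟨a, b, hab⟩ := hna
      rw [pow_zero] at hk
      have hbot := Subgroup.eq_bot_of_card_eq _ hk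
      have : ⁅a, b⁆ ∈ _root_.commutator G := commutator_mem_commutator (mem_top a) (mem_top b)
      rw [hbot, mem_bot] at this
      exact absurd (commutatorElement_eq_one_iff_mul_comm.1 this) hab
    · exact h
  -- the covering group
  let π : FreeGroup G →* G := FreeGroup.lift (id : G → G)
  have hπs : Function.Surjective π := fun g => ⟨FreeGroup.of g, by simp [π]⟩
  let K : Subgroup (FreeGroup G) := ⁅π.ker, (⊤ : Subgroup (FreeGroup G))⁆
  have hKR : K ≤ π.ker := commutator_le_left _ _
  have hKF : K ≤ _root_.commutator (FreeGroup G) := commutator_mono le_top le_rfl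
  let E := FreeGroup G ⧸ K
  let φ : E →* G := QuotientGroup.lift K π hKR
  have hφs : Function.Surjective φ := by
    intro g
    obtain ⟨x, hx⟩ := hπs g
    exact ⟨(x : E), hx⟩
  have hqs : Function.Surjective (QuotientGroup.mk' K) := QuotientGroup.mk'_surjective K
  have hC : φ.ker ≤ center E := by
    intro x hx
    obtain ⟨x, rfl⟩ := hqs x
    have hxR : x ∈ π.ker := hx
    rw [mem_center_iff]
    intro g
    obtain ⟨g, rfl⟩ := hqs g
    have : g ∈ commMod K x := mem_commMod.2 (commutator_mem_commutator hxR (mem_top g))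
    exact (mem_commMod'.1 this).symm
  by_cases hcen : φ.ker = center E
  · refine ⟨E, inferInstance, ⟨?_⟩⟩
    exact ((QuotientGroup.quotientMulEquivOfEq hcen).symm.trans
      (QuotientGroup.quotientKerEquivOfSurjective φ hφs)).symm
  exfalso
  have hmapφ : (_root_.commutator E).map φ = _root_.commutator G := by
    rw [_root_.commutator_def, _root_.commutator_def, map_commutator,
      map_top_of_surjective _ hφs]
  have hmapπ : (_root_.commutator (FreeGroup G)).map π = _root_.commutator G := by
    rw [_root_.commutator_def, _root_.commutator_def, map_commutator,
      map_top_of_surjective _ hπs]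
  have hmapq : (_root_.commutator (FreeGroup G)).map (QuotientGroup.mk' K)
      = _root_.commutator E := by
    rw [_root_.commutator_def, _root_.commutator_def, map_commutator,
      map_top_of_surjective _ hqs]
  have hEcard : Nat.card (_root_.commutator E) = schurCard G * p ^ k := by
    have e1 : schurCard G = K.relIndex (π.ker ⊓ _root_.commutator (FreeGroup G)) := rfl
    rw [e1, ← hk, ← hmapπ, ← relIndex_ker, ← hmapq, ← relIndex_ker, QuotientGroup.ker_mk',
      ← inf_relIndex_right π.ker]
    exact (relIndex_mul_relIndex _ _ _ (le_inf hKR hKF) inf_le_right).symm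
  have hEsq : Nat.card (_root_.commutator E) ^ 2 = p ^ ((d - 1) * (n + k - 2) + 2 + 2 * k) := by
    rw [hEcard, mul_pow, hM, ← pow_mul, ← pow_add, mul_comm k]
  have hCidx : φ.ker.index = p ^ n := by
    rw [index_ker, MonoidHom.range_eq_top.2 hφs, ← hG]
    exact Nat.card_congr Subgroup.topEquiv.toEquiv
  have hCrel : φ.ker.relIndex (_root_.commutator E) = p ^ k := by
    rw [relIndex_ker, hmapφ, hk]
  -- the centre
  obtain ⟨n1, hn1le, hn1⟩ : ∃ n1 ≤ n, (center E).index = p ^ n1 :=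
    (Nat.dvd_prime_pow hp).1 (hCidx ▸ index_dvd_of_le hC)
  have hn1lt : n1 < n := by
    refine lt_of_le_of_ne hn1le ?_
    rintro rfl
    have h := relIndex_mul_index hC
    rw [hCidx, hn1] at h
    have : φ.ker.relIndex (center E) = 1 :=
      Nat.eq_of_mul_eq_mul_right (pow_pos hp.pos _) (h.trans (one_mul _).symm)
    exact hcen (le_antisymm hC (relIndex_eq_one.1 this))
  obtain ⟨k1, hk1le, hk1'⟩ : ∃ k1 ≤ k, (center E).relIndex (_root_.commutator E) = p ^ k1 :=
    (Nat.dvd_prime_pow hp).1 (hCrel ▸ relIndex_dvd_of_le_left _ hC)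
  have hmul : p ^ k1 * (center E ⊔ _root_.commutator E).index = p ^ n1 := by
    rw [← hk1', ← hn1, ← relIndex_sup_right, sup_comm]
    exact relIndex_mul_index le_sup_left
  obtain ⟨m, hmle, hm⟩ : ∃ m ≤ n1, (center E ⊔ _root_.commutator E).index = p ^ m :=
    (Nat.dvd_prime_pow hp).1 (hmul ▸ Dvd.intro_left _ rfl)
  have hsum : k1 + m = n1 := by
    rw [hm, ← pow_add] at hmul
    exact Nat.pow_right_injective hp.two_le hmul
  -- generators of E modulo the centre
  let r : G → E := Function.surjInv hφs
  have hr : ∀ g, φ (r g) = g := Function.surjInv_eq hφs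
  have hTcard : (S.image r).card ≤ d := Finset.card_image_le.trans hScard.le
  have hTgen : closure ((S.image r : Finset E) : Set E) ⊔ center E = ⊤ := by
    rw [eq_top_iff]
    intro x _
    have hx : φ x ∈ (closure ((S.image r : Finset E) : Set E)).map φ := by
      rw [MonoidHom.map_closure, Finset.coe_image, ← Set.image_comp]
      have : φ ∘ r = id := funext hr
      rw [this, Set.image_id, hSgen]
      exact mem_top _
    obtain ⟨y, hy, hyx⟩ := hx
    have : y⁻¹ * x ∈ center E :=
      hC (by rw [MonoidHom.mem_ker, map_mul, map_inv, hyx, inv_mul_cancel])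
    have h := mul_mem_sup hy this
    rwa [mul_inv_cancel_left] at h
  obtain ⟨e, rfl⟩ := Nat.exists_eq_add_of_le' hd2
  rcases Nat.eq_zero_or_pos k1 with h0 | hpos
  · subst h0
    have hle : _root_.commutator E ≤ center E := relIndex_eq_one.1 (by rw [hk1', pow_zero])
    have hb := boundAb hp le_rfl hle hn1 _ hTcard hTgen
    rw [hEsq] at hb
    have hb' := (Nat.pow_le_pow_iff_right hp.one_lt).1 hb
    have : (e + 2 - 1) * n1 ≤ (e + 2 - 1) * (n + k - 2) := Nat.mul_le_mul_left _ (by omega)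
    omega
  · obtain ⟨j, rfl⟩ := Nat.exists_eq_add_of_le' hpos
    have hb := boundNonab hp (by omega) j m E (center E) le_rfl
      (by rw [hn1]; congr 1; omega) hm _ hTcard hTgen
    rw [hEsq] at hb
    have hb' := (Nat.pow_le_pow_iff_right hp.one_lt).1 hb
    have : (e + 2 - 1) * (m + 2 * j + 1) ≤ (e + 2 - 1) * (n + k - 2) :=
      Nat.mul_le_mul_left _ (by omega)
    have h3 : (e + 2 - 1) * (m + 2 * j + 1) = (e + 2 - 1) * (m + 2 * j) + (e + 1) := by
      simp only [mul_add, mul_one]; omega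
    omega

end SchurB

/-- If a non-abelian finite `p`-group `G` of order `p ^ n`, with `|G'| = p ^ k` and
`d = d(G)`, attains the bound `|M(G)| = p ^ ((1/2)*(d-1)*(n+k-2)+1)` (stated squared),
then `G` is capable: there is a group `H` with `G ≅ H/Z(H)`. -/
theorem schur_bound_capable
    {p n k d : ℕ} (hp : p.Prime) (G : Type u) [Group G] [Finite G]
    (hG : Nat.card G = p ^ n) (hna : ∃ a b : G, a * b ≠ b * a)
    (hk : Nat.card (commutator G) = p ^ k)
    (hd : d = minGens G)
    (hM : schurCard G ^ 2 = p ^ ((d - 1) * (n + k - 2) + 2)) :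
    ∃ (H : Type u) (_ : Group H), Nonempty (G ≃* H ⧸ Subgroup.center H) := by
  exact SchurB.capable_aux hp G hG hna hk hd hM
end

section
/- Let G be a group of nilpotency class two (i.e., its commutator subgroup [G,G] is contained in its center Z(G)) such that the quotient G/Z(G) can be generated by d elements, where d is a (finite) natural number. Then the commutator subgroup [G,G] can be generated by at most d(d-1)/2 elements. -/
open scoped commutatorElement

/-- If `G` has nilpotency class (at most) two, i.e. `[G,G] ≤ Z(G)`, and `G/Z(G)` can be
generated by `d` elements, then `[G,G]` can be generated by at most `d*(d-1)/2` elements. -/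
theorem commutator_generated_of_quotient_center_generated
    (G : Type*) [Group G] (d : ℕ)
    (hcl : commutator G ≤ Subgroup.center G)
    (hgen : ∃ S : Finset (G ⧸ Subgroup.center G), S.card ≤ d ∧
      Subgroup.closure (S : Set (G ⧸ Subgroup.center G)) = ⊤) :
    ∃ T : Finset G, T.card ≤ d * (d - 1) / 2 ∧
      Subgroup.closure (T : Set G) = commutator G := by
  classical
  obtain ⟨S, hSd, hS⟩ := hgen
  set n := S.card with hn
  let g : ℕ → G := fun i => if h : i < n then Quotient.out (S.equivFin.symm ⟨i, h⟩).1 else 1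
  have hg : ∀ s ∈ S, ∃ i < n, QuotientGroup.mk' (Subgroup.center G) (g i) = s := by
    intro s hs
    refine ⟨S.equivFin ⟨s, hs⟩, (S.equivFin ⟨s, hs⟩).2, ?_⟩
    simp [g, hn]
  let A : Set G := {x | ∃ i < n, g i = x}
  have hA : Subgroup.closure A ⊔ Subgroup.center G = ⊤ := by
    have h1 : (Subgroup.closure A).map (QuotientGroup.mk' (Subgroup.center G)) = ⊤ := by
      rw [eq_top_iff, ← hS, Subgroup.closure_le]
      intro s hs
      obtain ⟨i, hi, h⟩ := hg s hs
      exact ⟨g i, Subgroup.subset_closure ⟨i, hi, rfl⟩, h⟩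
    have h2 := Subgroup.comap_map_eq (QuotientGroup.mk' (Subgroup.center G)) (Subgroup.closure A)
    rw [h1, QuotientGroup.ker_mk', Subgroup.comap_top] at h2
    exact h2.symm
  let P : Finset (Σ _ : ℕ, ℕ) := (Finset.range n).sigma (fun j => Finset.range j)
  let T : Finset G := P.image (fun p => ⁅g p.1, g p.2⁆)
  have hTc : Subgroup.closure (T : Set G) ≤ commutator G := by
    rw [Subgroup.closure_le]
    intro x hx
    obtain ⟨p, _, rfl⟩ := Finset.mem_image.1 hx
    exact Subgroup.commutator_mem_commutator (Subgroup.mem_top _) (Subgroup.mem_top _)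
  refine ⟨T, ?_, le_antisymm hTc ?_⟩
  · refine Finset.card_image_le.trans ?_
    rw [Finset.card_sigma]
    simp only [Finset.card_range]
    rw [Finset.sum_range_id]
    gcongr
  set K := Subgroup.closure (T : Set G) with hK
  have hKn : K.Normal := ⟨fun k hk x => by
    have := Subgroup.mem_center_iff.1 (hcl (hTc hk)) x
    rw [this, mul_inv_cancel_right]; exact hk⟩
  have hlt : ∀ i j, j < i → i < n → ⁅g i, g j⁆ ∈ K := fun i j h hi =>
    Subgroup.subset_closure (Finset.mem_coe.2 (Finset.mem_image.2
      ⟨⟨i, j⟩, by simp [P, h, hi], rfl⟩))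
  have hAA : ∀ x ∈ A, ∀ y ∈ A, ⁅x, y⁆ ∈ K := by
    rintro _ ⟨i, hi, rfl⟩ _ ⟨j, hj, rfl⟩
    rcases lt_trichotomy i j with h | h | h
    · rw [← commutatorElement_inv]
      exact K.inv_mem (hlt j i h hj)
    · subst h
      simp [K.one_mem]
    · exact hlt i j h hi
  let C : G → Subgroup G := fun y =>
    (Subgroup.centralizer {(QuotientGroup.mk' K y)}).comap (QuotientGroup.mk' K)
  have hC : ∀ x y, x ∈ C y ↔ ⁅x, y⁆ ∈ K := by
    intro x y
    rw [← QuotientGroup.eq_one_iff (N := K), ← QuotientGroup.mk'_apply, map_commutatorElement,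
      commutatorElement_eq_one_iff_mul_comm]
    simp only [C, Subgroup.mem_comap, Subgroup.mem_centralizer_singleton_iff]
  have hZ : ∀ y, Subgroup.center G ≤ C y := by
    intro y z hz
    rw [hC, commutatorElement_eq_one_iff_mul_comm.2 (Subgroup.mem_center_iff.1 hz y).symm]
    exact K.one_mem
  have key : ∀ y : G, (∀ x ∈ A, ⁅x, y⁆ ∈ K) → ∀ x : G, ⁅x, y⁆ ∈ K := by
    intro y h x
    have : Subgroup.closure A ⊔ Subgroup.center G ≤ C y :=
      sup_le ((Subgroup.closure_le _).2 fun x hx => (hC x y).2 (h x hx)) (hZ y)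
    rw [hA] at this
    exact (hC x y).1 (this (Subgroup.mem_top x))
  rw [commutator_def, Subgroup.commutator_le]
  intro x _ y _
  refine key y (fun a ha => ?_) x
  rw [← commutatorElement_inv]
  exact K.inv_mem (key a (fun b hb => hAA b hb a ha) y)
end

section
/- Let p be a prime and m ≥ 2, n ≥ 1 integers, with p > 2, or p = 2 and m ≥ 3. Let G be a finite group generated by two elements a and b satisfying: the order of a is p^m, the order of b is p^n, [a,b] = a^{p^{m-1}}, [[a,b],a] = 1, [[a,b],b] = 1, and |G| = p^{m+n}. If the abelianization G/G' is homocyclic (a direct product of cyclic groups of the same order), then n = m - 1 and G is not capable (there is no group H with G isomorphic to H/Z(H)). -/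
theorem aux_conj {H : Type*} [Group H] (x y c w : H) (h1 : x * y = y * (x * c))
    (h2 : c * y = y * (c * w)) (hwy : Commute w y) (hwc : Commute w c) (k : ℕ) :
    x * y ^ k = y ^ k * (x * c ^ k * w ^ (k.choose 2)) := by
  have h3 : ∀ k : ℕ, c ^ k * y = y * (c ^ k * w ^ k) := by
    intro k
    have hs : SemiconjBy y (c * w) c := h2.symm
    have := hs.pow_right k
    rw [hwc.symm.mul_pow] at this
    exact this.eq.symm
  induction k with
  | zero => simp
  | succ k ih =>
    have e1 : (k + 1).choose 2 = k + k.choose 2 := by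
      rw [Nat.choose_succ_succ' k 1]; simp
    have hy : Commute (w ^ (k.choose 2)) y := hwy.pow_left _
    calc x * y ^ (k + 1) = (x * y ^ k) * y := by rw [pow_succ, mul_assoc]
      _ = y ^ k * (x * c ^ k * (w ^ (k.choose 2) * y)) := by rw [ih]; group
      _ = y ^ k * (x * (c ^ k * y) * w ^ (k.choose 2)) := by
          rw [hy.eq]; simp only [mul_assoc]
      _ = y ^ k * ((x * y) * (c ^ k * w ^ k) * w ^ (k.choose 2)) := by
          rw [h3]; simp only [mul_assoc]
      _ = y ^ (k + 1) * (x * c ^ (k + 1) * w ^ ((k + 1).choose 2)) := by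
          rw [h1, e1, pow_succ y, pow_succ' c, pow_add]; simp only [mul_assoc]

theorem aux_not_capable {p m : ℕ} (hp : p.Prime) (hm : 2 ≤ m)
    (hpm : 2 < p ∨ (p = 2 ∧ 3 ≤ m)) {H : Type*} [Group H] (x y z : H)
    (hz : z ∈ Subgroup.center H)
    (hxy : x * y = y * (x * (x ^ p ^ (m - 1) * z)))
    (hx : x ^ p ^ m ∈ Subgroup.center H) (hy : y ^ p ^ (m - 1) ∈ Subgroup.center H) :
    Commute (x ^ p ^ (m - 1)) y := by
  set q := p ^ (m - 1) with hq
  have hqm : p ^ m = q * p := by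
    rw [hq, ← pow_succ]; congr 1; omega
  have hzc : ∀ g, Commute z g := fun g => (Subgroup.mem_center_iff.1 hz g).symm
  set c := x ^ q * z with hc
  have hcx : Commute c x := ((Commute.refl x).pow_left q).mul_left (hzc x)
  have hk : ∀ k : ℕ, x ^ k * y = y * (x ^ k * c ^ k) := by
    intro k
    have hs : SemiconjBy y (x * c) x := hxy.symm
    have := hs.pow_right k
    rw [hcx.symm.mul_pow] at this
    exact this.eq.symm
  have hcp : c ^ (q * p) = 1 := by
    have h := hk (p ^ m)
    rw [← Subgroup.mem_center_iff.1 hx y, hqm] at h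
    have h' := mul_left_cancel h
    exact (mul_eq_left.1 h'.symm)
  set w := c ^ q with hw
  have h2 : c * y = y * (c * w) := by
    calc c * y = (x ^ q * y) * z := by rw [hc, mul_assoc, (hzc y).eq, mul_assoc]
      _ = y * (x ^ q * z * w) := by
        rw [hk q, mul_assoc, mul_assoc, mul_assoc, ← hw, (hzc w).eq]
      _ = y * (c * w) := rfl
  have hwc : Commute w c := (Commute.refl c).pow_left q
  have hwp : w ^ p = 1 := by rw [hw, ← pow_mul, hcp]
  have hpq : p ∣ q := dvd_pow_self p (by omega)
  have hwq : w ^ q = 1 := by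
    obtain ⟨d, hd⟩ := hpq
    rw [hd, pow_mul, hwp, one_pow]
  have hwy : Commute w y := by
    have hs : SemiconjBy y (c * w) c := h2.symm
    have := hs.pow_right q
    rw [hwc.symm.mul_pow, hwq, mul_one] at this
    exact this.eq.symm
  have hpc : p ∣ q.choose 2 := by
    apply hp.dvd_choose_pow (by norm_num)
    intro h
    rcases hpm with h3 | ⟨h3, h4⟩
    · have := Nat.le_of_dvd (by omega) (show p ∣ 2 by rw [h]; exact hpq)
      omega
    · have : 2 ^ 2 ≤ p ^ (m - 1) := by
        rw [h3]; exact Nat.pow_le_pow_right (by norm_num) (by omega)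
      omega
  have hwq2 : w ^ q.choose 2 = 1 := by
    obtain ⟨d, hd⟩ := hpc
    rw [hd, pow_mul, hwp, one_pow]
  have h := aux_conj x y c w hxy h2 hwy hwc q
  rw [hwq2, mul_one, ← hw, Subgroup.mem_center_iff.1 hy x] at h
  have hw1 : w = 1 := by
    have h' := mul_left_cancel h
    exact (mul_eq_left.1 h'.symm)
  have := hk q
  rw [← hw, hw1, mul_one] at this
  exact this

theorem aux_card {A : Type*} [CommGroup A] (x y : A)
    (hgen : Subgroup.closure {x, y} = ⊤) {M N : ℕ} (hM : 0 < M) (hN : 0 < N)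
    (hx : x ^ M = 1) (hy : y ^ N = 1) : Nat.card A ≤ M * N := by
  have h1 : 0 < orderOf x := Nat.pos_of_dvd_of_pos (orderOf_dvd_of_pow_eq_one hx) hM
  have h2 : 0 < orderOf y := Nat.pos_of_dvd_of_pos (orderOf_dvd_of_pow_eq_one hy) hN
  have : Finite (Subgroup.zpowers x) := Nat.finite_of_card_ne_zero (by
    rw [Nat.card_zpowers]; omega)
  have : Finite (Subgroup.zpowers y) := Nat.finite_of_card_ne_zero (by
    rw [Nat.card_zpowers]; omega)
  have hs : Function.Surjective
      (fun u : Subgroup.zpowers x × Subgroup.zpowers y => (u.1 : A) * (u.2 : A)) := by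
    intro g
    have hg : g ∈ Subgroup.closure {x, y} := by rw [hgen]; trivial
    obtain ⟨i, j, h⟩ := Subgroup.mem_closure_pair.1 hg
    exact ⟨⟨⟨x ^ i, i, rfl⟩, ⟨y ^ j, j, rfl⟩⟩, h⟩
  have := Nat.card_le_card_of_surjective _ hs
  rw [Nat.card_prod, Nat.card_zpowers, Nat.card_zpowers] at this
  exact this.trans (Nat.mul_le_mul (Nat.le_of_dvd hM (orderOf_dvd_of_pow_eq_one hx))
    (Nat.le_of_dvd hN (orderOf_dvd_of_pow_eq_one hy)))

theorem aux_le {A : Type*} [CommGroup A] (x y : A) {p s t e : ℕ} (hp : p.Prime)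
    (hgen : Subgroup.closure {x, y} = ⊤) (hs : 1 ≤ s)
    (hx : x ^ p ^ s = 1) (hy : y ^ p ^ t = 1) (hcard : p ^ (s + t) ≤ Nat.card A)
    (hdiv : ∀ g : A, g ^ p ^ (e - 1) = 1 → ∃ h : A, h ^ p = g) : e ≤ s := by
  by_contra hlt
  have hx' : x ^ p ^ (e - 1) = 1 := by
    have : p ^ (e - 1) = p ^ s * p ^ (e - 1 - s) := by rw [← pow_add]; congr 1; omega
    rw [this, pow_mul, hx, one_pow]
  obtain ⟨c, hc⟩ := hdiv x hx'
  have hg : c ∈ Subgroup.closure {x, y} := by rw [hgen]; trivial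
  obtain ⟨i, j, h⟩ := Subgroup.mem_closure_pair.1 hg
  have hx1 : x ^ (1 - p * i : ℤ) ∈ Subgroup.zpowers y := by
    refine ⟨j * p, ?_⟩
    have : x = x ^ (i * p) * y ^ (j * p) := by
      conv_lhs => rw [← hc, ← h, mul_pow]
      rw [zpow_mul, zpow_mul, zpow_natCast, zpow_natCast]
    have h5 : x ^ (1 - p * i : ℤ) = x * (x ^ (i * p))⁻¹ := by
      rw [zpow_sub, zpow_one, mul_comm i]
    change y ^ (j * p) = _
    rw [h5, eq_mul_inv_iff_mul_eq, mul_comm]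
    exact this.symm
  have hco : IsCoprime (1 - p * i : ℤ) ((p : ℤ) ^ s) :=
    IsCoprime.pow_right ⟨1, i, by ring⟩
  obtain ⟨u, v, huv⟩ := hco
  have hxy : x ∈ Subgroup.zpowers y := by
    have : x = (x ^ (1 - p * i : ℤ)) ^ u := by
      have h6 : x ^ ((p : ℤ) ^ s) = 1 := by exact_mod_cast hx
      calc x = x ^ (u * (1 - p * i) + v * (p : ℤ) ^ s) := by rw [huv, zpow_one]
        _ = _ := by
          rw [zpow_add, mul_comm v, zpow_mul x ((p : ℤ) ^ s), h6, one_zpow, mul_one,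
            mul_comm u, zpow_mul]
    rw [this]
    exact Subgroup.zpow_mem _ hx1 u
  have hgen' : Subgroup.closure {(1 : A), y} = ⊤ := by
    rw [← top_le_iff, ← hgen, Subgroup.closure_le]
    have hyc : y ∈ Subgroup.closure {(1 : A), y} := Subgroup.subset_closure (by simp)
    rintro g (rfl | rfl)
    · exact (Subgroup.zpowers_le.2 hyc) hxy
    · exact hyc
  have h7 := aux_card (1 : A) y hgen' one_pos (pow_pos hp.pos t) (one_pow 1) hy
  have : p ^ t < p ^ (s + t) := Nat.pow_lt_pow_right hp.one_lt (by omega)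
  omega

theorem aux_div {p r e : ℕ} (hp : p.Prime) (he : 1 ≤ e)
    (f : Fin r → Multiplicative (ZMod (p ^ e))) (hf : f ^ p ^ (e - 1) = 1) :
    ∃ g : Fin r → Multiplicative (ZMod (p ^ e)), g ^ p = f := by
  have key : ∀ v : ZMod (p ^ e), (p ^ (e - 1)) • v = 0 → ∃ w : ZMod (p ^ e), p • w = v := by
    intro v hv
    have : NeZero (p ^ e) := ⟨(pow_pos hp.pos e).ne'⟩
    have h1 : ((p ^ (e - 1) * v.val : ℕ) : ZMod (p ^ e)) = 0 := by
      rw [Nat.cast_mul, ZMod.natCast_zmod_val, ← nsmul_eq_mul, hv]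
    rw [ZMod.natCast_eq_zero_iff] at h1
    have h2 : p ^ e = p ^ (e - 1) * p := by rw [← pow_succ]; congr 1; omega
    conv at h1 => lhs; rw [h2]
    obtain ⟨d, hd⟩ := Nat.dvd_of_mul_dvd_mul_left (pow_pos hp.pos _) h1
    refine ⟨(d : ZMod (p ^ e)), ?_⟩
    rw [nsmul_eq_mul, ← Nat.cast_mul, ← hd, ZMod.natCast_zmod_val]
  have : ∀ i, ∃ w : ZMod (p ^ e), p • w = (f i).toAdd := by
    intro i
    apply key
    have := congrFun hf i
    exact congrArg Multiplicative.toAdd this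
  choose g hg using this
  refine ⟨fun i => Multiplicative.ofAdd (g i), ?_⟩
  funext i
  exact congrArg Multiplicative.ofAdd (hg i)

theorem aux_exp {p r e : ℕ} 
    (f : Fin r → Multiplicative (ZMod (p ^ e))) : f ^ p ^ e = 1 := by
  funext i
  have : (p ^ e) • (f i).toAdd = 0 := by
    rw [nsmul_eq_mul]; simp only [CharP.cast_eq_zero, zero_mul]
  exact congrArg Multiplicative.ofAdd this

open scoped commutatorElement in
theorem aux_abel {G : Type*} [Group G] [Finite G] (a b z : G)
    (hgen : Subgroup.closure {a, b} = ⊤) (hab : a⁻¹ * b⁻¹ * a * b = z)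
    (hca : Commute z a) (hcb : Commute z b) :
    Nat.card G ≤ orderOf z * Nat.card (Abelianization G) := by
  have hz : z ∈ Subgroup.center G := by
    rw [Subgroup.mem_center_iff]
    have : (⊤ : Subgroup G) ≤ Subgroup.centralizer {z} := by
      rw [← hgen, Subgroup.closure_le]
      rintro g (rfl | rfl)
      · exact Subgroup.mem_centralizer_singleton_iff.2 hca.symm.eq
      · exact Subgroup.mem_centralizer_singleton_iff.2 hcb.symm.eq
    intro g
    exact Subgroup.mem_centralizer_singleton_iff.1 (this (Subgroup.mem_top g))
  have hle : Subgroup.zpowers z ≤ Subgroup.center G := Subgroup.zpowers_le.2 hz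
  have : (Subgroup.zpowers z).Normal := by
    constructor
    intro n hn g
    rw [Subgroup.mem_center_iff.1 (hle hn) g]
    simpa using hn
  have hcomm : commutator G ≤ Subgroup.zpowers z := by
    let π := QuotientGroup.mk' (Subgroup.zpowers z)
    have hπab : Commute (π a) (π b) := by
      have h1 : π (a⁻¹ * b⁻¹ * a * b) = 1 := by
        rw [hab]; exact (QuotientGroup.eq_one_iff z).2 (Subgroup.mem_zpowers z)
      have h2 : π (a * b) = π (b * a) * π (a⁻¹ * b⁻¹ * a * b) := by
        rw [← map_mul]; congr 1; group
      rw [h1, mul_one, map_mul, map_mul] at h2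
      exact h2
    have hA : ∀ g, Commute (π g) (π a) := by
      have : (⊤ : Subgroup G) ≤ (Subgroup.centralizer {π a}).comap π := by
        rw [← hgen, Subgroup.closure_le]
        rintro g (rfl | rfl)
        · exact Subgroup.mem_centralizer_singleton_iff.2 rfl
        · exact Subgroup.mem_centralizer_singleton_iff.2 hπab.symm.eq
      intro g
      exact Subgroup.mem_centralizer_singleton_iff.1 (this (Subgroup.mem_top g))
    have hB : ∀ g, Commute (π g) (π b) := by
      have : (⊤ : Subgroup G) ≤ (Subgroup.centralizer {π b}).comap π := by
        rw [← hgen, Subgroup.closure_le]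
        rintro g (rfl | rfl)
        · exact Subgroup.mem_centralizer_singleton_iff.2 hπab.eq
        · exact Subgroup.mem_centralizer_singleton_iff.2 rfl
      intro g
      exact Subgroup.mem_centralizer_singleton_iff.1 (this (Subgroup.mem_top g))
    have hAll : ∀ g h, Commute (π g) (π h) := by
      intro g h
      have : (⊤ : Subgroup G) ≤ (Subgroup.centralizer {π g}).comap π := by
        rw [← hgen, Subgroup.closure_le]
        rintro k (rfl | rfl)
        · exact Subgroup.mem_centralizer_singleton_iff.2 (hA g).symm.eq
        · exact Subgroup.mem_centralizer_singleton_iff.2 (hB g).symm.eq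
      exact (Subgroup.mem_centralizer_singleton_iff.1 (this (Subgroup.mem_top h))).symm
    rw [commutator_def, Subgroup.commutator_le]
    intro g _ h _
    rw [← QuotientGroup.eq_one_iff]
    change π (Bracket.bracket g h) = 1
    rw [map_commutatorElement]
    exact commutatorElement_eq_one_iff_commute.2 (hAll g h)
  have h1 : Nat.card (commutator G) ≤ orderOf z := by
    rw [← Nat.card_zpowers]
    exact Subgroup.card_le_of_le hcomm
  rw [Subgroup.card_eq_card_quotient_mul_card_subgroup (commutator G), mul_comm]
  exact Nat.mul_le_mul_right _ h1

/-- Let `p` be a prime, `m ≥ 2`, `n ≥ 1`, with `p > 2`, or `p = 2` and `m ≥ 3`. Let `G`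
be a finite group generated by `a, b` with `|a| = p ^ m`, `|b| = p ^ n`,
`[a,b] = a⁻¹b⁻¹ab = a ^ (p ^ (m-1))`, `[a,b]` commuting with both `a` and `b`, and
`|G| = p ^ (m + n)`.  If `G/G'` is homocyclic (a direct product of cyclic groups of the
same order), then `n = m - 1` and `G` is not capable (no group `H` has `H/Z(H) ≅ G`). -/
theorem minimal_nonabelian_metacyclic_not_capable
    {p m n : ℕ} (hp : p.Prime) (hm : 2 ≤ m) (hn : 1 ≤ n)
    (hpm : 2 < p ∨ (p = 2 ∧ 3 ≤ m))
    (G : Type u) [Group G] [Finite G] (a b : G)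
    (hgen : Subgroup.closure {a, b} = ⊤)
    (ha : orderOf a = p ^ m) (hb : orderOf b = p ^ n)
    (hab : a⁻¹ * b⁻¹ * a * b = a ^ p ^ (m - 1))
    (hca : Commute (a⁻¹ * b⁻¹ * a * b) a) (hcb : Commute (a⁻¹ * b⁻¹ * a * b) b)
    (hG : Nat.card G = p ^ (m + n))
    (hhom : ∃ r e : ℕ, 1 ≤ e ∧
      Nonempty (Abelianization G ≃* (Fin r → Multiplicative (ZMod (p ^ e))))) :
    n = m - 1 ∧
      ¬ ∃ (H : Type u) (_ : Group H), Nonempty (G ≃* H ⧸ Subgroup.center H) := by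
  have hzo : orderOf (a ^ p ^ (m - 1)) = p := by
    rw [orderOf_pow_of_dvd (pow_pos hp.pos _).ne' (by rw [ha]; exact pow_dvd_pow p (by omega)), ha,
      Nat.pow_div (by omega) hp.pos]
    rw [show m - (m - 1) = 1 by omega, pow_one]
  have hcard : p ^ ((m - 1) + n) ≤ Nat.card (Abelianization G) := by
    have h := aux_abel a b _ hgen hab (hab ▸ hca) (hab ▸ hcb)
    rw [hzo, hG, show m + n = ((m - 1) + n) + 1 by omega, pow_succ', ] at h
    exact Nat.le_of_mul_le_mul_left h hp.pos
  have hnm : n = m - 1 := by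
    obtain ⟨r, e, he, ⟨φ⟩⟩ := hhom
    have hgen' : Subgroup.closure {Abelianization.of a, Abelianization.of b} = ⊤ := by
      have h := congrArg (Subgroup.map (Abelianization.of (G := G))) hgen
      rw [MonoidHom.map_closure, Set.image_pair,
        Subgroup.map_top_of_surjective (Abelianization.of (G := G))
          (QuotientGroup.mk'_surjective (commutator G))] at h
      exact h
    have hxx : (Abelianization.of a) ^ p ^ (m - 1) = 1 := by
      rw [← map_pow, ← hab]
      simp only [map_mul, map_inv]
      rw [mul_right_comm, mul_assoc]
      group
    have hyy : (Abelianization.of b) ^ p ^ n = 1 := by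
      rw [← map_pow, ← hb, pow_orderOf_eq_one, map_one]
    have hdiv : ∀ g : Abelianization G, g ^ p ^ (e - 1) = 1 → ∃ h : Abelianization G, h ^ p = g := by
      intro g hg
      obtain ⟨h, hh⟩ := aux_div hp he (φ g) (by rw [← map_pow, hg, map_one])
      exact ⟨φ.symm h, by rw [← map_pow, hh, φ.symm_apply_apply]⟩
    have hexp : ∀ g : Abelianization G, g ^ p ^ e = 1 := by
      intro g
      apply φ.injective
      rw [map_pow, map_one, aux_exp]
    have h1 := aux_le _ _ hp hgen' (by omega) hxx hyy hcard hdiv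
    have h2 := aux_le _ _ hp (by rw [Set.pair_comm]; exact hgen') hn hyy hxx
      (by rw [add_comm]; exact hcard) hdiv
    have h3 := aux_card _ _ hgen' (pow_pos hp.pos e) (pow_pos hp.pos e) (hexp _) (hexp _)
    rw [← pow_add] at h3
    have h4 := (Nat.pow_le_pow_iff_right hp.one_lt).1 (hcard.trans h3)
    omega
  refine ⟨hnm, ?_⟩
  rintro ⟨H, _, ⟨φ⟩⟩
  obtain ⟨x, hx⟩ := QuotientGroup.mk'_surjective (Subgroup.center H) (φ a)
  obtain ⟨y, hy⟩ := QuotientGroup.mk'_surjective (Subgroup.center H) (φ b)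
  let π := QuotientGroup.mk' (Subgroup.center H)
  have hπ : ∀ g, π g = 1 ↔ g ∈ Subgroup.center H := fun g => QuotientGroup.eq_one_iff g
  have hx : π x = φ a := hx
  have hy : π y = φ b := hy
  have hz : (x ^ p ^ (m - 1))⁻¹ * (x⁻¹ * y⁻¹ * x * y) ∈ Subgroup.center H := by
    rw [← hπ]
    simp only [map_mul, map_inv, map_pow, hx, hy]
    simp only [← map_mul, ← map_inv, ← map_pow, hab]
    simp
  have hcomm := aux_not_capable hp hm hpm x y _ hz (by group)
    (by rw [← hπ, map_pow, hx, ← map_pow, ← ha, pow_orderOf_eq_one, map_one])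
    (by rw [← hπ, map_pow, hy, ← map_pow, ← hnm, ← hb, pow_orderOf_eq_one, map_one])
  have hcen : x ^ p ^ (m - 1) ∈ Subgroup.center H := by
    set q := x ^ p ^ (m - 1) with hq
    have htop : (⊤ : Subgroup G) ≤
        ((Subgroup.centralizer {q}).map π).comap φ.toMonoidHom := by
      rw [← hgen, Subgroup.closure_le]
      rintro g (rfl | rfl)
      · exact ⟨x, Subgroup.mem_centralizer_singleton_iff.2
          ((Commute.refl x).pow_right _).eq, hx⟩
      · exact ⟨y, Subgroup.mem_centralizer_singleton_iff.2 hcomm.symm.eq, hy⟩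
    rw [Subgroup.mem_center_iff]
    intro g
    obtain ⟨g', hg', hgg⟩ := htop (Subgroup.mem_top (φ.symm (π g)))
    have hgg : π g' = π g := by rw [hgg]; exact φ.apply_symm_apply _
    have h1 : g'⁻¹ * g ∈ Subgroup.center H := by
      rw [← hπ, map_mul, map_inv, hgg, inv_mul_cancel]
    have h2 : Commute g' q := Subgroup.mem_centralizer_singleton_iff.1 hg'
    have h3 : Commute (g'⁻¹ * g) q := (Subgroup.mem_center_iff.1 h1 q).symm
    have := h2.mul_left h3
    rw [mul_inv_cancel_left] at this
    exact this.eq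
  rw [← hπ, map_pow, hx, ← map_pow] at hcen
  have h1 : a ^ p ^ (m - 1) = 1 := φ.injective (by rw [hcen, map_one])
  rw [h1, orderOf_one] at hzo
  exact hp.one_lt.ne hzo
end

section
/- Let p be a prime, m > 1 an integer, and let G be a finite group generated by two elements a, b such that: the order of a is p^m, the order of b is p^m, the commutator c = [a,b] has order p, c lies in the center Z(G), and |G| = p^{2m+1}. Then the Schur multiplier of G satisfies M(G) ≅ Z/p^{m-1}Z × Z/pZ × Z/pZ; that is, for any free presentation π : F → G with kernel R, the quotient (R ∩ [F,F])/[R,F] is isomorphic to the direct product of cyclic groups of orders p^{m-1}, p, and p. -/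
section helpers

open scoped commutatorElement

/-- `i * (i - 1) / 2`. -/
def tri (i : ℤ) : ℤ := i * (i - 1) / 2

lemma two_tri (i : ℤ) : 2 * tri i = i * (i - 1) := by
  unfold tri
  apply Int.mul_ediv_cancel'
  have := Int.even_mul_pred_self i
  exact this.two_dvd

lemma tri_add (i j : ℤ) : tri (i + j) = tri i + tri j + i * j := by
  have h1 := two_tri i
  have h2 := two_tri j
  have h3 := two_tri (i + j)
  have : 2 * tri (i + j) = 2 * (tri i + tri j + i * j) := by
    rw [h3]; linear_combination - h1 - h2
  omega

lemma tri_neg (i : ℤ) : tri (-i) = tri i + i := by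
  have h1 := two_tri i
  have h3 := two_tri (-i)
  have : 2 * tri (-i) = 2 * (tri i + i) := by
    rw [h3]; linear_combination - h1
  omega

lemma tri_zero : tri 0 = 0 := by simp [tri]
lemma tri_one : tri 1 = 0 := by simp [tri]

lemma dvd_tri {p m : ℕ} (hp : p.Prime) (hm : 1 < m) {i : ℤ} (hi : ((p ^ m : ℕ) : ℤ) ∣ i) :
    (p : ℤ) ∣ tri i := by
  have h := two_tri i
  rcases hp.eq_two_or_odd' with rfl | hodd
  · have h4 : (4 : ℤ) ∣ i := by
      refine dvd_trans ?_ hi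
      obtain ⟨k, rfl⟩ := Nat.exists_eq_add_of_lt hm
      refine ⟨2 ^ k, ?_⟩
      push_cast
      ring
    obtain ⟨t, rfl⟩ := h4
    refine ⟨t * (4 * t - 1), ?_⟩
    push_cast
    linarith
  · have hpi : (p : ℤ) ∣ i := by
      refine dvd_trans ?_ hi
      exact_mod_cast dvd_pow_self p (by omega : m ≠ 0)
    have h2 : (p : ℤ) ∣ 2 * tri i := by rw [h]; exact hpi.mul_right _
    refine IsCoprime.dvd_of_dvd_mul_left ?_ h2
    have : Nat.Coprime p 2 := Nat.coprime_two_right.mpr hodd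
    exact_mod_cast Nat.isCoprime_iff_coprime.mpr this

/-- The free nilpotent group of class three and rank two, in coordinates. -/
@[ext] structure HH where
  i : ℤ
  j : ℤ
  k : ℤ
  l : ℤ
  n : ℤ

namespace HH

instance : Mul HH := ⟨fun g h => ⟨g.i + h.i, g.j + h.j, g.k + h.k + g.i * h.j,
  g.l + h.l + g.i * h.k + tri g.i * h.j, g.n + h.n + g.k * h.j + g.i * tri h.j⟩⟩
instance : One HH := ⟨⟨0, 0, 0, 0, 0⟩⟩
instance : Inv HH := ⟨fun g => ⟨-g.i, -g.j, -g.k + g.i * g.j,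
  -g.l - g.i * (-g.k + g.i * g.j) + tri g.i * g.j, -g.n + g.k * g.j - g.i * (tri g.j + g.j)⟩⟩

lemma mul_def (g h : HH) : g * h = ⟨g.i + h.i, g.j + h.j, g.k + h.k + g.i * h.j,
  g.l + h.l + g.i * h.k + tri g.i * h.j, g.n + h.n + g.k * h.j + g.i * tri h.j⟩ := rfl
lemma one_def : (1 : HH) = ⟨0, 0, 0, 0, 0⟩ := rfl
lemma inv_def (g : HH) : g⁻¹ = ⟨-g.i, -g.j, -g.k + g.i * g.j,
  -g.l - g.i * (-g.k + g.i * g.j) + tri g.i * g.j, -g.n + g.k * g.j - g.i * (tri g.j + g.j)⟩ := rfl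

instance : Group HH := Group.ofLeftAxioms
  (by
    intro g h u
    simp only [mul_def, tri_add, HH.mk.injEq]
    refine ⟨by ring, by ring, by ring, by ring, by ring⟩)
  (by
    intro g
    simp [mul_def, one_def, tri_zero])
  (by
    intro g
    simp only [mul_def, one_def, inv_def, tri_neg, HH.mk.injEq]
    have h1 := two_tri g.i
    have h2 := two_tri g.j
    refine ⟨by ring, by ring, by ring, ?_, ?_⟩
    · linear_combination g.j * h1
    · linear_combination -g.i * h2)

lemma comm_def (g h : HH) : ⁅g, h⁆ = ⟨0, 0, g.i * h.j - h.i * g.j,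
    g.i * h.k + tri g.i * h.j - h.i * g.k - tri h.i * g.j,
    g.k * h.j + g.i * tri h.j - h.k * g.j - h.i * tri g.j
      - (g.i * h.j - h.i * g.j) * (g.j + h.j)⟩ := by
  rw [commutatorElement_def, mul_inv_eq_iff_eq_mul, mul_inv_eq_iff_eq_mul]
  simp only [mul_def, tri_zero, HH.mk.injEq]
  refine ⟨by ring, by ring, by ring, by ring, by ring⟩

/-- The subgroup receiving the commutators of the kernel. -/
def KK (P p : ℤ) : Subgroup HH where
  carrier := {g | g.i = 0 ∧ g.j = 0 ∧ P ∣ g.k ∧ p ∣ g.l ∧ p ∣ g.n}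
  one_mem' := by simp [one_def]
  mul_mem' := by
    rintro g h ⟨h1, h2, h3, h4, h5⟩ ⟨k1, k2, k3, k4, k5⟩
    simp only [mul_def, Set.mem_ofPred_eq, h1, h2, k1, k2, tri_zero]
    simp [dvd_add, h3, h4, h5, k3, k4, k5]
  inv_mem' := by
    rintro g ⟨h1, h2, h3, h4, h5⟩
    simp only [inv_def, Set.mem_ofPred_eq, h1, h2, tri_zero]
    simp [h3, h4, h5]

lemma mem_KK {P p : ℤ} {g : HH} :
    g ∈ KK P p ↔ g.i = 0 ∧ g.j = 0 ∧ P ∣ g.k ∧ p ∣ g.l ∧ p ∣ g.n := Iff.rfl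

lemma pow_central (k l n : ℤ) (u : ℕ) :
    (⟨0, 0, k, l, n⟩ : HH) ^ u = ⟨0, 0, u * k, u * l, u * n⟩ := by
  induction u with
  | zero => simp [one_def]
  | succ u ih =>
    rw [pow_succ, ih]
    simp only [mul_def, tri_zero, HH.mk.injEq]
    push_cast
    refine ⟨by simp, by simp, by ring, by ring, by ring⟩

lemma zpow_central (k l n : ℤ) (u : ℤ) :
    (⟨0, 0, k, l, n⟩ : HH) ^ u = ⟨0, 0, u * k, u * l, u * n⟩ := by
  rcases Int.eq_nat_or_neg u with ⟨t, rfl | rfl⟩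
  · rw [zpow_natCast, pow_central]
  · rw [zpow_neg, zpow_natCast, pow_central]
    simp [inv_def, tri_zero]

lemma comm_mem_KK {p m : ℕ} (hp : p.Prime) (hm : 1 < m) (g h : HH)
    (hi : ((p ^ m : ℕ) : ℤ) ∣ g.i) (hj : ((p ^ m : ℕ) : ℤ) ∣ g.j) (hk : (p : ℤ) ∣ g.k) :
    ⁅g, h⁆ ∈ KK ((p ^ m : ℕ) : ℤ) p := by
  have hpP : (p : ℤ) ∣ ((p ^ m : ℕ) : ℤ) := by
    exact_mod_cast dvd_pow_self p (by omega : m ≠ 0)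
  have ti := dvd_tri hp hm hi
  have tj := dvd_tri hp hm hj
  have pi := hpP.trans hi
  have pj := hpP.trans hj
  rw [comm_def, mem_KK]
  refine ⟨rfl, rfl, dvd_sub (hi.mul_right _) (hj.mul_left _), ?_, ?_⟩
  · exact dvd_sub (dvd_sub (dvd_add (pi.mul_right _) (ti.mul_right _)) (hk.mul_left _))
      (pj.mul_left _)
  · exact dvd_sub (dvd_sub (dvd_sub (dvd_add (hk.mul_right _) (pi.mul_right _)) (pj.mul_left _))
      (tj.mul_left _)) ((dvd_sub (pi.mul_right _) (pj.mul_left _)).mul_right _)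

/-- Lower bound for a pair of elements congruent to the generators. -/
lemma lower {p m : ℕ} (hp : p.Prime) (hm : 1 < m) (A B : HH)
    (hAi : ((p ^ m : ℕ) : ℤ) ∣ A.i - 1) (hAj : ((p ^ m : ℕ) : ℤ) ∣ A.j)
    (hBi : ((p ^ m : ℕ) : ℤ) ∣ B.i) (hBj : ((p ^ m : ℕ) : ℤ) ∣ B.j - 1)
    (u v w : ℤ)
    (h : ((⁅A, B⁆) ^ p) ^ u * ⁅⁅A, B⁆, A⁆ ^ v * ⁅⁅A, B⁆, B⁆ ^ w ∈ KK ((p ^ m : ℕ) : ℤ) p) :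
    ((p ^ (m - 1) : ℕ) : ℤ) ∣ u ∧ (p : ℤ) ∣ v ∧ (p : ℤ) ∣ w := by
  have hpP : (p : ℤ) ∣ ((p ^ m : ℕ) : ℤ) := by
    exact_mod_cast dvd_pow_self p (by omega : m ≠ 0)
  have hK : ((p ^ m : ℕ) : ℤ) ∣ A.i * B.j - B.i * A.j - 1 := by
    have : A.i * B.j - B.i * A.j - 1 = (A.i - 1) * B.j + (B.j - 1) - B.i * A.j := by ring
    rw [this]
    exact dvd_sub (dvd_add (hAi.mul_right _) hBj) (hBi.mul_right _)
  rw [comm_def A B] at h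
  generalize (A.i * B.j - B.i * A.j) = K at h hK
  generalize A.i * B.k + tri A.i * B.j - B.i * A.k - tri B.i * A.j = X at h
  generalize A.k * B.j + A.i * tri B.j - B.k * A.j - B.i * tri A.j - K * (A.j + B.j) = Y at h
  rw [comm_def, comm_def] at h
  simp only [tri_zero] at h
  simp only [zero_mul, mul_zero, sub_zero, zero_sub, zero_add, add_zero] at h
  rw [pow_central, zpow_central, zpow_central, zpow_central, mem_KK] at h
  simp only [mul_def, tri_zero] at h
  simp only [zero_mul, mul_zero, sub_zero, zero_sub, zero_add, add_zero, true_and] at h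
  obtain ⟨h1, h2, h3⟩ := h
  have pAi := hpP.trans hAi
  have pAj := hpP.trans hAj
  have pBi := hpP.trans hBi
  have pBj := hpP.trans hBj
  have pK := hpP.trans hK
  have hp0 : (p : ℤ) ≠ 0 := by exact_mod_cast hp.ne_zero
  refine ⟨?_, ?_, ?_⟩
  · have e : ((p ^ m : ℕ) : ℤ) = p * ((p ^ (m - 1) : ℕ) : ℤ) := by
      rw [← Nat.cast_mul, ← pow_succ']
      congr 2
      omega
    have h4 : ((p ^ m : ℕ) : ℤ) ∣ p * u := by
      have : (p : ℤ) * u = u * (p * K) - (K - 1) * (p * u) := by ring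
      rw [this]
      exact dvd_sub h1 (hK.mul_right _)
    rw [e] at h4
    exact Int.dvd_of_mul_dvd_mul_left hp0 h4
  · rw [← (ZMod.intCast_zmod_eq_zero_iff_dvd _ p)] at *
    push_cast at *
    simp only [sub_eq_zero] at *
    simp_all
  · rw [← (ZMod.intCast_zmod_eq_zero_iff_dvd _ p)] at *
    push_cast at *
    simp only [sub_eq_zero] at *
    simp_all

end HH


lemma iso_of_gens {M : Type*} [Group M] (N p : ℕ) (s x y : M)
    (hcomm : ∀ g h : M, g * h = h * g)
    (hs : s ^ N = 1) (hx : x ^ p = 1) (hy : y ^ p = 1)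
    (hsurj : ∀ g : M, ∃ u v w : ℤ, g = s ^ u * x ^ v * y ^ w)
    (hinj : ∀ u v w : ℤ, s ^ u * x ^ v * y ^ w = 1 → (N : ℤ) ∣ u ∧ (p : ℤ) ∣ v ∧ (p : ℤ) ∣ w) :
    Nonempty (M ≃* (Multiplicative (ZMod N) × Multiplicative (ZMod p) × Multiplicative (ZMod p))) := by
  let _ : CommGroup M := { (inferInstance : Group M) with mul_comm := hcomm }
  have key : ∀ (n : ℕ) (t : M), t ^ n = 1 → ∃ f : Multiplicative (ZMod n) →* M,
      ∀ k : ℤ, f (Multiplicative.ofAdd (k : ZMod n)) = t ^ k := by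
    intro n t ht
    refine ⟨AddMonoidHom.toMultiplicativeLeft
      (ZMod.lift n ⟨AddMonoidHom.toMultiplicativeLeft.symm (zpowersHom M t), ?_⟩), ?_⟩
    · apply Additive.toMul.injective
      simpa using ht
    · intro k
      simp
  obtain ⟨f, hf⟩ := key N s hs
  obtain ⟨g, hg⟩ := key p x hx
  obtain ⟨h, hh⟩ := key p y hy
  let Φ := f.coprod (g.coprod h)
  have hΦ : ∀ u v w : ℤ, Φ (Multiplicative.ofAdd (u : ZMod N), Multiplicative.ofAdd (v : ZMod p),
      Multiplicative.ofAdd (w : ZMod p)) = s ^ u * x ^ v * y ^ w := by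
    intro u v w
    simp only [Φ, MonoidHom.coprod_apply, hf, hg, hh, mul_assoc]
  refine ⟨(MulEquiv.ofBijective Φ ⟨?_, ?_⟩).symm⟩
  · rw [injective_iff_map_eq_one]
    rintro ⟨u, v, w⟩ h1
    obtain ⟨u, rfl⟩ := Multiplicative.ofAdd.surjective u
    obtain ⟨v, rfl⟩ := Multiplicative.ofAdd.surjective v
    obtain ⟨w, rfl⟩ := Multiplicative.ofAdd.surjective w
    obtain ⟨u, rfl⟩ := ZMod.intCast_surjective u
    obtain ⟨v, rfl⟩ := ZMod.intCast_surjective v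
    obtain ⟨w, rfl⟩ := ZMod.intCast_surjective w
    rw [hΦ] at h1
    obtain ⟨h1, h2, h3⟩ := hinj _ _ _ h1
    rw [(ZMod.intCast_zmod_eq_zero_iff_dvd _ _).2 h1, (ZMod.intCast_zmod_eq_zero_iff_dvd _ _).2 h2,
      (ZMod.intCast_zmod_eq_zero_iff_dvd _ _).2 h3]
    rfl
  · intro z
    obtain ⟨u, v, w, rfl⟩ := hsurj z
    exact ⟨_, hΦ u v w⟩

lemma comm_pow_eq_one {E : Type*} [Group E] {c a : E} (p : ℕ)
    (hx : ⁅c, a⁆ ∈ Subgroup.center E) (hc : c ^ p ∈ Subgroup.center E) : ⁅c, a⁆ ^ p = 1 := by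
  have h1 : c * a = ⁅c, a⁆ * (a * c) := by simp [commutatorElement_def, mul_assoc]
  generalize ⁅c, a⁆ = x at *
  rw [Subgroup.mem_center_iff] at hx hc
  have h2 : a⁻¹ * c * a = x * c := by
    rw [mul_assoc, h1, ← mul_assoc, hx, mul_assoc, inv_mul_cancel_left]
  have h3 : (a⁻¹ * c * a) ^ p = a⁻¹ * c ^ p * a := by
    simpa using conj_pow (i := p) (a := a⁻¹) (b := c)
  rw [h2, (show Commute x c from (hx c).symm).mul_pow, hc a⁻¹, mul_assoc, inv_mul_cancel, mul_one] at h3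
  exact mul_eq_right.mp h3

lemma comm_pow_main {E : Type*} [Group E] {a b : E} {p m : ℕ} (hp : p.Prime) (hm : 1 < m)
    (hx : ⁅⁅a, b⁆, a⁆ ∈ Subgroup.center E) (hxp : ⁅⁅a, b⁆, a⁆ ^ p = 1)
    (hc : a ^ (p ^ m) ∈ Subgroup.center E) : ⁅a, b⁆ ^ (p ^ m) = 1 := by
  have h0 : a * b = ⁅a, b⁆ * b * a := by simp [commutatorElement_def, mul_assoc]
  generalize ⁅a, b⁆ = c at *
  have h1 : c * a = ⁅c, a⁆ * (a * c) := by simp [commutatorElement_def, mul_assoc]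
  generalize ⁅c, a⁆ = x at *
  rw [Subgroup.mem_center_iff] at hx hc
  have hX : ∀ g, Commute x g := fun g => (hx g).symm
  have h2 : a * c = x⁻¹ * (c * a) := by rw [h1, inv_mul_cancel_left]
  have h3 : ∀ n : ℕ, a * c ^ n = (x ^ (-(n : ℤ))) * (c ^ n * a) := by
    intro n
    have : (a * c * a⁻¹) ^ n = a * c ^ n * a⁻¹ := conj_pow
    rw [h2, ← mul_assoc, mul_inv_cancel_right, ((hX c).inv_left).mul_pow, eq_mul_inv_iff_mul_eq] at this
    rw [← this, zpow_neg, zpow_natCast, inv_pow, mul_assoc]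
  have h4 : ∀ n : ℕ, a ^ n * b = x ^ (-tri n) * c ^ n * b * a ^ n := by
    intro n
    induction n with
    | zero => simp [tri_zero]
    | succ n ih =>
      have e : a * x ^ (-tri n) = x ^ (-tri n) * a := ((hX a).zpow_left _).symm.eq
      have t : -tri ((n + 1 : ℕ) : ℤ) = -tri n + (-(n : ℤ)) := by
        push_cast; rw [tri_add, tri_one]; ring
      calc a ^ (n + 1) * b = a * (a ^ n * b) := by rw [pow_succ', mul_assoc]
        _ = (a * x ^ (-tri n)) * c ^ n * b * a ^ n := by rw [ih]; simp only [mul_assoc]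
        _ = x ^ (-tri n) * (a * c ^ n) * b * a ^ n := by rw [e]; simp only [mul_assoc]
        _ = x ^ (-tri n) * x ^ (-(n : ℤ)) * c ^ n * (a * b) * a ^ n := by
          rw [h3]; simp only [mul_assoc]
        _ = _ := by
          rw [h0, t, zpow_add, pow_succ, pow_succ']; simp only [mul_assoc]
  have h5 := h4 (p ^ m)
  have h6 : x ^ (-tri ((p ^ m : ℕ) : ℤ)) = 1 := by
    obtain ⟨t, ht⟩ := dvd_tri hp hm (dvd_refl ((p ^ m : ℕ) : ℤ))
    rw [ht, zpow_neg, zpow_mul, zpow_natCast, hxp]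
    simp
  rw [h6, one_mul, ← hc b, hc] at h5
  rw [hc (c ^ p ^ m * b)] at h5
  have h7 := mul_left_cancel h5
  exact (mul_eq_right.mp h7.symm)

lemma upper {E G : Type*} [Group E] [Group G] (q : E →* G) (hq : q.ker ≤ Subgroup.center E)
    {p m : ℕ} (hp : p.Prime) (hm : 1 < m) (a b : E) (hgen : Subgroup.closure {q a, q b} = ⊤)
    (ha : (q a) ^ (p ^ m) = 1) (hcz : ⁅q a, q b⁆ ∈ Subgroup.center G) (hcp : ⁅q a, q b⁆ ^ p = 1) :
    ⁅⁅a, b⁆, a⁆ ∈ q.ker ∧ ⁅⁅a, b⁆, b⁆ ∈ q.ker ∧ ⁅⁅a, b⁆, a⁆ ^ p = 1 ∧ ⁅⁅a, b⁆, b⁆ ^ p = 1 ∧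
      ⁅a, b⁆ ^ (p ^ m) = 1 ∧ ∀ e ∈ commutator E, ∃ u v w : ℤ,
        e = ⁅a, b⁆ ^ u * (⁅⁅a, b⁆, a⁆ ^ v * ⁅⁅a, b⁆, b⁆ ^ w) := by
  have hk : ∀ g, ⁅⁅a, b⁆, g⁆ ∈ q.ker := by
    intro g
    rw [MonoidHom.mem_ker, map_commutatorElement, map_commutatorElement,
      commutatorElement_eq_one_iff_mul_comm]
    exact (Subgroup.mem_center_iff.mp hcz _).symm
  have hcp' : ⁅a, b⁆ ^ p ∈ Subgroup.center E := by
    apply hq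
    rw [MonoidHom.mem_ker, map_pow, map_commutatorElement, hcp]
  have hxz := hq (hk a)
  have hyz := hq (hk b)
  have hxp := comm_pow_eq_one p hxz hcp'
  refine ⟨hk a, hk b, hxp, comm_pow_eq_one p hyz hcp',
    comm_pow_main hp hm hxz hxp (hq (by rw [MonoidHom.mem_ker, map_pow, ha])), ?_⟩
  have hab : a * b = ⁅a, b⁆ * (b * a) := by simp [commutatorElement_def, mul_assoc]
  have hgrp : ∀ c g : E, g * c * g⁻¹ = ⁅c, g⁆⁻¹ * c := by
    intro c g; simp [commutatorElement_def, mul_assoc]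
  have hca : a * ⁅a, b⁆ * a⁻¹ = ⁅⁅a, b⁆, a⁆⁻¹ * ⁅a, b⁆ := by
    exact hgrp _ _
  have hcb : b * ⁅a, b⁆ * b⁻¹ = ⁅⁅a, b⁆, b⁆⁻¹ * ⁅a, b⁆ := by
    exact hgrp _ _
  generalize ⁅⁅a, b⁆, a⁆ = x at *
  generalize ⁅⁅a, b⁆, b⁆ = y at *
  generalize ⁅a, b⁆ = c at *
  have hX : ∀ g, Commute x g := fun g => (Subgroup.mem_center_iff.mp hxz g).symm
  have hY : ∀ g, Commute y g := fun g => (Subgroup.mem_center_iff.mp hyz g).symm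
  let S : Subgroup E :=
    { carrier := {e | ∃ u v w : ℤ, e = c ^ u * (x ^ v * y ^ w)}
      one_mem' := ⟨0, 0, 0, by simp⟩
      mul_mem' := by
        rintro _ _ ⟨u, v, w, rfl⟩ ⟨u', v', w', rfl⟩
        refine ⟨u + u', v + v', w + w', ?_⟩
        rw [Commute.mul_mul_mul_comm
            (((hX (c ^ u')).zpow_left v).mul_left ((hY (c ^ u')).zpow_left w)),
          Commute.mul_mul_mul_comm ((hY (x ^ v')).zpow_left w), zpow_add, zpow_add, zpow_add]
      inv_mem' := by
        rintro _ ⟨u, v, w, rfl⟩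
        refine ⟨-u, -v, -w, ?_⟩
        rw [mul_inv_rev, mul_inv_rev, zpow_neg, zpow_neg, zpow_neg,
          ((hX (y ^ w)⁻¹).zpow_left v).inv_left.eq]
        refine (Commute.eq ?_)
        exact (((hY _).zpow_left _).inv_left).mul_left ((hX _).zpow_left _).inv_left }
  have hcS : c ∈ S := ⟨1, 0, 0, by simp⟩
  have hxS : x ∈ S := ⟨0, 1, 0, by simp⟩
  have hyS : y ∈ S := ⟨0, 0, 1, by simp⟩
  have hconj : ∀ g, g * c * g⁻¹ ∈ S → ∀ s ∈ S, g * s * g⁻¹ ∈ S := by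
    rintro g hg _ ⟨u, v, w, rfl⟩
    have e : g * (c ^ u * (x ^ v * y ^ w)) * g⁻¹ = (g * c * g⁻¹) ^ u * (x ^ v * y ^ w) := by
      rw [conj_zpow]
      have : Commute (x ^ v * y ^ w) g⁻¹ := ((hX _).zpow_left _).mul_left ((hY _).zpow_left _)
      simp only [mul_assoc, this.eq]
    rw [e]
    exact S.mul_mem (S.zpow_mem hg _) (S.mul_mem (S.zpow_mem hxS _) (S.zpow_mem hyS _))
  have hnorm : ∀ g z, z ∈ S → (∀ h, Commute z h) → g * c * g⁻¹ = z⁻¹ * c →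
      g ∈ Subgroup.normalizer (S : Set E) := by
    intro g z hz hZ h
    rw [Subgroup.mem_normalizer_iff]
    intro s
    constructor
    · exact hconj g (by rw [h]; exact S.mul_mem (S.inv_mem hz) hcS) s
    · intro hs
      have h' : g⁻¹ * c * g⁻¹⁻¹ = z * c := by
        have : c = z * (g * c * g⁻¹) := by rw [h, mul_inv_cancel_left]
        have h2 : g⁻¹ * c = z * (c * g⁻¹) := by
          conv_lhs => rw [this]
          rw [← mul_assoc, ← (hZ g⁻¹).eq]
          simp only [mul_assoc, inv_mul_cancel_left]
        rw [h2]; simp [mul_assoc]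
      have := hconj g⁻¹ (by rw [h']; exact S.mul_mem hz hcS) _ hs
      simpa [mul_assoc] using this
  have hgenE : Subgroup.closure ({a, b} ∪ (q.ker : Set E)) = ⊤ := by
    rw [eq_top_iff]
    intro e _
    have h1 : q e ∈ (Subgroup.closure {a, b}).map q := by
      rw [MonoidHom.map_closure, Set.image_pair, hgen]; trivial
    obtain ⟨h, hh, he⟩ := h1
    have : e = h * (h⁻¹ * e) := by group
    rw [this]
    refine Subgroup.mul_mem _ (Subgroup.closure_mono Set.subset_union_left hh)
      (Subgroup.subset_closure (Or.inr ?_))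
    show q _ = 1
    simp [he]
  have hSn : S.Normal := by
    rw [← Subgroup.normalizer_eq_top_iff, eq_top_iff, ← hgenE, Subgroup.closure_le]
    rintro g ((rfl | rfl) | hg)
    · exact hnorm _ x hxS hX hca
    · exact hnorm _ y hyS hY hcb
    · refine hnorm _ 1 S.one_mem (fun h => Commute.one_left h) ?_
      have := Subgroup.mem_center_iff.mp (hq hg) c
      rw [← this]; simp
  have habS : (QuotientGroup.mk' S) a * QuotientGroup.mk' S b
      = QuotientGroup.mk' S b * QuotientGroup.mk' S a := by
    rw [← map_mul, hab, map_mul]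
    have : QuotientGroup.mk' S c = 1 := (QuotientGroup.eq_one_iff c).2 hcS
    rw [this, one_mul, map_mul]
  have hN : ∀ g ∈ q.ker, ∀ h, QuotientGroup.mk' S g * QuotientGroup.mk' S h
      = QuotientGroup.mk' S h * QuotientGroup.mk' S g := by
    intro g hg h
    rw [← map_mul, ← Subgroup.mem_center_iff.mp (hq hg) h, map_mul]
  have hcen1 : ∀ t ∈ ({a, b} ∪ (q.ker : Set E)), ∀ h, QuotientGroup.mk' S t * QuotientGroup.mk' S h
      = QuotientGroup.mk' S h * QuotientGroup.mk' S t := by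
    intro t ht h
    have : (⊤ : Subgroup E) ≤ (Subgroup.centralizer {QuotientGroup.mk' S t}).comap
        (QuotientGroup.mk' S) := by
      rw [← hgenE, Subgroup.closure_le]
      intro g hg
      show QuotientGroup.mk' S g ∈ Subgroup.centralizer {QuotientGroup.mk' S t}
      rw [Subgroup.mem_centralizer_singleton_iff]
      rcases hg with (rfl | rfl) | hg
      · rcases ht with (rfl | rfl) | ht
        · rfl
        · exact habS
        · exact (hN t ht _).symm
      · rcases ht with (rfl | rfl) | ht
        · exact habS.symm
        · rfl
        · exact (hN t ht _).symm
      · exact hN g hg _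
    have h2 := this (Subgroup.mem_top h)
    rw [Subgroup.mem_comap, Subgroup.mem_centralizer_singleton_iff] at h2
    exact h2.symm
  have hcen : (⊤ : Subgroup E) ≤ (Subgroup.center (E ⧸ S)).comap (QuotientGroup.mk' S) := by
    rw [← hgenE, Subgroup.closure_le]
    intro g hg
    show QuotientGroup.mk' S g ∈ Subgroup.center (E ⧸ S)
    rw [Subgroup.mem_center_iff]
    intro z
    obtain ⟨h, rfl⟩ := QuotientGroup.mk'_surjective S z
    exact (hcen1 g hg h).symm
  have hle : commutator E ≤ S := by
    rw [commutator_def, Subgroup.commutator_le]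
    intro g _ h _
    rw [← QuotientGroup.eq_one_iff, ← QuotientGroup.mk'_apply, map_commutatorElement,
      commutatorElement_eq_one_iff_mul_comm]
    exact (Subgroup.mem_center_iff.mp (hcen (Subgroup.mem_top g)) _).symm
  intro e he
  exact hle he

lemma zpow_mul_zpow_comm {G : Type*} [Group G] (a b : G) (hcz : ⁅a, b⁆ ∈ Subgroup.center G)
    (i j : ℤ) : a ^ i * b ^ j = b ^ j * a ^ i * ⁅a, b⁆ ^ (i * j) := by
  have hab : a * b = ⁅a, b⁆ * (b * a) := by simp [commutatorElement_def, mul_assoc]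
  generalize ⁅a, b⁆ = c at *
  have hC : ∀ g, Commute c g := fun g => (Subgroup.mem_center_iff.mp hcz g).symm
  have h1 : b⁻¹ * a * b = c * a := by
    rw [mul_assoc, hab, (hC (b * a)).eq, mul_assoc, inv_mul_cancel_left, (hC a).eq]
  have h2 : b⁻¹ * a ^ i * b = c ^ i * a ^ i := by
    have := conj_zpow (i := i) (a := b⁻¹) (b := a)
    rw [inv_inv] at this
    rw [← this, h1, (hC a).mul_zpow]
  have h3 : a ^ i * b * (a ^ i)⁻¹ = b * c ^ i := by
    rw [mul_inv_eq_iff_eq_mul, mul_assoc, ← h2, mul_assoc, mul_inv_cancel_left]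
  have h4 : a ^ i * b ^ j * (a ^ i)⁻¹ = b ^ j * (c ^ i) ^ j := by
    rw [← conj_zpow, h3]
    exact Commute.mul_zpow (((hC b).zpow_left i).symm) j
  rw [mul_inv_eq_iff_eq_mul] at h4
  rw [h4, ← zpow_mul, mul_assoc, mul_assoc, ((hC (a ^ i)).zpow_left _).eq]

/-- The map from the free nilpotent group onto the special group. -/
def psi {G : Type*} [Group G] (a b : G) (hcz : ⁅a, b⁆ ∈ Subgroup.center G) : HH →* G :=
  MonoidHom.mk' (fun g => b ^ g.j * a ^ g.i * ⁅a, b⁆ ^ g.k) (by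
    intro g h
    have hC : ∀ t, Commute ⁅a, b⁆ t := fun t => (Subgroup.mem_center_iff.mp hcz t).symm
    have e := zpow_mul_zpow_comm a b hcz g.i h.j
    simp only [HH.mul_def]
    generalize ⁅a, b⁆ = c at *
    rw [Commute.mul_mul_mul_comm ((hC (b ^ h.j * a ^ h.i)).zpow_left g.k)]
    rw [show b ^ g.j * a ^ g.i * (b ^ h.j * a ^ h.i) = b ^ g.j * (a ^ g.i * b ^ h.j) * a ^ h.i by
      simp only [mul_assoc]]
    rw [e, zpow_add, zpow_add, zpow_add, zpow_add]
    have e2 := ((hC (a ^ h.i * (c ^ g.k * c ^ h.k))).zpow_left (g.i * h.j)).eq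
    simp only [mul_assoc] at e2 ⊢
    rw [e2])

lemma psi_apply {G : Type*} [Group G] (a b : G) (hcz : ⁅a, b⁆ ∈ Subgroup.center G) (g : HH) :
    psi a b hcz g = b ^ g.j * a ^ g.i * ⁅a, b⁆ ^ g.k := rfl

lemma psi_surj {G : Type*} [Group G] (a b : G) (hcz : ⁅a, b⁆ ∈ Subgroup.center G)
    (hgen : Subgroup.closure {a, b} = ⊤) : Function.Surjective (psi a b hcz) := by
  rw [← MonoidHom.range_eq_top, eq_top_iff, ← hgen, Subgroup.closure_le]
  rintro g (rfl | rfl)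
  · exact ⟨⟨1, 0, 0, 0, 0⟩, by simp [psi_apply]⟩
  · exact ⟨⟨0, 1, 0, 0, 0⟩, by simp [psi_apply]⟩

lemma psi_ker {p m : ℕ} (hp : p.Prime) {G : Type*} [Group G] [Finite G] (a b : G)
    (hcz : ⁅a, b⁆ ∈ Subgroup.center G)
    (hgen : Subgroup.closure {a, b} = ⊤) (ha : orderOf a = p ^ m) (hb : orderOf b = p ^ m)
    (hc : orderOf ⁅a, b⁆ = p) (hG : Nat.card G = p ^ (2 * m + 1)) (g : HH)
    (hg : psi a b hcz g = 1) :
    ((p ^ m : ℕ) : ℤ) ∣ g.i ∧ ((p ^ m : ℕ) : ℤ) ∣ g.j ∧ (p : ℤ) ∣ g.k := by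
  have hs := psi_surj a b hcz hgen
  haveI : NeZero p := ⟨hp.ne_zero⟩
  haveI : NeZero (p ^ m) := ⟨pow_ne_zero _ hp.ne_zero⟩
  let f : ZMod (p ^ m) × ZMod (p ^ m) × ZMod p → G := fun t =>
    b ^ ((t.1.val : ℕ) : ℤ) * a ^ ((t.2.1.val : ℕ) : ℤ) * ⁅a, b⁆ ^ ((t.2.2.val : ℕ) : ℤ)
  have hf : ∀ i j k : ℤ, f ((j : ZMod (p ^ m)), (i : ZMod (p ^ m)), (k : ZMod p))
      = b ^ j * a ^ i * ⁅a, b⁆ ^ k := by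
    intro i j k
    have e1 : b ^ (j % ((p ^ m : ℕ) : ℤ)) = b ^ j := by rw [← hb, zpow_mod_orderOf]
    have e2 : a ^ (i % ((p ^ m : ℕ) : ℤ)) = a ^ i := by rw [← ha, zpow_mod_orderOf]
    have e3 : ⁅a, b⁆ ^ (k % (p : ℤ)) = ⁅a, b⁆ ^ k := by
      conv_lhs => rw [← hc, zpow_mod_orderOf]
    simp only [f, ZMod.val_intCast, e1, e2, e3]
  have hfs : Function.Surjective f := by
    intro z
    obtain ⟨h, rfl⟩ := hs z
    exact ⟨_, hf h.i h.j h.k⟩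
  have hfb : Function.Bijective f := by
    refine hfs.bijective_of_nat_card_le ?_
    rw [hG, Nat.card_prod, Nat.card_prod, Nat.card_zmod, Nat.card_zmod]
    apply le_of_eq; ring
  have h0 := hf 0 0 0
  have h1 := hf g.i g.j g.k
  rw [← psi_apply a b hcz, hg] at h1
  have h2 := hfb.1 (h1.trans (by rw [h0]; simp))
  simp only [Prod.mk.injEq, Int.cast_zero] at h2
  obtain ⟨h2, h3, h4⟩ := h2
  exact ⟨(ZMod.intCast_zmod_eq_zero_iff_dvd _ _).1 h3, (ZMod.intCast_zmod_eq_zero_iff_dvd _ _).1 h2,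
    (ZMod.intCast_zmod_eq_zero_iff_dvd _ _).1 h4⟩

lemma main_aux {p m : ℕ} (hp : p.Prime) (hm : 1 < m)
    (G : Type*) [Group G] [Finite G] (a b : G)
    (hgen : Subgroup.closure {a, b} = ⊤)
    (ha : orderOf a = p ^ m) (hb : orderOf b = p ^ m)
    (hc : orderOf ⁅a, b⁆ = p) (hcz : ⁅a, b⁆ ∈ Subgroup.center G)
    (hG : Nat.card G = p ^ (2 * m + 1))
    (α : Type*) (π : FreeGroup α →* G) (hπ : Function.Surjective π) :
      Nonempty (((π.ker ⊓ commutator (FreeGroup α) : Subgroup (FreeGroup α)) ⧸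
          (⁅π.ker, (⊤ : Subgroup (FreeGroup α))⁆.subgroupOf
            (π.ker ⊓ commutator (FreeGroup α)))) ≃*
        (Multiplicative (ZMod (p ^ (m - 1))) ×
          Multiplicative (ZMod p) × Multiplicative (ZMod p))) := by
  -- the lift to the free nilpotent group
  have hs := psi_surj a b hcz hgen
  choose lf hlf using hs
  let φ : FreeGroup α →* HH := FreeGroup.lift (fun t => lf (π (FreeGroup.of t)))
  have hφ : ∀ f, psi a b hcz (φ f) = π f := by
    intro f
    have : (psi a b hcz).comp φ = π := by
      ext t
      simp [φ, hlf]
    exact DFunLike.congr_fun this f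
  have hφK : ⁅π.ker, (⊤ : Subgroup (FreeGroup α))⁆ ≤ (HH.KK ((p ^ m : ℕ) : ℤ) p).comap φ := by
    rw [Subgroup.commutator_le]
    intro g hg h _
    rw [Subgroup.mem_comap, map_commutatorElement]
    have := psi_ker hp a b hcz hgen ha hb hc hG (φ g) (by rw [hφ]; exact hg)
    exact HH.comm_mem_KK hp hm _ _ this.1 this.2.1 this.2.2
  obtain ⟨A, hA⟩ := hπ a
  obtain ⟨B, hB⟩ := hπ b
  set V : Subgroup (FreeGroup α) := ⁅π.ker, (⊤ : Subgroup (FreeGroup α))⁆ with hV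
  set D : Subgroup (FreeGroup α) := π.ker ⊓ commutator (FreeGroup α) with hD
  have hVker : V ≤ π.ker := Subgroup.commutator_le_left _ _
  let q : FreeGroup α ⧸ V →* G := QuotientGroup.lift V π (fun x hx => hVker hx)
  have hqm : ∀ f, q (QuotientGroup.mk' V f) = π f := fun f => rfl
  have hq : q.ker ≤ Subgroup.center (FreeGroup α ⧸ V) := by
    intro z hz
    obtain ⟨f, rfl⟩ := QuotientGroup.mk'_surjective V z
    rw [Subgroup.mem_center_iff]
    intro y
    obtain ⟨g, rfl⟩ := QuotientGroup.mk'_surjective V y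
    symm
    rw [← commutatorElement_eq_one_iff_mul_comm, ← map_commutatorElement]
    exact (QuotientGroup.eq_one_iff _).2 (Subgroup.commutator_mem_commutator hz (Subgroup.mem_top g))
  obtain ⟨hxk, hyk, hxp, hyp, hcp, hall⟩ := upper q hq hp hm (QuotientGroup.mk' V A)
    (QuotientGroup.mk' V B) (by rw [hqm, hqm, hA, hB, hgen])
    (by rw [hqm, hA, ← ha, pow_orderOf_eq_one]) (by rwa [hqm, hqm, hA, hB])
    (by rw [hqm, hqm, hA, hB]; conv_lhs => rw [← hc, pow_orderOf_eq_one])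
  simp only [← map_commutatorElement] at hxk hyk hxp hyp hcp hall
  have hCcomm : ∀ g h : FreeGroup α, ⁅g, h⁆ ∈ commutator (FreeGroup α) := fun g h =>
    Subgroup.commutator_mem_commutator (Subgroup.mem_top g) (Subgroup.mem_top h)
  have hπC : π ⁅A, B⁆ = ⁅a, b⁆ := by rw [map_commutatorElement, hA, hB]
  have hsD : ⁅A, B⁆ ^ p ∈ D := by
    refine ⟨?_, Subgroup.pow_mem _ (hCcomm _ _) _⟩
    show π _ = 1
    rw [map_pow, hπC]
    conv_lhs => rw [← hc, pow_orderOf_eq_one]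
  have hxD : ⁅⁅A, B⁆, A⁆ ∈ D := ⟨hxk, hCcomm _ _⟩
  have hyD : ⁅⁅A, B⁆, B⁆ ∈ D := ⟨hyk, hCcomm _ _⟩
  let ι : D ⧸ V.subgroupOf D →* FreeGroup α ⧸ V :=
    QuotientGroup.lift (V.subgroupOf D) ((QuotientGroup.mk' V).comp D.subtype) (by
      intro x hx
      exact (QuotientGroup.eq_one_iff _).2 (Subgroup.mem_subgroupOf.mp hx))
  have hιm : ∀ d : D, ι (QuotientGroup.mk' _ d) = QuotientGroup.mk' V (d : FreeGroup α) :=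
    fun d => rfl
  have hιinj : Function.Injective ι := by
    rw [injective_iff_map_eq_one]
    intro z hz
    obtain ⟨d, rfl⟩ := QuotientGroup.mk'_surjective _ z
    rw [hιm] at hz
    exact (QuotientGroup.eq_one_iff _).2 (Subgroup.mem_subgroupOf.mpr
      ((QuotientGroup.eq_one_iff _).1 hz))
  have hιker : ∀ z, ι z ∈ q.ker := by
    intro z
    obtain ⟨d, rfl⟩ := QuotientGroup.mk'_surjective _ z
    exact d.2.1
  have hpm : p * p ^ (m - 1) = p ^ m := by
    rw [← pow_succ']; congr 1; omega
  refine iso_of_gens (p ^ (m - 1)) p (QuotientGroup.mk' _ ⟨_, hsD⟩) (QuotientGroup.mk' _ ⟨_, hxD⟩)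
    (QuotientGroup.mk' _ ⟨_, hyD⟩) ?_ ?_ ?_ ?_ ?_ ?_
  · intro g h
    apply hιinj
    rw [map_mul, map_mul]
    exact (Subgroup.mem_center_iff.mp (hq (hιker h)) _)
  · apply hιinj
    rw [map_pow, hιm, map_one, map_pow, ← pow_mul, hpm]
    exact hcp
  · apply hιinj
    rw [map_pow, hιm, map_one]
    exact hxp
  · apply hιinj
    rw [map_pow, hιm, map_one]
    exact hyp
  · intro g
    obtain ⟨d, rfl⟩ := QuotientGroup.mk'_surjective _ g
    have hd : QuotientGroup.mk' V (d : FreeGroup α) ∈ commutator (FreeGroup α ⧸ V) := by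
      have h1 : (commutator (FreeGroup α)).map (QuotientGroup.mk' V) ≤ commutator _ := by
        rw [commutator_def, Subgroup.map_commutator]
        exact Subgroup.commutator_mono le_top le_top
      exact h1 ⟨_, d.2.2, rfl⟩
    obtain ⟨u, v, w, h⟩ := hall _ hd
    have h1 := congrArg q h
    have hx1 : q (QuotientGroup.mk' V ⁅⁅A, B⁆, A⁆) = 1 := hxk
    have hy1 : q (QuotientGroup.mk' V ⁅⁅A, B⁆, B⁆) = 1 := hyk
    have hd1 : π (d : FreeGroup α) = 1 := d.2.1
    simp only [map_mul, map_zpow, hx1, hy1, one_zpow, mul_one] at h1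
    rw [hqm, hqm, hd1, hπC] at h1
    obtain ⟨t, rfl⟩ : (p : ℤ) ∣ u := by
      have := orderOf_dvd_iff_zpow_eq_one.2 h1.symm
      rwa [hc] at this
    refine ⟨t, v, w, hιinj ?_⟩
    rw [hιm, h, map_mul, map_mul, map_zpow, map_zpow, map_zpow, hιm, hιm, hιm, zpow_mul,
      mul_assoc, map_pow, zpow_natCast]
  · intro u v w h
    rw [← map_zpow, ← map_zpow, ← map_zpow, ← map_mul, ← map_mul] at h
    have h1 := Subgroup.mem_subgroupOf.mp ((QuotientGroup.eq_one_iff _).1 h)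
    have h2 := hφK h1
    rw [Subgroup.mem_comap] at h2
    simp only [Subgroup.coe_mul, Subgroup.coe_zpow, map_mul, map_zpow, map_pow,
      map_commutatorElement] at h2
    have kA := psi_ker hp a b hcz hgen ha hb hc hG (⟨1, 0, 0, 0, 0⟩⁻¹ * φ A) (by
      rw [map_mul, map_inv, hφ, hA]
      simp [psi_apply])
    have kB := psi_ker hp a b hcz hgen ha hb hc hG (⟨0, 1, 0, 0, 0⟩⁻¹ * φ B) (by
      rw [map_mul, map_inv, hφ, hB]
      simp [psi_apply])
    simp only [HH.mul_def, HH.inv_def] at kA kB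
    refine HH.lower hp hm (φ A) (φ B) ?_ ?_ ?_ ?_ u v w h2
    · have := kA.1
      rwa [neg_add_eq_sub] at this
    · simpa using kA.2.1
    · simpa using kB.1
    · have := kB.2.1
      rwa [neg_add_eq_sub] at this

lemma comm_swap {G : Type*} [Group G] (a b : G) (h : a⁻¹ * b⁻¹ * a * b ∈ Subgroup.center G) :
    ⁅a, b⁆ = a⁻¹ * b⁻¹ * a * b := by
  have h1 := Subgroup.mem_center_iff.mp h (b * a)
  rw [commutatorElement_def, mul_inv_eq_iff_eq_mul, mul_inv_eq_iff_eq_mul, mul_assoc _ b a, ← h1]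
  group

end helpers


/-- Let `p` be a prime, `m > 1`, and `G` a finite group generated by `a, b` with
`|a| = |b| = p ^ m`, `c = [a,b] = a⁻¹b⁻¹ab` of order `p` and central, and
`|G| = p ^ (2m+1)`.  Then for every free presentation `π : F → G` (with `F` a free
group and kernel `R = ker π`), the Hopf quotient `(R ∩ [F,F])/[R,F]` is isomorphic to
`ZMod (p^(m-1)) × ZMod p × ZMod p`. -/
theorem schur_multiplier_of_special_group
    {p m : ℕ} (hp : p.Prime) (hm : 1 < m)
    (G : Type*) [Group G] [Finite G] (a b : G)
    (hgen : Subgroup.closure {a, b} = ⊤)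
    (ha : orderOf a = p ^ m) (hb : orderOf b = p ^ m)
    (hc : orderOf (a⁻¹ * b⁻¹ * a * b) = p)
    (hcz : a⁻¹ * b⁻¹ * a * b ∈ Subgroup.center G)
    (hG : Nat.card G = p ^ (2 * m + 1)) :
    ∀ (α : Type*) (π : FreeGroup α →* G), Function.Surjective π →
      Nonempty (((π.ker ⊓ commutator (FreeGroup α) : Subgroup (FreeGroup α)) ⧸
          (⁅π.ker, (⊤ : Subgroup (FreeGroup α))⁆.subgroupOf
            (π.ker ⊓ commutator (FreeGroup α)))) ≃*
        (Multiplicative (ZMod (p ^ (m - 1))) ×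
          Multiplicative (ZMod p) × Multiplicative (ZMod p))) := by
  intro α π hπ
  have e := comm_swap a b hcz
  rw [← e] at hc hcz
  exact main_aux hp hm G a b hgen ha hb hc hcz hG α π hπ
end

section
/- Let p be a prime and let G be a non-abelian finite p-group of order p^n such that |G'| ≥ p^2, the abelianization G/G' is isomorphic to Z/p^m Z × Z/p^m Z, and G' = Z(G) is cyclic of order p^k with k ≥ 2. Then |M(G)| = p^{(1/2)(2-1)(n+k-2)+1} (the bound with d = 2) if and only if p ≠ 2, m ≥ 2, and there exist elements a, b generating G with: the order of a is p^m, the order of b is p^m, the commutator c = [a,b] has order p^m, c lies in Z(G), and |G| = p^{3m} (in particular k = m). -/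
section Calc

variable {Q : Type*} [Group Q]

theorem aux_pow_left {d a u : Q} (h : d * a = a * d * u) (hu : ∀ x, u * x = x * u) (i : ℕ) :
    d ^ i * a = a * d ^ i * u ^ i := by
  induction i with
  | zero => simp
  | succ i ih =>
    have hu' : u ^ i * d = d * u ^ i := ((show Commute u d from hu d).pow_left i).eq
    have hu2 : u * d ^ i = d ^ i * u := hu _
    calc d ^ (i + 1) * a = d * (d ^ i * a) := by rw [pow_succ']; group
      _ = (d * a) * d ^ i * u ^ i := by rw [ih]; group
      _ = a * d * (u * d ^ i) * u ^ i := by rw [h]; group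
      _ = a * d * (d ^ i * u) * u ^ i := by rw [hu2]
      _ = a * (d * d ^ i) * (u * u ^ i) := by group
      _ = _ := by rw [← pow_succ', ← pow_succ']

theorem aux_pow_right {d a u : Q} (h : d * a = a * d * u) (hu : ∀ x, u * x = x * u) (i : ℕ) :
    d * a ^ i = a ^ i * d * u ^ i := by
  induction i with
  | zero => simp
  | succ i ih =>
    have hu' : u ^ i * a = a * u ^ i := ((show Commute u a from hu a).pow_left i).eq
    calc d * a ^ (i + 1) = (d * a ^ i) * a := by rw [pow_succ]; group
      _ = a ^ i * d * (u ^ i * a) := by rw [ih]; group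
      _ = a ^ i * (d * a) * u ^ i := by rw [hu']; group
      _ = (a ^ i * a) * d * (u * u ^ i) := by rw [h]; group
      _ = _ := by rw [← pow_succ, ← pow_succ']

theorem aux_b_apow {a b d u : Q} (hba : b * a = a * b * d) (hda : d * a = a * d * u)
    (hu : ∀ x, u * x = x * u) (i : ℕ) :
    b * a ^ i = a ^ i * b * d ^ i * u ^ (i.choose 2) := by
  induction i with
  | zero => simp
  | succ i ih =>
    have hu' : u ^ (i.choose 2) * a = a * u ^ (i.choose 2) :=
      ((show Commute u a from hu a).pow_left _).eq
    have hc : (i + 1).choose 2 = i + i.choose 2 := by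
      rw [Nat.choose_succ_succ' i 1, Nat.choose_one_right]
    calc b * a ^ (i + 1) = (b * a ^ i) * a := by rw [pow_succ]; group
      _ = a ^ i * b * d ^ i * (u ^ (i.choose 2) * a) := by rw [ih]; group
      _ = a ^ i * b * (d ^ i * a) * u ^ (i.choose 2) := by rw [hu']; group
      _ = a ^ i * (b * a) * d ^ i * (u ^ i * u ^ (i.choose 2)) := by
        rw [aux_pow_left hda hu]; group
      _ = (a ^ i * a) * b * (d * d ^ i) * (u ^ i * u ^ (i.choose 2)) := by rw [hba]; group
      _ = _ := by rw [← pow_succ, ← pow_succ', ← pow_add, hc]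

theorem aux_bpow_a {a b d v : Q} (hba : b * a = a * b * d) (hdb : d * b = b * d * v)
    (hv : ∀ x, v * x = x * v) (i : ℕ) :
    b ^ i * a = a * b ^ i * d ^ i * v ^ (i.choose 2) := by
  induction i with
  | zero => simp
  | succ i ih =>
    have hc : (i + 1).choose 2 = i + i.choose 2 := by
      rw [Nat.choose_succ_succ' i 1, Nat.choose_one_right]
    have hv' : v ^ i * d ^ i = d ^ i * v ^ i := ((show Commute v d from hv d).pow_pow _ _).eq
    calc b ^ (i + 1) * a = b * (b ^ i * a) := by rw [pow_succ']; group
      _ = (b * a) * b ^ i * d ^ i * v ^ (i.choose 2) := by rw [ih]; group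
      _ = a * b * (d * b ^ i) * d ^ i * v ^ (i.choose 2) := by rw [hba]; group
      _ = a * (b * b ^ i) * d * (v ^ i * d ^ i) * v ^ (i.choose 2) := by
        rw [aux_pow_right hdb hv]; group
      _ = a * (b * b ^ i) * (d * d ^ i) * (v ^ i * v ^ (i.choose 2)) := by rw [hv']; group
      _ = _ := by rw [← pow_succ', ← pow_succ', ← pow_add, hc]

variable {G : Type*} [Group G]

theorem gen_top (π : Q →* G) {a b : Q}
    (hgen : Subgroup.closure {π a, π b} = ⊤) (H : Subgroup Q) (ha : a ∈ H) (hb : b ∈ H)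
    (hk : π.ker ≤ H) : H = ⊤ := by
  have h1 : H.map π = ⊤ := by
    rw [eq_top_iff, ← hgen, Subgroup.closure_le]
    rintro x (rfl | rfl)
    · exact ⟨a, ha, rfl⟩
    · exact ⟨b, hb, rfl⟩
  rw [← Subgroup.comap_map_eq_self hk, h1, Subgroup.comap_top]

theorem comm_le (π : Q →* G) {a b d u v : Q}
    (hgen : Subgroup.closure {π a, π b} = ⊤)
    (hk : π.ker ≤ Subgroup.center Q)
    (hba : b * a = a * b * d) (hda : d * a = a * d * u) (hdb : d * b = b * d * v)
    (hu : ∀ x, u * x = x * u) (hv : ∀ x, v * x = x * v) :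
    commutator Q ≤ Subgroup.closure {d, u, v} := by
  set S := Subgroup.closure {d, u, v} with hS
  have hdS : d ∈ S := Subgroup.subset_closure (by simp)
  have huS : u ∈ S := Subgroup.subset_closure (by simp)
  have hvS : v ∈ S := Subgroup.subset_closure (by simp)
  have key : ∀ q : Q, q * d * q⁻¹ ∈ S → ∀ s ∈ S, q * s * q⁻¹ ∈ S := by
    intro q hq
    have : S ≤ S.comap (MulAut.conj q).toMonoidHom := by
      conv_lhs => rw [hS]
      rw [Subgroup.closure_le]
      rintro x (rfl | rfl | rfl)
      · simpa using hq
      · simpa [← hu] using huS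
      · simpa [← hv] using hvS
    intro s hs
    simpa using this hs
  have e1 : a⁻¹ * d * a = d * u := by
    rw [mul_assoc, hda]; group
  have e2 : a * d * a⁻¹ = d * u⁻¹ := by
    rw [mul_inv_eq_iff_eq_mul, mul_assoc, inv_mul_eq_of_eq_mul (b := a) (c := a * u⁻¹)]
    · rw [← mul_assoc, hda]; group
    · rw [← mul_assoc, hu]; group
  have f1 : b⁻¹ * d * b = d * v := by
    rw [mul_assoc, hdb]; group
  have f2 : b * d * b⁻¹ = d * v⁻¹ := by
    rw [mul_inv_eq_iff_eq_mul, mul_assoc, inv_mul_eq_of_eq_mul (b := b) (c := b * v⁻¹)]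
    · rw [← mul_assoc, hdb]; group
    · rw [← mul_assoc, hv]; group
  have hnorm : Subgroup.normalizer (S : Set Q) = ⊤ := by
    have mem : ∀ q : Q, q * d * q⁻¹ ∈ S → q⁻¹ * d * q ∈ S → q ∈ Subgroup.normalizer (S : Set Q) := by
      intro q h1 h2
      rw [Subgroup.mem_normalizer_iff]
      intro s
      refine ⟨key q h1 s, fun h => ?_⟩
      have := key q⁻¹ (by simpa using h2) _ h
      simpa [mul_assoc] using this
    apply gen_top π hgen
    · apply mem
      · rw [e2]; exact S.mul_mem hdS (S.inv_mem huS)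
      · rw [e1]; exact S.mul_mem hdS huS
    · apply mem
      · rw [f2]; exact S.mul_mem hdS (S.inv_mem hvS)
      · rw [f1]; exact S.mul_mem hdS hvS
    · intro q hq
      have hc := Subgroup.mem_center_iff.1 (hk hq)
      apply mem
      · rw [← hc]; simpa using hdS
      · rw [mul_assoc, hc]; simpa using hdS
  have : S.Normal := Subgroup.normalizer_eq_top_iff.1 hnorm
  have hcomm : (QuotientGroup.mk' S) b * (QuotientGroup.mk' S) a =
      (QuotientGroup.mk' S) a * (QuotientGroup.mk' S) b := by
    rw [← map_mul, ← map_mul, hba, map_mul _ (a * b) d]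
    have : (QuotientGroup.mk' S) d = 1 := by
      rw [← MonoidHom.mem_ker, QuotientGroup.ker_mk']; exact hdS
    rw [this, mul_one]
  have hcent : ∀ x : Q, (x = a ∨ x = b) → ∀ y : Q,
      (QuotientGroup.mk' S) y * (QuotientGroup.mk' S) x =
      (QuotientGroup.mk' S) x * (QuotientGroup.mk' S) y := by
    intro x hx
    have : (Subgroup.centralizer {(QuotientGroup.mk' S) x}).comap (QuotientGroup.mk' S) = ⊤ := by
      apply gen_top π hgen
      · rw [Subgroup.mem_comap, Subgroup.mem_centralizer_singleton_iff]
        rcases hx with rfl | rfl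
        · rfl
        · exact hcomm.symm
      · rw [Subgroup.mem_comap, Subgroup.mem_centralizer_singleton_iff]
        rcases hx with rfl | rfl
        · exact hcomm
        · rfl
      · intro q hq
        rw [Subgroup.mem_comap, Subgroup.mem_centralizer_singleton_iff, ← map_mul, ← map_mul,
          Subgroup.mem_center_iff.1 (hk hq)]
    intro y
    have hy : y ∈ (Subgroup.centralizer {(QuotientGroup.mk' S) x}).comap (QuotientGroup.mk' S) := by
      rw [this]; trivial
    exact Subgroup.mem_centralizer_singleton_iff.1 hy
  have hcen : (Subgroup.center (Q ⧸ S)).comap (QuotientGroup.mk' S) = ⊤ := by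
    apply gen_top π hgen
    · rw [Subgroup.mem_comap, Subgroup.mem_center_iff]
      intro g
      obtain ⟨y, rfl⟩ := QuotientGroup.mk'_surjective S g
      exact hcent a (Or.inl rfl) y
    · rw [Subgroup.mem_comap, Subgroup.mem_center_iff]
      intro g
      obtain ⟨y, rfl⟩ := QuotientGroup.mk'_surjective S g
      exact hcent b (Or.inr rfl) y
    · intro q hq
      rw [Subgroup.mem_comap, Subgroup.mem_center_iff]
      intro g
      obtain ⟨y, rfl⟩ := QuotientGroup.mk'_surjective S g
      rw [← map_mul, ← map_mul, Subgroup.mem_center_iff.1 (hk hq)]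
  rw [commutator_def, Subgroup.commutator_le]
  intro x _ y _
  have hx : x ∈ (Subgroup.center (Q ⧸ S)).comap (QuotientGroup.mk' S) := by rw [hcen]; trivial
  have h3 := Subgroup.mem_center_iff.1 (Subgroup.mem_comap.1 hx) (QuotientGroup.mk' S y)
  rw [← QuotientGroup.ker_mk' S, MonoidHom.mem_ker, map_commutatorElement, 
    commutatorElement_eq_one_iff_mul_comm]
  exact h3.symm

end Calc

/-- A group of order `|A|^5` covering the Heisenberg group over `A`. -/
@[ext] structure CoverK (A : Type) (h : A) where
  x : A
  y : A
  z : A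
  u : A
  v : A

section Cover

variable {A : Type} [CommRing A] {h : A}

instance : Mul (CoverK A h) := ⟨fun g g' =>
  ⟨g.x + g'.x, g.y + g'.y, g.z + g'.z + g.y * g'.x,
   g.u + g'.u + g'.x * g.z + h * g'.x ^ 2 * g.y,
   g.v + g'.v + g.y * g'.z + h * g.y ^ 2 * g'.x⟩⟩

instance : One (CoverK A h) := ⟨⟨0, 0, 0, 0, 0⟩⟩

instance : Inv (CoverK A h) := ⟨fun g =>
  ⟨-g.x, -g.y, -g.z + g.y * g.x, -g.u + g.x * g.z - g.y * g.x ^ 2 + h * g.x ^ 2 * g.y,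
    -g.v + g.y * g.z - h * g.y ^ 2 * g.x⟩⟩

theorem CoverK.mul_def (g g' : CoverK A h) : g * g' =
  ⟨g.x + g'.x, g.y + g'.y, g.z + g'.z + g.y * g'.x,
   g.u + g'.u + g'.x * g.z + h * g'.x ^ 2 * g.y,
   g.v + g'.v + g.y * g'.z + h * g.y ^ 2 * g'.x⟩ := rfl

theorem CoverK.one_def : (1 : CoverK A h) = ⟨0, 0, 0, 0, 0⟩ := rfl

theorem CoverK.inv_def (g : CoverK A h) : g⁻¹ =
  ⟨-g.x, -g.y, -g.z + g.y * g.x, -g.u + g.x * g.z - g.y * g.x ^ 2 + h * g.x ^ 2 * g.y,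
    -g.v + g.y * g.z - h * g.y ^ 2 * g.x⟩ := rfl

instance [hh : Fact (2 * h = 1)] : Group (CoverK A h) :=
  Group.ofLeftAxioms
    (by
      intro a b c
      have := hh.out
      simp only [CoverK.mul_def]
      ext
      · simp only []; ring
      · simp only []; ring
      · simp only []; ring
      · simp only []; linear_combination (-(c.x * a.y * b.x)) * this
      · simp only []; linear_combination ((b.y * a.y * c.x)) * this)
    (by intro a; simp only [CoverK.mul_def, CoverK.one_def]; ext <;> simp)
    (by intro a; simp only [CoverK.mul_def, CoverK.one_def, CoverK.inv_def]; ext <;> simp only [] <;> ring)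

theorem CoverK.pow_uv [hh : Fact (2 * h = 1)] (u v : A) (i : ℕ) :
    (⟨0, 0, 0, u, v⟩ : CoverK A h) ^ i = ⟨0, 0, 0, i * u, i * v⟩ := by
  induction i with
  | zero => simp [CoverK.one_def]
  | succ i ih =>
    rw [pow_succ, ih, CoverK.mul_def]
    ext <;> simp <;> ring

end Cover

section Hopf

variable (G : Type*) [Group G]

/-- The universal central quotient `F/[R,F]`. -/
abbrev HopfQ := FreeGroup G ⧸ ⁅(FreeGroup.lift (id : G → G)).ker, (⊤ : Subgroup (FreeGroup G))⁆

/-- The projection `F/[R,F] → G`. -/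
noncomputable def hopfPi : HopfQ G →* G :=
  QuotientGroup.lift _ (FreeGroup.lift (id : G → G)) (Subgroup.commutator_le_left _ _)

theorem hopfPi_mk (f : FreeGroup G) :
    hopfPi G (QuotientGroup.mk' _ f) = FreeGroup.lift (id : G → G) f := rfl

theorem hopfPi_surj : Function.Surjective (hopfPi G) := fun g =>
  ⟨QuotientGroup.mk' _ (FreeGroup.of g), by rw [hopfPi_mk]; simp⟩

theorem hopfPi_ker : (hopfPi G).ker ≤ Subgroup.center (HopfQ G) := by
  intro q hq
  obtain ⟨f, rfl⟩ := QuotientGroup.mk'_surjective _ q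
  rw [MonoidHom.mem_ker, hopfPi_mk] at hq
  rw [Subgroup.mem_center_iff]
  intro g
  obtain ⟨y, rfl⟩ := QuotientGroup.mk'_surjective _ g
  symm
  rw [← commutatorElement_eq_one_iff_mul_comm, ← map_commutatorElement, ← MonoidHom.mem_ker,
    QuotientGroup.ker_mk']
  exact Subgroup.commutator_mem_commutator hq trivial

theorem schurCard_eq :
    schurCard G = Nat.card ((hopfPi G).ker ⊓ commutator (HopfQ G) : Subgroup (HopfQ G)) := by
  unfold schurCard hopfCard
  set π := FreeGroup.lift (id : G → G) with hπ
  let N : Subgroup (FreeGroup G) := ⁅π.ker, (⊤ : Subgroup (FreeGroup G))⁆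
  let f : (π.ker ⊓ commutator (FreeGroup G) : Subgroup (FreeGroup G)) →* HopfQ G :=
    (QuotientGroup.mk' N).comp (Subgroup.subtype _)
  have hker : f.ker = N.subgroupOf (π.ker ⊓ commutator (FreeGroup G)) := by
    ext x
    rw [MonoidHom.mem_ker, Subgroup.mem_subgroupOf, ← QuotientGroup.ker_mk' N, MonoidHom.mem_ker]
    rfl
  have hrange : f.range = (hopfPi G).ker ⊓ commutator (HopfQ G) := by
    have hc : commutator (HopfQ G) = (commutator (FreeGroup G)).map (QuotientGroup.mk' N) := by
      rw [commutator_def, commutator_def, Subgroup.map_commutator,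
        Subgroup.map_top_of_surjective _ (QuotientGroup.mk'_surjective N)]
    ext q
    constructor
    · rintro ⟨⟨x, hx1, hx2⟩, rfl⟩
      refine ⟨?_, ?_⟩
      · exact hx1
      · rw [hc]; exact ⟨x, hx2, rfl⟩
    · rintro ⟨h1, h2⟩
      rw [hc] at h2
      obtain ⟨x, hx, rfl⟩ := h2
      exact ⟨⟨x, h1, hx⟩, rfl⟩
  rw [← hrange, ← Nat.card_congr (QuotientGroup.quotientKerEquivRange f).toEquiv]
  rw [hker]

theorem hopf_lift {K : Type*} [Group K] (φ : K →* G) (hs : Function.Surjective φ)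
    (hk : φ.ker ≤ Subgroup.center K) : ∃ l : HopfQ G →* K, ∀ q, φ (l q) = hopfPi G q := by
  choose s hs' using hs
  let l0 : FreeGroup G →* K := FreeGroup.lift s
  have h0 : φ.comp l0 = FreeGroup.lift (id : G → G) := by
    ext g
    simp [l0, hs']
  have h0' : ∀ x, φ (l0 x) = FreeGroup.lift (id : G → G) x := fun x => DFunLike.congr_fun h0 x
  have hle : ⁅(FreeGroup.lift (id : G → G)).ker, (⊤ : Subgroup (FreeGroup G))⁆ ≤ l0.ker := by
    rw [Subgroup.commutator_le]
    intro x hx y _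
    rw [MonoidHom.mem_ker, map_commutatorElement, commutatorElement_eq_one_iff_mul_comm]
    have : l0 x ∈ φ.ker := by
      rw [MonoidHom.mem_ker, h0']; exact hx
    exact (Subgroup.mem_center_iff.1 (hk this) _).symm
  refine ⟨QuotientGroup.lift _ l0 hle, ?_⟩
  intro q
  obtain ⟨f, rfl⟩ := QuotientGroup.mk'_surjective _ q
  rw [hopfPi_mk, ← h0']
  rfl

end Hopf

section Upper

open scoped commutatorElement

variable {Q : Type*} [Group Q] {G : Type*} [Group G]

theorem upper_rel (π : Q →* G) {a b d u v : Q} {N r s : ℕ}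
    (hgen : Subgroup.closure {π a, π b} = ⊤)
    (hk : π.ker ≤ Subgroup.center Q)
    (hba : b * a = a * b * d) (hda : d * a = a * d * u) (hdb : d * b = b * d * v)
    (hdc : ∀ x, π d * x = x * π d) (hord : orderOf (π d) = N)
    (hr : π a ^ N = π d ^ r) (hs : π b ^ N = π d ^ s) :
    (∀ x, u * x = x * u) ∧ (∀ x, v * x = x * v) ∧
    u ∈ π.ker ⊓ commutator Q ∧ v ∈ π.ker ⊓ commutator Q ∧
    u ^ N = 1 ∧ v ^ N = 1 ∧ u ^ r = 1 ∧ v ^ s = 1 ∧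
    d ^ N * v ^ r * u ^ (N.choose 2) = 1 ∧ u ^ s = d ^ N * v ^ (N.choose 2) ∧
    ∀ x ∈ π.ker ⊓ commutator Q, ∃ i j : ℤ, x = u ^ i * v ^ j := by
  have ud : u = ⁅d⁻¹, a⁻¹⁆ := by
    rw [commutatorElement_def]
    have : u = d⁻¹ * a⁻¹ * (a * d * u) := by group
    rw [this, ← hda]; group
  have vd : v = ⁅d⁻¹, b⁻¹⁆ := by
    rw [commutatorElement_def]
    have : v = d⁻¹ * b⁻¹ * (b * d * v) := by group
    rw [this, ← hdb]; group
  have uk : u ∈ π.ker := by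
    rw [MonoidHom.mem_ker, ud, map_commutatorElement, commutatorElement_eq_one_iff_mul_comm]
    have := hdc (π a)
    rw [map_inv, map_inv, ← mul_inv_rev, ← mul_inv_rev, this]
  have vk : v ∈ π.ker := by
    rw [MonoidHom.mem_ker, vd, map_commutatorElement, commutatorElement_eq_one_iff_mul_comm]
    have := hdc (π b)
    rw [map_inv, map_inv, ← mul_inv_rev, ← mul_inv_rev, this]
  have kc : ∀ x ∈ π.ker, ∀ y, x * y = y * x := fun x hx y =>
    (Subgroup.mem_center_iff.1 (hk hx) y).symm
  have hu := kc u uk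
  have hv := kc v vk
  have uM : u ∈ commutator Q := by
    rw [ud]; exact Subgroup.commutator_mem_commutator (Subgroup.mem_top _) (Subgroup.mem_top _)
  have vM : v ∈ commutator Q := by
    rw [vd]; exact Subgroup.commutator_mem_commutator (Subgroup.mem_top _) (Subgroup.mem_top _)
  have hdN : d ^ N ∈ π.ker := by
    rw [MonoidHom.mem_ker, map_pow, ← hord, pow_orderOf_eq_one]
  have huN : u ^ N = 1 := by
    have h1 := aux_pow_left hda hu N
    rw [kc _ hdN a] at h1
    exact (mul_eq_left.1 h1.symm)
  have hvN : v ^ N = 1 := by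
    have h1 := aux_pow_left hdb hv N
    rw [kc _ hdN b] at h1
    exact (mul_eq_left.1 h1.symm)
  obtain ⟨z, hz, haz⟩ : ∃ z, (∀ y, z * y = y * z) ∧ a ^ N = d ^ r * z := by
    refine ⟨(d ^ r)⁻¹ * a ^ N, kc _ ?_, by group⟩
    rw [MonoidHom.mem_ker, map_mul, map_inv, map_pow, map_pow, hr]; group
  obtain ⟨z', hz', hbz⟩ : ∃ z, (∀ y, z * y = y * z) ∧ b ^ N = d ^ s * z := by
    refine ⟨(d ^ s)⁻¹ * b ^ N, kc _ ?_, by group⟩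
    rw [MonoidHom.mem_ker, map_mul, map_inv, map_pow, map_pow, hs]; group
  have hur : u ^ r = 1 := by
    have h1 : a ^ N * a = a * a ^ N := by rw [← pow_succ, ← pow_succ']
    rw [haz, mul_assoc, hz, ← mul_assoc, aux_pow_left hda hu, ← mul_assoc,
      mul_left_inj] at h1
    exact mul_eq_left.1 h1
  have hvs : v ^ s = 1 := by
    have h1 : b ^ N * b = b * b ^ N := by rw [← pow_succ, ← pow_succ']
    rw [hbz, mul_assoc, hz', ← mul_assoc, aux_pow_left hdb hv, ← mul_assoc,
      mul_left_inj] at h1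
    exact mul_eq_left.1 h1
  have hN1 : d ^ N * v ^ r * u ^ (N.choose 2) = 1 := by
    have h1 := aux_b_apow hba hda hu N
    have h2 : a ^ N * b = b * a ^ N * v ^ r := by
      rw [haz, mul_assoc, hz, ← mul_assoc, aux_pow_left hdb hv, mul_assoc, ← hz]; group
    rw [h2] at h1
    have h3 : b * a ^ N * (v ^ r * d ^ N * u ^ (N.choose 2)) = b * a ^ N := by
      simp only [← mul_assoc]
      exact h1.symm
    have h4 := mul_eq_left.1 h3
    rwa [← kc _ hdN] at h4
  have hN2 : u ^ s = d ^ N * v ^ (N.choose 2) := by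
    have h1 := aux_bpow_a hba hdb hv N
    have h2 : b ^ N * a = a * b ^ N * u ^ s := by
      rw [hbz, mul_assoc, hz', ← mul_assoc, aux_pow_left hda hu, mul_assoc, ← hz']; group
    rw [h2, mul_assoc (a * b ^ N)] at h1
    exact mul_left_cancel h1
  refine ⟨hu, hv, ⟨uk, uM⟩, ⟨vk, vM⟩, huN, hvN, hur, hvs, hN1, hN2, ?_⟩
  rintro x ⟨hx1, hx2⟩
  have hx3 := comm_le π hgen hk hba hda hdb hu hv hx2
  have hform : ∃ i j l : ℤ, x = d ^ l * (u ^ i * v ^ j) := by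
    have cud : ∀ i l : ℤ, u ^ i * d ^ l = d ^ l * u ^ i := fun i l =>
      ((show Commute u d from hu d).zpow_zpow i l).eq
    have cvd : ∀ i l : ℤ, v ^ i * d ^ l = d ^ l * v ^ i := fun i l =>
      ((show Commute v d from hv d).zpow_zpow i l).eq
    have cvu : ∀ i l : ℤ, v ^ i * u ^ l = u ^ l * v ^ i := fun i l =>
      ((show Commute v u from hv u).zpow_zpow i l).eq
    clear hx1 hx2
    induction hx3 using Subgroup.closure_induction with
    | mem x hx =>
      rcases hx with rfl | rfl | rfl
      · exact ⟨0, 0, 1, by simp⟩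
      · exact ⟨1, 0, 0, by simp⟩
      · exact ⟨0, 1, 0, by simp⟩
    | one => exact ⟨0, 0, 0, by simp⟩
    | mul x y _ _ hx hy =>
      obtain ⟨i, j, l, rfl⟩ := hx
      obtain ⟨i', j', l', rfl⟩ := hy
      refine ⟨i + i', j + j', l + l', ?_⟩
      calc _ = d ^ l * u ^ i * (v ^ j * d ^ l') * (u ^ i' * v ^ j') := by group
        _ = d ^ l * (u ^ i * d ^ l') * (v ^ j * u ^ i') * v ^ j' := by rw [cvd]; group
        _ = _ := by rw [cud, cvu, zpow_add, zpow_add, zpow_add]; group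
    | inv x _ hx =>
      obtain ⟨i, j, l, rfl⟩ := hx
      refine ⟨-i, -j, -l, ?_⟩
      rw [mul_inv_rev, mul_inv_rev, ← zpow_neg, ← zpow_neg, ← zpow_neg, mul_assoc, cud,
        ← mul_assoc, cvd, mul_assoc, cvu]
  obtain ⟨i, j, l, rfl⟩ := hform
  have huv : u ^ i * v ^ j ∈ π.ker := π.ker.mul_mem (π.ker.zpow_mem uk _) (π.ker.zpow_mem vk _)
  have hl : (N : ℤ) ∣ l := by
    have := (Subgroup.mul_mem_cancel_right _ huv).1 hx1
    rw [MonoidHom.mem_ker, map_zpow] at this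
    rw [← hord]
    exact orderOf_dvd_iff_zpow_eq_one.2 this
  obtain ⟨t, rfl⟩ := hl
  have hdN' : d ^ N = u ^ (s : ℤ) * v ^ (-(N.choose 2 : ℕ) : ℤ) := by
    rw [zpow_natCast, hN2]; simp
  refine ⟨s * t + i, -(N.choose 2 : ℕ) * t + j, ?_⟩
  rw [zpow_mul, zpow_natCast, hdN', Commute.mul_zpow, ← zpow_mul, ← zpow_mul, zpow_add, zpow_add]
  · have : v ^ (-(N.choose 2 : ℕ) * t : ℤ) * u ^ i = u ^ i * v ^ (-(N.choose 2 : ℕ) * t : ℤ) :=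
      ((show Commute v u from hv u).zpow_zpow _ _).eq
    calc _ = u ^ (s * t : ℤ) * (v ^ (-(N.choose 2 : ℕ) * t : ℤ) * u ^ i) * v ^ j := by group
      _ = _ := by rw [this]; simp only [mul_assoc]
  · exact (show Commute u v from hu v).zpow_zpow _ _

theorem count_uv {M : Subgroup Q} {u v : Q} {N : ℕ} (hN : 0 < N)
    (hu : u ∈ M) (hv : v ∈ M) (huN : u ^ N = 1) (hvN : v ^ N = 1)
    (hM : ∀ x ∈ M, ∃ i j : ℤ, x = u ^ i * v ^ j) :
    Finite M ∧ Nat.card M ≤ N ^ 2 ∧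
      (Nat.card M = N ^ 2 → ∀ i j : ℤ, u ^ i * v ^ j = 1 → (N : ℤ) ∣ i ∧ (N : ℤ) ∣ j) := by
  have red : ∀ w : Q, w ^ N = 1 → ∀ i : ℤ, w ^ i = w ^ (i % N).toNat := by
    intro w hw i
    have h0 : 0 ≤ i % N := Int.emod_nonneg _ (by omega)
    rw [← zpow_natCast, Int.toNat_of_nonneg h0]
    conv_lhs => rw [← Int.emod_add_mul_ediv i N, zpow_add, zpow_mul, zpow_natCast, hw, one_zpow,
      mul_one]
  have lt : ∀ i : ℤ, (i % N).toNat < N := by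
    intro i
    have h0 : 0 ≤ i % N := Int.emod_nonneg _ (by omega)
    have h1 : i % N < N := Int.emod_lt_of_pos _ (by omega)
    omega
  let f : Fin N × Fin N → M := fun q =>
    ⟨u ^ (q.1 : ℕ) * v ^ (q.2 : ℕ), M.mul_mem (M.pow_mem hu _) (M.pow_mem hv _)⟩
  have hf : Function.Surjective f := by
    rintro ⟨x, hx⟩
    obtain ⟨i, j, rfl⟩ := hM x hx
    refine ⟨(⟨_, lt i⟩, ⟨_, lt j⟩), ?_⟩
    apply Subtype.ext
    simp only [f]
    rw [red u huN i, red v hvN j]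
  have hcard : Nat.card (Fin N × Fin N) = N ^ 2 := by simp [sq]
  have hfin : Finite M := Finite.of_surjective f hf
  refine ⟨hfin, ?_, ?_⟩
  · rw [← hcard]; exact Nat.card_le_card_of_surjective f hf
  · intro hc i j hij
    have hb : Function.Bijective f :=
      (Nat.bijective_iff_surjective_and_card f).2 ⟨hf, by rw [hcard, hc]⟩
    have : f (⟨_, lt i⟩, ⟨_, lt j⟩) = f (⟨0, hN⟩, ⟨0, hN⟩) := by
      apply Subtype.ext
      simp only [f]
      rw [← red u huN i, ← red v hvN j, hij]; simp
    have := hb.1 this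
    simp only [Prod.mk.injEq, Fin.mk.injEq] at this
    have h0 : 0 ≤ i % N := Int.emod_nonneg _ (by omega)
    have h1 : 0 ≤ j % N := Int.emod_nonneg _ (by omega)
    exact ⟨Int.dvd_of_emod_eq_zero (by omega), Int.dvd_of_emod_eq_zero (by omega)⟩

end Upper

section Lower

variable {G : Type*} [Group G] [Finite G]

theorem lower_bound {N : ℕ} [NeZero N] (hodd : Odd N) {a b d : G}
    (hba : b * a = a * b * d) (hdc : ∀ x, d * x = x * d)
    (hgen : Subgroup.closure {a, b} = ⊤)
    (haN : a ^ N = 1) (hbN : b ^ N = 1) (hdN : d ^ N = 1) (hcard : Nat.card G = N ^ 3)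
    {qa qb qd u v : HopfQ G} (hqa : hopfPi G qa = a) (hqb : hopfPi G qb = b)
    (h1 : qb * qa = qa * qb * qd) (h2 : qd * qa = qa * qd * u) (h3 : qd * qb = qb * qd * v)
    {M : Subgroup (HopfQ G)} [Finite M] (hu : u ∈ M) (hv : v ∈ M) :
    N ^ 2 ≤ Nat.card M := by
  obtain ⟨h, hh⟩ : ∃ h : ZMod N, 2 * h = 1 := by
    have : IsUnit ((2 : ℕ) : ZMod N) := by
      rw [ZMod.isUnit_iff_coprime]
      exact (Nat.coprime_two_left.2 hodd)
    obtain ⟨c, hc⟩ := this.exists_right_inv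
    exact ⟨c, by simpa using hc⟩
  have : Fact (2 * h = 1) := ⟨hh⟩
  have val_add : ∀ w : G, w ^ N = 1 → ∀ x y : ZMod N,
      w ^ (x + y).val = w ^ x.val * w ^ y.val := by
    intro w hw x y
    rw [ZMod.val_add, ← pow_eq_pow_mod _ hw, pow_add]
  have val_mul : ∀ w : G, w ^ N = 1 → ∀ x y : ZMod N,
      w ^ (x * y).val = w ^ (x.val * y.val) := by
    intro w hw x y
    rw [ZMod.val_mul, ← pow_eq_pow_mod _ hw]
  have hcol : ∀ i j : ℕ, b ^ i * a ^ j = a ^ j * b ^ i * d ^ (i * j) := by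
    intro i j
    have e1 : b ^ i * a = a * b ^ i * d ^ i := aux_pow_left hba hdc i
    have e2 := aux_pow_right e1 (fun x => ((show Commute d x from hdc x).pow_left i).eq) j
    rw [e2, pow_mul]
  let φ : CoverK (ZMod N) h →* G :=
    { toFun := fun g => a ^ g.x.val * b ^ g.y.val * d ^ g.z.val
      map_one' := by simp [CoverK.one_def]
      map_mul' := by
        intro g g'
        have c1 : ∀ (i : ℕ) (x : G), d ^ i * x = x * d ^ i := fun i x =>
          ((show Commute d x from hdc x).pow_left i).eq
        simp only [CoverK.mul_def]
        rw [val_add a haN, val_add b hbN, val_add d hdN, val_add d hdN, val_mul d hdN]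
        symm
        calc _ = a ^ g.x.val * b ^ g.y.val * (d ^ g.z.val * (a ^ g'.x.val * b ^ g'.y.val))
                  * d ^ g'.z.val := by simp only [mul_assoc]
          _ = a ^ g.x.val * (b ^ g.y.val * a ^ g'.x.val) * b ^ g'.y.val * (d ^ g.z.val
                  * d ^ g'.z.val) := by rw [c1]; simp only [mul_assoc]
          _ = a ^ g.x.val * a ^ g'.x.val * b ^ g.y.val * (d ^ (g.y.val * g'.x.val) *
                  (b ^ g'.y.val * (d ^ g.z.val * d ^ g'.z.val))) := by
                rw [hcol]; simp only [mul_assoc]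
          _ = _ := by rw [c1]; simp only [mul_assoc] }
  have hφ : ∀ g, φ g = a ^ g.x.val * b ^ g.y.val * d ^ g.z.val := fun g => rfl
  have hsurj : Function.Surjective φ := by
    rw [← MonoidHom.range_eq_top, eq_top_iff, ← hgen, Subgroup.closure_le]
    have v1 : ∀ w : G, w ^ N = 1 → w ^ (1 : ZMod N).val = w := by
      intro w hw
      rw [ZMod.val_one_eq_one_mod, ← pow_eq_pow_mod _ hw, pow_one]
    rintro x (rfl | rfl)
    · exact ⟨⟨1, 0, 0, 0, 0⟩, by rw [hφ]; simp [v1 _ haN]⟩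
    · exact ⟨⟨0, 1, 0, 0, 0⟩, by rw [hφ]; simp [v1 _ hbN]⟩
  let ψ : ZMod N × ZMod N × ZMod N → G := fun t => a ^ t.1.val * b ^ t.2.1.val * d ^ t.2.2.val
  have hψ : Function.Bijective ψ := by
    refine (Nat.bijective_iff_surjective_and_card ψ).2 ⟨?_, ?_⟩
    · intro g
      obtain ⟨k, rfl⟩ := hsurj g
      exact ⟨(k.x, k.y, k.z), rfl⟩
    · rw [hcard]; simp; ring
  have hinj : ∀ g g', φ g = φ g' → g.x = g'.x ∧ g.y = g'.y ∧ g.z = g'.z := by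
    intro g g' hg
    have : ψ (g.x, g.y, g.z) = ψ (g'.x, g'.y, g'.z) := hg
    simpa using hψ.1 this
  have hker : φ.ker ≤ Subgroup.center _ := by
    intro g hg
    rw [MonoidHom.mem_ker, ← map_one φ] at hg
    obtain ⟨e1, e2, e3⟩ := hinj _ _ hg
    simp only [CoverK.one_def] at e1 e2 e3
    rw [Subgroup.mem_center_iff]
    intro k
    simp only [CoverK.mul_def, e1, e2, e3]
    ext <;> simp [add_comm]
  obtain ⟨l, hl⟩ := hopf_lift G φ hsurj hker
  have la : (l qa).x = 1 ∧ (l qa).y = 0 ∧ (l qa).z = 0 := by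
    apply hinj (l qa) ⟨1, 0, 0, 0, 0⟩
    rw [hl, hqa, hφ, ZMod.val_one_eq_one_mod, ← pow_eq_pow_mod _ haN]; simp
  have lb : (l qb).x = 0 ∧ (l qb).y = 1 ∧ (l qb).z = 0 := by
    apply hinj (l qb) ⟨0, 1, 0, 0, 0⟩
    rw [hl, hqb, hφ]
    simp only [ZMod.val_one_eq_one_mod, ← pow_eq_pow_mod _ hbN]; simp
  obtain ⟨a1, a2, a3⟩ := la
  obtain ⟨b1, b2, b3⟩ := lb
  have l1 := congrArg l h1
  have l2 := congrArg l h2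
  have l3 := congrArg l h3
  simp only [map_mul] at l1 l2 l3
  generalize l qa = A at *
  generalize l qb = B at *
  generalize l qd = D at *
  simp only [CoverK.mul_def, CoverK.ext_iff, a1, a2, a3, b1, b2, b3] at l1 l2 l3
  obtain ⟨d1, d2, d3, -, -⟩ := l1
  have d1' : D.x = 0 := by linear_combination -d1
  have d2' : D.y = 0 := by linear_combination -d2
  have d3' : D.z = 1 := by
    rw [d1'] at d3
    linear_combination -d3
  simp only [d1', d2', d3'] at l2 l3
  have hlu : l u = ⟨0, 0, 0, 1, 0⟩ := by
    obtain ⟨x1, x2, x3, x4, x5⟩ := l2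
    have y1 : (l u).x = 0 := by linear_combination -x1
    have y2 : (l u).y = 0 := by linear_combination -x2
    rw [y1] at x3 x4 x5
    have y3 : (l u).z = 0 := by linear_combination -x3
    rw [y3] at x5
    ext
    · exact y1
    · exact y2
    · exact y3
    · simp only []; linear_combination -x4
    · simp only []; linear_combination -x5
  have hlv : l v = ⟨0, 0, 0, 0, -1⟩ := by
    obtain ⟨x1, x2, x3, x4, x5⟩ := l3
    have y1 : (l v).x = 0 := by linear_combination -x1
    have y2 : (l v).y = 0 := by linear_combination -x2
    rw [y1] at x3 x4 x5
    have y3 : (l v).z = 0 := by linear_combination -x3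
    rw [y3] at x5
    ext
    · exact y1
    · exact y2
    · exact y3
    · simp only []; linear_combination -x4
    · simp only []; linear_combination -x5
  let F : ZMod N × ZMod N → M := fun t =>
    ⟨u ^ t.1.val * v ^ t.2.val, M.mul_mem (M.pow_mem hu _) (M.pow_mem hv _)⟩
  have hF : Function.Injective F := by
    rintro ⟨i, j⟩ ⟨i', j'⟩ he
    have he' := congrArg (fun x : M => l x) he
    simp only [F, map_mul, map_pow, hlu, hlv, CoverK.pow_uv, CoverK.mul_def] at he'
    simpa using he'
  calc N ^ 2 = Nat.card (ZMod N × ZMod N) := by simp [sq]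
    _ ≤ Nat.card M := Nat.card_le_card_of_injective F hF

end Lower

section Main

variable {G : Type*} [Group G]

/-- Lifts of two generators to the universal central quotient and their iterated commutators. -/
theorem exists_lifts {a b d : G} (hba : b * a = a * b * d) :
    ∃ qa qb qd u v : HopfQ G, hopfPi G qa = a ∧ hopfPi G qb = b ∧ hopfPi G qd = d ∧
      qb * qa = qa * qb * qd ∧ qd * qa = qa * qd * u ∧ qd * qb = qb * qd * v := by
  obtain ⟨qa, hqa⟩ := hopfPi_surj G a
  obtain ⟨qb, hqb⟩ := hopfPi_surj G b
  refine ⟨qa, qb, (qa * qb)⁻¹ * (qb * qa), _, _, hqa, hqb, ?_, (mul_inv_cancel_left _ _).symm,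
    (mul_inv_cancel_left _ _).symm, (mul_inv_cancel_left _ _).symm⟩
  rw [map_mul, map_inv, map_mul, map_mul, hqa, hqb, hba, inv_mul_cancel_left]

theorem commutator_eq_zpowers {a b d : G} (hgen : Subgroup.closure {a, b} = ⊤)
    (hba : b * a = a * b * d) (hdc : ∀ x, d * x = x * d) :
    commutator G = Subgroup.zpowers d := by
  apply le_antisymm
  · have := comm_le (MonoidHom.id G) (a := a) (b := b) (d := d) (u := 1) (v := 1)
      (by simpa using hgen)
      (by intro x hx
          have : x = 1 := hx
          rw [this]; exact Subgroup.one_mem _) hba (by rw [hdc, mul_one])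
      (by rw [hdc, mul_one]) (by simp) (by simp)
    refine this.trans ?_
    rw [Subgroup.closure_le]
    rintro x (rfl | rfl | rfl)
    · exact Subgroup.mem_zpowers _
    · exact Subgroup.one_mem _
    · exact Subgroup.one_mem _
  · rw [Subgroup.zpowers_le]
    have h : d = b⁻¹ * a⁻¹ * (a * b * d) := by group
    rw [h, ← hba]
    have h5 := Subgroup.commutator_mem_commutator (Subgroup.mem_top b⁻¹) (Subgroup.mem_top a⁻¹)
    rw [commutatorElement_def] at h5
    rw [commutator_def]
    simpa [mul_assoc] using h5

/-- Structure of the group: `k = m`, `|G| = p^(3m)`, and generators. -/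
theorem structure_G [Finite G] {N : ℕ} (hN : 0 < N)
    (e : Abelianization G ≃* (Multiplicative (ZMod N) × Multiplicative (ZMod N)))
    (hZ : commutator G = Subgroup.center G) :
    ∃ a b d : G, Subgroup.closure {a, b} = ⊤ ∧ b * a = a * b * d ∧ (∀ x, d * x = x * d) ∧
      orderOf d = N ∧ Nat.card (commutator G) = N ∧ Nat.card G = N ^ 3 ∧
      a ^ N ∈ commutator G ∧ b ^ N ∈ commutator G ∧ N ∣ orderOf a ∧ N ∣ orderOf b := by
  have : NeZero N := ⟨hN.ne'⟩
  obtain ⟨a, ha⟩ := QuotientGroup.mk'_surjective (commutator G)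
    (e.symm (Multiplicative.ofAdd 1, 1))
  obtain ⟨b, hb⟩ := QuotientGroup.mk'_surjective (commutator G)
    (e.symm (1, Multiplicative.ofAdd 1))
  let θ : G →* Multiplicative (ZMod N) × Multiplicative (ZMod N) :=
    e.toMonoidHom.comp (QuotientGroup.mk' (commutator G))
  have θa : θ a = (Multiplicative.ofAdd 1, 1) := by
    change e (QuotientGroup.mk' (commutator G) a) = _
    rw [ha]; exact e.apply_symm_apply _
  have θb : θ b = (1, Multiplicative.ofAdd 1) := by
    change e (QuotientGroup.mk' (commutator G) b) = _
    rw [hb]; exact e.apply_symm_apply _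
  have θk : ∀ x, θ x = 1 ↔ x ∈ commutator G := by
    intro x
    change e (QuotientGroup.mk' (commutator G) x) = 1 ↔ _
    rw [← QuotientGroup.eq_one_iff (N := commutator G)]
    exact e.map_eq_one_iff
  have hpa : ∀ i : ℕ, a ^ i ∈ commutator G ↔ N ∣ i := by
    intro i
    rw [← θk, map_pow, θa, ← ZMod.natCast_eq_zero_iff, Prod.ext_iff]
    simp [← ofAdd_nsmul]
  have hpb : ∀ i : ℕ, b ^ i ∈ commutator G ↔ N ∣ i := by
    intro i
    rw [← θk, map_pow, θb, ← ZMod.natCast_eq_zero_iff, Prod.ext_iff]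
    simp [← ofAdd_nsmul]
  have hcen : ∀ x ∈ commutator G, ∀ y, x * y = y * x := by
    intro x hx y
    rw [hZ] at hx
    exact (Subgroup.mem_center_iff.1 hx y).symm
  -- generation
  have hdecomp : ∀ g : G, ∃ x ∈ Subgroup.closure {a, b}, ∃ z ∈ commutator G, g = x * z := by
    intro g
    refine ⟨a ^ (Multiplicative.toAdd (θ g).1).val * b ^ (Multiplicative.toAdd (θ g).2).val, ?_,
      _, ?_, (mul_inv_cancel_left _ _).symm⟩
    · exact Subgroup.mul_mem _ (Subgroup.pow_mem _ (Subgroup.subset_closure (by simp)) _)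
        (Subgroup.pow_mem _ (Subgroup.subset_closure (by simp)) _)
    · rw [← θk, map_mul, map_inv, inv_mul_eq_one, map_mul, map_pow, map_pow, θa, θb]
      ext <;> simp [← ofAdd_nsmul]
  have hgen : Subgroup.closure {a, b} = ⊤ := by
    have hle : commutator G ≤ Subgroup.closure {a, b} := by
      rw [commutator_def, Subgroup.commutator_le]
      intro g _ g' _
      obtain ⟨x, hx, z, hz, rfl⟩ := hdecomp g
      obtain ⟨x', hx', z', hz', rfl⟩ := hdecomp g'
      have h1 := hcen z hz
      have h2 := hcen z' hz'
      have : (x * z) * (x' * z') * (x * z)⁻¹ * (x' * z')⁻¹ = x * x' * x⁻¹ * x'⁻¹ := by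
        calc _ = x * (z * x') * z' * z⁻¹ * x⁻¹ * z'⁻¹ * x'⁻¹ := by group
          _ = x * x' * (z * z') * z⁻¹ * x⁻¹ * z'⁻¹ * x'⁻¹ := by rw [h1]; group
          _ = x * x' * (z' * x⁻¹) * z'⁻¹ * x'⁻¹ := by rw [h1]; group
          _ = _ := by rw [h2]; group
      rw [commutatorElement_def, this]
      exact Subgroup.mul_mem _ (Subgroup.mul_mem _ (Subgroup.mul_mem _ hx hx')
        (Subgroup.inv_mem _ hx)) (Subgroup.inv_mem _ hx')
    rw [eq_top_iff]
    intro g _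
    obtain ⟨x, hx, z, hz, rfl⟩ := hdecomp g
    exact Subgroup.mul_mem _ hx (hle hz)
  have hdcm : (a * b)⁻¹ * (b * a) ∈ commutator G := by
    have h5 := Subgroup.commutator_mem_commutator (Subgroup.mem_top b⁻¹) (Subgroup.mem_top a⁻¹)
    rw [commutatorElement_def] at h5
    rw [commutator_def]
    simpa [mul_assoc] using h5
  obtain ⟨d, hd⟩ : ∃ d, d = (a * b)⁻¹ * (b * a) := ⟨_, rfl⟩
  have hba : b * a = a * b * d := by rw [hd, mul_inv_cancel_left]
  have hdc : ∀ x, d * x = x * d := hcen d (by rw [hd]; exact hdcm)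
  have hzp := commutator_eq_zpowers hgen hba hdc
  have hord : orderOf d = N := by
    have key : ∀ i : ℕ, d ^ i = 1 ↔ N ∣ i := by
      intro i
      rw [← hpa]
      have h1 : b * a ^ i = a ^ i * b * d ^ i := aux_pow_right hba hdc i
      constructor
      · intro h
        rw [h, mul_one] at h1
        have ht : Subgroup.centralizer {a ^ i} = ⊤ := by
          rw [eq_top_iff, ← hgen, Subgroup.closure_le]
          rintro x (rfl | rfl)
          · rw [SetLike.mem_coe, Subgroup.mem_centralizer_singleton_iff, ← pow_succ, ← pow_succ']
          · rw [SetLike.mem_coe, Subgroup.mem_centralizer_singleton_iff, h1]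
        rw [hZ, Subgroup.mem_center_iff]
        intro g
        have hg : g ∈ Subgroup.centralizer {a ^ i} := by rw [ht]; exact Subgroup.mem_top _
        exact Subgroup.mem_centralizer_singleton_iff.1 hg
      · intro h
        rw [← hcen _ h b] at h1
        exact mul_eq_left.1 h1.symm
    apply Nat.dvd_antisymm
    · exact orderOf_dvd_of_pow_eq_one ((key N).2 dvd_rfl)
    · exact (key _).1 (pow_orderOf_eq_one d)
  have hcc : Nat.card (commutator G) = N := by rw [hzp, Nat.card_zpowers, hord]
  refine ⟨a, b, d, hgen, hba, hdc, hord, hcc, ?_, (hpa N).2 dvd_rfl, (hpb N).2 dvd_rfl, ?_, ?_⟩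
  · rw [Subgroup.card_eq_card_quotient_mul_card_subgroup (commutator G), hcc]
    have : Nat.card (G ⧸ commutator G) = N ^ 2 := by
      have := Nat.card_congr e.toEquiv
      rw [Nat.card_prod] at this
      rw [show Nat.card (G ⧸ commutator G) = Nat.card (Abelianization G) from rfl]
      simpa [sq] using this
    rw [this]; ring
  · rw [← hpa, pow_orderOf_eq_one]; exact Subgroup.one_mem _
  · rw [← hpb, pow_orderOf_eq_one]; exact Subgroup.one_mem _

end Main

/-- Let `G` be a non-abelian finite `p`-group of order `p ^ n` with `|G'| ≥ p²`,
`G/G' ≅ ZMod (p^m) × ZMod (p^m)`, and `G' = Z(G)` cyclic of order `p ^ k`, `k ≥ 2`.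
Then `|M(G)|` attains the bound `p ^ ((1/2)*(2-1)*(n+k-2)+1)` (the case `d = 2`, stated
squared) if and only if `p ≠ 2`, `m ≥ 2`, and `G` is the group
`⟨a, b | a^(p^m) = b^(p^m) = c^(p^m) = 1, [a,b] = c central⟩` of order `p ^ (3m)`
(in particular `k = m`). -/
theorem bound_attained_iff_special_group_center_eq_commutator
    {p n k m : ℕ} (hp : p.Prime) (G : Type*) [Group G] [Finite G]
    (hG : Nat.card G = p ^ n) (hna : ∃ a b : G, a * b ≠ b * a)
    (hk : Nat.card (commutator G) = p ^ k) (hk2 : 2 ≤ k)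
    (hab : Nonempty (Abelianization G ≃*
      (Multiplicative (ZMod (p ^ m)) × Multiplicative (ZMod (p ^ m)))))
    (hZ : commutator G = Subgroup.center G)
    (hcyc : IsCyclic (↥(commutator G))) :
    schurCard G ^ 2 = p ^ ((2 - 1) * (n + k - 2) + 2) ↔
      (p ≠ 2 ∧ 2 ≤ m ∧
        (∃ a b : G,
          Subgroup.closure {a, b} = ⊤ ∧
          orderOf a = p ^ m ∧ orderOf b = p ^ m ∧
          orderOf (a⁻¹ * b⁻¹ * a * b) = p ^ m ∧
          a⁻¹ * b⁻¹ * a * b ∈ Subgroup.center G ∧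
          Nat.card G = p ^ (3 * m)) ∧
        k = m) := by
  classical
  have hNpos : 0 < p ^ m := pow_pos hp.pos m
  constructor
  · intro hS
    obtain ⟨e⟩ := hab
    obtain ⟨a, b, d, hgen, hba, hdc, hord, hcc, hcG, haN, hbN, hNa, hNb⟩ :=
      structure_G hNpos e hZ
    have hzp := commutator_eq_zpowers hgen hba hdc
    have hkm : k = m := Nat.pow_right_injective hp.two_le (hk.symm.trans hcc)
    have hn : n = 3 * m := Nat.pow_right_injective hp.two_le
      (show p ^ n = p ^ (3 * m) by rw [← hG, hcG, ← pow_mul, mul_comm])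
    have hm2 : 2 ≤ m := hkm ▸ hk2
    have hS' : schurCard G = (p ^ m) ^ 2 := by
      have h1 : schurCard G ^ 2 = ((p ^ m) ^ 2) ^ 2 := by
        rw [hS, ← pow_mul, ← pow_mul]
        congr 1
        omega
      exact Nat.pow_left_injective (by norm_num : 2 ≠ 0) h1
    obtain ⟨qa, qb, qd, u, v, hqa, hqb, hqd, e1, e2, e3⟩ := exists_lifts hba
    obtain ⟨r, hr⟩ : ∃ r : ℕ, d ^ r = a ^ (p ^ m) := by
      rw [hzp, ← mem_powers_iff_mem_zpowers] at haN
      exact haN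
    obtain ⟨s, hs⟩ : ∃ s : ℕ, d ^ s = b ^ (p ^ m) := by
      rw [hzp, ← mem_powers_iff_mem_zpowers] at hbN
      exact hbN
    obtain ⟨hu, hv, uM, vM, huN, hvN, hur, hvs, hN1, hN2, hM⟩ :=
      upper_rel (hopfPi G) (N := p ^ m) (r := r) (s := s)
        (by rw [hqa, hqb]; exact hgen) (hopfPi_ker G) e1 e2 e3
        (by rw [hqd]; exact hdc) (by rw [hqd]; exact hord) (by rw [hqa, hqd, hr])
        (by rw [hqb, hqd, hs])
    obtain ⟨hfin, hle, hind⟩ := count_uv hNpos uM vM huN hvN hM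
    have hind := hind ((schurCard_eq G).symm.trans hS')
    have hNr : p ^ m ∣ r := by
      have := (hind r 0 (by simpa using hur)).1
      exact_mod_cast this
    have hNs : p ^ m ∣ s := by
      have := (hind 0 s (by simpa using hvs)).2
      exact_mod_cast this
    have ha1 : a ^ (p ^ m) = 1 := by
      rw [← hr]; exact orderOf_dvd_iff_pow_eq_one.1 (hord.symm ▸ hNr)
    have hb1 : b ^ (p ^ m) = 1 := by
      rw [← hs]; exact orderOf_dvd_iff_pow_eq_one.1 (hord.symm ▸ hNs)
    have hvr : v ^ r = 1 := by
      obtain ⟨t, rfl⟩ := hNr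
      rw [pow_mul, hvN, one_pow]
    have hus : u ^ s = 1 := by
      obtain ⟨t, rfl⟩ := hNs
      rw [pow_mul, huN, one_pow]
    refine ⟨?_, hm2, ⟨a, b, hgen, ?_, ?_, ?_, ?_, ?_⟩, hkm⟩
    · rintro rfl
      rw [hvr, mul_one] at hN1
      rw [hus] at hN2
      have h1 : u ^ (((2 ^ m).choose 2 : ℕ) : ℤ) * v ^ (-(((2 ^ m).choose 2 : ℕ) : ℤ)) = 1 := by
        rw [zpow_neg, zpow_natCast, zpow_natCast, mul_inv_eq_one]
        exact mul_left_cancel (hN1.trans hN2)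
      have h2 := (hind _ _ h1).1
      have h3 : 2 ^ m ∣ (2 ^ m).choose 2 := by exact_mod_cast h2
      obtain ⟨t, ht⟩ := h3
      obtain ⟨j, rfl⟩ : ∃ j, m = j + 1 := ⟨m - 1, by omega⟩
      have h4 : 2 ^ (j + 1) * (2 ^ (j + 1) - 1) = 2 ^ (j + 1) * (2 * t) := by
        have h5 := Nat.choose_two_right (2 ^ (j + 1))
        have h6 : 2 ∣ 2 ^ (j + 1) * (2 ^ (j + 1) - 1) :=
          Dvd.dvd.mul_right (dvd_pow_self 2 (by omega)) _
        rw [ht] at h5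
        have h7 := Nat.div_mul_cancel h6
        rw [← h5] at h7
        rw [← h7]; ring
      have h8 := Nat.eq_of_mul_eq_mul_left hNpos h4
      have h9 : 2 ^ (j + 1) = 2 * 2 ^ j := by ring
      have h10 : 0 < 2 ^ j := by positivity
      omega
    · exact Nat.dvd_antisymm (orderOf_dvd_of_pow_eq_one ha1) hNa
    · exact Nat.dvd_antisymm (orderOf_dvd_of_pow_eq_one hb1) hNb
    · have : a⁻¹ * b⁻¹ * a * b = d⁻¹ := by
        have h : d = b⁻¹ * a⁻¹ * (a * b * d) := by group
        rw [h, ← hba]; group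
      rw [this, orderOf_inv, hord]
    · have : a⁻¹ * b⁻¹ * a * b = d⁻¹ := by
        have h : d = b⁻¹ * a⁻¹ * (a * b * d) := by group
        rw [h, ← hba]; group
      rw [this]
      apply Subgroup.inv_mem
      rw [Subgroup.mem_center_iff]
      exact fun x => (hdc x).symm
    · rw [hG, hn]
  · rintro ⟨hp2, hm2, ⟨a, b, hgen, hoa, hob, hoc, hcc, hcard⟩, hkm⟩
    have hn : n = 3 * m := Nat.pow_right_injective hp.two_le (hG.symm.trans hcard)
    obtain ⟨d, hd⟩ : ∃ d, d = (a⁻¹ * b⁻¹ * a * b)⁻¹ := ⟨_, rfl⟩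
    have hba : b * a = a * b * d := by rw [hd]; group
    have hdc : ∀ x, d * x = x * d := by
      intro x
      have : d ∈ Subgroup.center G := by rw [hd]; exact Subgroup.inv_mem _ hcc
      exact (Subgroup.mem_center_iff.1 this x).symm
    have hord : orderOf d = p ^ m := by rw [hd, orderOf_inv, hoc]
    have ha1 : a ^ (p ^ m) = 1 := by rw [← hoa, pow_orderOf_eq_one]
    have hb1 : b ^ (p ^ m) = 1 := by rw [← hob, pow_orderOf_eq_one]
    have hd1 : d ^ (p ^ m) = 1 := by rw [← hord, pow_orderOf_eq_one]
    obtain ⟨qa, qb, qd, u, v, hqa, hqb, hqd, e1, e2, e3⟩ := exists_lifts hba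
    obtain ⟨hu, hv, uM, vM, huN, hvN, hur, hvs, hN1, hN2, hM⟩ :=
      upper_rel (hopfPi G) (N := p ^ m) (r := 0) (s := 0)
        (by rw [hqa, hqb]; exact hgen) (hopfPi_ker G) e1 e2 e3
        (by rw [hqd]; exact hdc) (by rw [hqd]; exact hord) (by rw [hqa, ha1, pow_zero])
        (by rw [hqb, hb1, pow_zero])
    obtain ⟨hfin, hle, -⟩ := count_uv hNpos uM vM huN hvN hM
    have : NeZero (p ^ m) := ⟨hNpos.ne'⟩
    have hge := lower_bound (N := p ^ m) ((hp.odd_of_ne_two hp2).pow) hba hdc hgen ha1 hb1 hd1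
      (by rw [hcard, ← pow_mul, mul_comm]) hqa hqb e1 e2 e3 uM vM
    rw [schurCard_eq, le_antisymm hle hge, ← pow_mul, ← pow_mul]
    congr 1
    omega
end

section
/- Let p be a prime, m ≥ 2 an integer, and let G be a finite group generated by two elements a, b such that: the order of a is p^m, the order of b is p^m, the commutator c = [a,b] has order p, c lies in the center Z(G), and |G| = p^{2m+1}. Then the center of G equals the subgroup generated by a^p, b^p and [a,b]; moreover Z(G) is isomorphic to Z/p^{m-1}Z × Z/p^{m-1}Z × Z/pZ. -/
theorem aux_comm {G : Type*} [Group G] (a b c : G) (hc : a⁻¹ * b⁻¹ * a * b = c)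
    (hz : ∀ g : G, Commute c g) (i j : ℤ) : b ^ j * a ^ i = a ^ i * b ^ j * c ^ (-(i * j)) := by
  have h1 : b⁻¹ * a * b⁻¹⁻¹ = a * c := by rw [← hc]; group
  have h2 : b⁻¹ * a ^ i * b⁻¹⁻¹ = a ^ i * c ^ i := by
    rw [← conj_zpow, h1, ((hz a).symm).mul_zpow]
  have h3 : a ^ (-i) * b * (a ^ (-i))⁻¹ = b * c ^ (-i) := by
    have h4 : a ^ i * b = b * a ^ i * c ^ i := by
      rw [mul_assoc, ← h2]; group
    have h5 : b * a ^ i = a ^ i * b * c ^ (-i) := by rw [h4]; group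
    have h6 : (a ^ (-i))⁻¹ = a ^ i := by group
    rw [h6, mul_assoc, h5]; group
  have h4 : a ^ (-i) * b ^ j * (a ^ (-i))⁻¹ = b ^ j * c ^ (-(i * j)) := by
    rw [← conj_zpow, h3, (((hz b).zpow_left (-i)).symm).mul_zpow, ← zpow_mul, neg_mul]
  rw [mul_assoc, ← h4]; group

theorem aux_zmod {G : Type*} [Group G] (a : G) {n : ℕ} [NeZero n] (h : orderOf a = n) (i : ℤ) :
    a ^ ((i : ZMod n).val) = a ^ i := by
  rw [← zpow_natCast, ZMod.val_intCast, ← h, zpow_mod_orderOf]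

theorem aux_form {G : Type*} [Group G] (a b c : G) (hc : a⁻¹ * b⁻¹ * a * b = c)
    (hz : ∀ g : G, Commute c g) (hgen : Subgroup.closure {a, b} = ⊤) (g : G) :
    ∃ i j k : ℤ, g = a ^ i * b ^ j * c ^ k := by
  have hg : g ∈ Subgroup.closure {a, b} := by rw [hgen]; trivial
  have key := aux_comm a b c hc hz
  induction hg using Subgroup.closure_induction with
  | mem x hx =>
    rcases hx with rfl | rfl
    · exact ⟨1, 0, 0, by simp⟩
    · exact ⟨0, 1, 0, by simp⟩
  | one => exact ⟨0, 0, 0, by simp⟩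
  | mul x y _ _ hx hy =>
    obtain ⟨i, j, k, rfl⟩ := hx
    obtain ⟨i', j', k', rfl⟩ := hy
    refine ⟨i + i', j + j', -(i' * j) + k + k', ?_⟩
    have e1 := ((hz (a ^ i' * b ^ j')).zpow_left k).eq
    have e2 := ((hz (b ^ j')).zpow_left (-(i' * j))).eq
    calc a ^ i * b ^ j * c ^ k * (a ^ i' * b ^ j' * c ^ k')
        = a ^ i * b ^ j * (c ^ k * (a ^ i' * b ^ j')) * c ^ k' := by simp only [mul_assoc]
      _ = a ^ i * (b ^ j * a ^ i') * b ^ j' * c ^ k * c ^ k' := by rw [e1]; simp only [mul_assoc]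
      _ = a ^ i * a ^ i' * b ^ j * (c ^ (-(i' * j)) * b ^ j') * c ^ k * c ^ k' := by
        rw [key]; simp only [mul_assoc]
      _ = _ := by rw [e2]; simp only [zpow_add, mul_assoc]
  | inv x _ hx =>
    obtain ⟨i, j, k, rfl⟩ := hx
    refine ⟨-i, -j, -(i * j) - k, ?_⟩
    have e1 := ((hz (a ^ (-i) * b ^ (-j))).zpow_left (-k)).eq
    calc (a ^ i * b ^ j * c ^ k)⁻¹ = c ^ (-k) * (b ^ (-j) * a ^ (-i)) := by group
      _ = c ^ (-k) * (a ^ (-i) * b ^ (-j)) * c ^ (-(i * j)) := by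
        rw [key]; simp only [mul_assoc, neg_mul_neg]
      _ = _ := by rw [e1]; group

theorem aux_inj {p m : ℕ} (hp : p.Prime)
    {G : Type*} [Group G] [Finite G] (a b c : G) (hc : a⁻¹ * b⁻¹ * a * b = c)
    (hz : ∀ g : G, Commute c g) (hgen : Subgroup.closure {a, b} = ⊤)
    (ha : orderOf a = p ^ m) (hb : orderOf b = p ^ m)
    (hc' : orderOf c = p) (hG : Nat.card G = p ^ (2 * m + 1)) (i j k : ℤ)
    (h : a ^ i * b ^ j * c ^ k = 1) : ((p ^ m : ℕ) : ℤ) ∣ i ∧ ((p ^ m : ℕ) : ℤ) ∣ j ∧ (p : ℤ) ∣ k := by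
  have : NeZero p := ⟨hp.ne_zero⟩
  have : NeZero (p ^ m) := ⟨pow_ne_zero _ hp.ne_zero⟩
  let F : ZMod (p ^ m) × ZMod (p ^ m) × ZMod p → G :=
    fun x => a ^ x.1.val * b ^ x.2.1.val * c ^ x.2.2.val
  have hF : ∀ i j k : ℤ, F (i, j, k) = a ^ i * b ^ j * c ^ k := by
    intro i j k
    simp only [F]
    rw [aux_zmod a ha, aux_zmod b hb, aux_zmod c hc']
  have hs : Function.Surjective F := by
    intro g
    obtain ⟨i, j, k, rfl⟩ := aux_form a b c hc hz hgen g
    exact ⟨_, hF i j k⟩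
  have hb : Function.Bijective F := by
    rw [Nat.bijective_iff_surjective_and_card]
    refine ⟨hs, ?_⟩
    rw [hG, Nat.card_prod, Nat.card_prod, Nat.card_zmod, Nat.card_zmod]
    ring
  have := hb.1 ((hF i j k).trans (h.trans (by simpa using (hF 0 0 0).symm)) : F (i, j, k) = F ((0:ℤ), (0:ℤ), (0:ℤ)))
  simp only [Prod.mk.injEq, Int.cast_zero, ZMod.intCast_zmod_eq_zero_iff_dvd] at this
  exact this

theorem center_of_special_group_order_p
    {p m : ℕ} (hp : p.Prime) (hm : 2 ≤ m)
    (G : Type*) [Group G] [Finite G] (a b : G)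
    (hgen : Subgroup.closure {a, b} = ⊤)
    (ha : orderOf a = p ^ m) (hb : orderOf b = p ^ m)
    (hc : orderOf (a⁻¹ * b⁻¹ * a * b) = p)
    (hcz : a⁻¹ * b⁻¹ * a * b ∈ Subgroup.center G)
    (hG : Nat.card G = p ^ (2 * m + 1)) :
    Subgroup.center G = Subgroup.closure {a ^ p, b ^ p, a⁻¹ * b⁻¹ * a * b} ∧
      Nonempty ((Subgroup.center G) ≃*
        (Multiplicative (ZMod (p ^ (m - 1))) ×
          Multiplicative (ZMod (p ^ (m - 1))) × Multiplicative (ZMod p))) := by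
  generalize hcd : a⁻¹ * b⁻¹ * a * b = c at *
  have hz : ∀ g : G, Commute c g := fun g => (Subgroup.mem_center_iff.mp hcz g).symm
  have key := aux_comm a b c hcd hz
  have form := aux_form a b c hcd hz hgen
  have inj := aux_inj hp a b c hcd hz hgen ha hb hc hG
  have hcp : c ^ p = 1 := by rw [← hc]; exact pow_orderOf_eq_one c
  have hcpz : ∀ n : ℤ, c ^ ((p : ℤ) * n) = 1 := by
    intro n; rw [zpow_mul, zpow_natCast, hcp, one_zpow]
  have cen : ∀ x : G, Commute x a → Commute x b → x ∈ Subgroup.center G := by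
    intro x h1 h2
    rw [Subgroup.mem_center_iff]
    intro g
    obtain ⟨i, j, k, rfl⟩ := form g
    exact ((((h1.zpow_right i).mul_right (h2.zpow_right j))).mul_right
      ((hz x).symm.zpow_right k)).eq.symm
  have hap : a ^ p ∈ Subgroup.center G := by
    apply cen _ ((Commute.refl a).pow_left p)
    have := key p 1
    rw [mul_one, ← mul_neg_one, hcpz, mul_one, zpow_one, zpow_natCast] at this
    exact this.symm
  have hbp : b ^ p ∈ Subgroup.center G := by
    refine cen _ ?_ ((Commute.refl b).pow_left p)
    have := key 1 p
    rw [one_mul, ← mul_neg_one, hcpz, mul_one, zpow_one, zpow_natCast] at this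
    exact this
  have cform : ∀ x ∈ Subgroup.center G, ∃ i j k : ℤ, x = (a ^ p) ^ i * (b ^ p) ^ j * c ^ k := by
    intro x hx
    obtain ⟨i, j, k, rfl⟩ := form x
    have hx' : a ^ i * b ^ j ∈ Subgroup.center G := by
      have := mul_mem hx (inv_mem (Subgroup.zpow_mem _ hcz k))
      rwa [mul_inv_cancel_right] at this
    rw [Subgroup.mem_center_iff] at hx'
    have hj : (p : ℤ) ∣ j := by
      have h1 : a * b ^ j = b ^ j * a := by
        have := hx' a
        have h2 : a ^ i * (a * b ^ j) = a ^ i * (b ^ j * a) := by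
          rw [← mul_assoc, ← mul_assoc, ← this, ← mul_assoc, (Commute.self_zpow a i).eq]
        exact mul_left_cancel h2
      have h3 := key 1 j
      rw [zpow_one, ← h1, left_eq_mul, one_mul] at h3
      have := orderOf_dvd_iff_zpow_eq_one.mpr h3
      rw [hc] at this
      exact (dvd_neg.mp this)
    have hi : (p : ℤ) ∣ i := by
      have h1 : b * a ^ i = a ^ i * b := by
        have := hx' b
        have h2 : (b * a ^ i) * b ^ j = a ^ i * b * b ^ j := by
          rw [mul_assoc, this, mul_assoc, mul_assoc, (Commute.self_zpow b j).eq]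
        exact mul_right_cancel h2
      have h3 := key i 1
      rw [zpow_one, h1, left_eq_mul, mul_one] at h3
      have := orderOf_dvd_iff_zpow_eq_one.mpr h3
      rw [hc] at this
      exact (dvd_neg.mp this)
    obtain ⟨i, rfl⟩ := hi
    obtain ⟨j, rfl⟩ := hj
    exact ⟨i, j, k, by simp only [zpow_mul, zpow_natCast]⟩
  have hpm : p * p ^ (m - 1) = p ^ m := by
    rw [← pow_succ']; congr 1; omega
  refine ⟨le_antisymm ?_ ?_, ?_⟩
  · intro x hx
    obtain ⟨i, j, k, rfl⟩ := cform x hx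
    refine mul_mem (mul_mem (zpow_mem (Subgroup.subset_closure ?_) _)
      (zpow_mem (Subgroup.subset_closure ?_) _)) (zpow_mem (Subgroup.subset_closure ?_) _) <;> simp
  · rw [Subgroup.closure_le]
    rintro x (rfl | rfl | rfl)
    exacts [hap, hbp, hcz]
  · let L : (n : ℕ) → (x : Subgroup.center G) → x ^ n = 1 →
        (Multiplicative (ZMod n) →* Subgroup.center G) := fun n x h =>
      AddMonoidHom.toMultiplicativeLeft (ZMod.lift n ⟨zmultiplesHom _ (Additive.ofMul x), by
        simp only [zmultiplesHom_apply, natCast_zsmul, ← ofMul_pow, h, ofMul_one]⟩)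
    have hL : ∀ n x h (i : ℤ), L n x h (Multiplicative.ofAdd (i : ZMod n)) = x ^ i := by
      intro n x h i
      simp [L]
    let A : Subgroup.center G := ⟨a ^ p, hap⟩
    let B : Subgroup.center G := ⟨b ^ p, hbp⟩
    let C : Subgroup.center G := ⟨c, hcz⟩
    have hA : A ^ (p ^ (m - 1)) = 1 := by
      apply Subtype.ext
      simp only [A, Subgroup.coe_pow, Subgroup.coe_one]
      rw [← pow_mul, hpm, ← ha, pow_orderOf_eq_one]
    have hB : B ^ (p ^ (m - 1)) = 1 := by
      apply Subtype.ext
      simp only [B, Subgroup.coe_pow, Subgroup.coe_one]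
      rw [← pow_mul, hpm, ← hb, pow_orderOf_eq_one]
    have hC : C ^ p = 1 := Subtype.ext hcp
    letI : CommGroup (Subgroup.center G) :=
      { (inferInstance : Group (Subgroup.center G)) with
        mul_comm := fun x y => Subtype.ext (Subgroup.mem_center_iff.mp y.2 x) }
    let f := MonoidHom.coprod (P := Subgroup.center G) (L _ A hA)
      (MonoidHom.coprod (P := Subgroup.center G) (L _ B hB) (L _ C hC))
    have hf : ∀ i j k : ℤ, ((f (Multiplicative.ofAdd (i : ZMod _), Multiplicative.ofAdd (j : ZMod _),
        Multiplicative.ofAdd (k : ZMod _)) : Subgroup.center G) : G)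
        = (a ^ p) ^ i * (b ^ p) ^ j * c ^ k := by
      intro i j k
      simp only [f, MonoidHom.coprod_apply, hL, A, B, C, Subgroup.coe_mul, Subgroup.coe_zpow,
        mul_assoc]
    refine ⟨(MulEquiv.ofBijective f ⟨?_, ?_⟩).symm⟩
    · rw [injective_iff_map_eq_one]
      rintro ⟨x, y, z⟩ h
      obtain ⟨i, hi⟩ := ZMod.intCast_surjective x.toAdd
      obtain ⟨j, hj⟩ := ZMod.intCast_surjective y.toAdd
      obtain ⟨k, hk⟩ := ZMod.intCast_surjective z.toAdd
      obtain rfl : Multiplicative.ofAdd (i : ZMod _) = x := hi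
      obtain rfl : Multiplicative.ofAdd (j : ZMod _) = y := hj
      obtain rfl : Multiplicative.ofAdd (k : ZMod _) = z := hk
      have h1 := hf i j k
      rw [h, Subgroup.coe_one] at h1
      have h2 := inj (p * i) (p * j) k (by
        simp only [zpow_mul, zpow_natCast]; exact h1.symm)
      have hp0 : (p : ℤ) ≠ 0 := by exact_mod_cast hp.ne_zero
      rw [← hpm, Nat.cast_mul, mul_dvd_mul_iff_left hp0, mul_dvd_mul_iff_left hp0] at h2
      rw [← ZMod.intCast_zmod_eq_zero_iff_dvd, ← ZMod.intCast_zmod_eq_zero_iff_dvd, ← ZMod.intCast_zmod_eq_zero_iff_dvd] at h2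
      rw [h2.1, h2.2.1, h2.2.2]
      rfl
    · rintro ⟨x, hx⟩
      obtain ⟨i, j, k, rfl⟩ := cform x hx
      exact ⟨_, Subtype.ext (hf i j k)⟩
end

section
/- Let p be a prime, m ≥ 2 an integer, and let G be a finite group generated by two elements a, b such that: the order of a is p^m, the order of b is p^m, the commutator c = [a,b] has order p^m, c lies in the center Z(G), and |G| = p^{3m}. Then the center of G equals the commutator subgroup of G: Z(G) = [G,G]. -/
open scoped commutatorElement

/-- Let `p` be a prime, `m ≥ 2`, and `G` a finite group generated by `a, b` with
`|a| = |b| = p ^ m`, `c = [a,b] = a⁻¹b⁻¹ab` of order `p ^ m` and central, and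
`|G| = p ^ (3m)`.  Then `Z(G) = [G,G]`. -/
theorem center_eq_commutator_of_special_group
    {p m : ℕ} (hp : p.Prime) (hm : 2 ≤ m)
    (G : Type*) [Group G] [Finite G] (a b : G)
    (hgen : Subgroup.closure {a, b} = ⊤)
    (ha : orderOf a = p ^ m) (hb : orderOf b = p ^ m)
    (hc : orderOf (a⁻¹ * b⁻¹ * a * b) = p ^ m)
    (hcz : a⁻¹ * b⁻¹ * a * b ∈ Subgroup.center G)
    (hG : Nat.card G = p ^ (3 * m)) :
    Subgroup.center G = commutator G := by
  obtain ⟨c, hcdef⟩ : ∃ c, c = a⁻¹ * b⁻¹ * a * b := ⟨_, rfl⟩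
  rw [← hcdef] at hc hcz
  have hcc : ∀ (k : ℤ) (g : G), g * c ^ k = c ^ k * g := fun k g =>
    Subgroup.mem_center_iff.mp (Subgroup.zpow_mem _ hcz k) g
  have hcom : ∀ g : G, Commute g c := fun g => Subgroup.mem_center_iff.mp hcz g
  have h1 : b⁻¹ * a * b = a * c := by rw [hcdef]; group
  have h2 : a⁻¹ * b * a = b * c⁻¹ := by
    rw [hcdef]; group
  have k1 : ∀ i : ℤ, b⁻¹ * a ^ i * b = a ^ i * c ^ i := by
    intro i
    rw [← (hcom a).mul_zpow, ← h1]
    simpa using (conj_zpow (i := i) (a := b⁻¹) (b := a)).symm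
  have k2 : ∀ i : ℤ, a⁻¹ * b ^ i * a = b ^ i * (c⁻¹) ^ i := by
    intro i
    rw [← ((hcom b).inv_right).mul_zpow, ← h2]
    simpa using (conj_zpow (i := i) (a := a⁻¹) (b := b)).symm
  have nf : ∀ g : G, ∃ i j k : ℤ, g = a ^ i * b ^ j * c ^ k := by
    intro g
    have hg : g ∈ Subgroup.closure {a, b} := by rw [hgen]; trivial
    induction hg using Subgroup.closure_induction_left with
    | one => exact ⟨0, 0, 0, by simp⟩
    | mul_left x hx y _ ih =>
      obtain ⟨i, j, k, rfl⟩ := ih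
      rcases hx with rfl | rfl
      · exact ⟨i + 1, j, k, by rw [add_comm, zpow_add]; simp [mul_assoc]⟩
      · refine ⟨i, j + 1, k - i, ?_⟩
        have h := k1 i
        have h' : x * a ^ i = a ^ i * x * c ^ (-i) := by
          have : a ^ i * x = x * (a ^ i * c ^ i) := by rw [← h]; group
          rw [this]; group
        rw [add_comm, zpow_add, sub_eq_neg_add, zpow_add, zpow_one]
        calc x * (a ^ i * x ^ j * c ^ k) = (x * a ^ i) * x ^ j * c ^ k := by group
          _ = a ^ i * x * (c ^ (-i) * x ^ j) * c ^ k := by rw [h']; simp only [mul_assoc]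
          _ = _ := by rw [← hcc]; simp only [mul_assoc]
    | inv_mul_cancel x hx y _ ih =>
      obtain ⟨i, j, k, rfl⟩ := ih
      rcases hx with rfl | rfl
      · exact ⟨i - 1, j, k, by rw [sub_eq_neg_add, zpow_add]; simp [mul_assoc]⟩
      · refine ⟨i, j - 1, k + i, ?_⟩
        have h := k1 i
        have h' : x⁻¹ * a ^ i = a ^ i * c ^ i * x⁻¹ := by rw [← h]; group
        rw [sub_eq_neg_add, zpow_add, add_comm k, zpow_add, zpow_neg_one]
        calc x⁻¹ * (a ^ i * x ^ j * c ^ k) = (x⁻¹ * a ^ i) * x ^ j * c ^ k := by group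
          _ = a ^ i * (c ^ i * (x⁻¹ * x ^ j)) * c ^ k := by rw [h']; simp only [mul_assoc]
          _ = _ := by rw [← hcc]; simp only [mul_assoc]
  apply le_antisymm
  · intro g hg
    obtain ⟨i, j, k, rfl⟩ := nf g
    have hg' : a ^ i * b ^ j ∈ Subgroup.center G := by
      have := Subgroup.mul_mem _ hg (Subgroup.inv_mem _ (Subgroup.zpow_mem _ hcz k))
      simpa using this
    rw [Subgroup.mem_center_iff] at hg'
    have e1 : c ^ i = 1 := by
      have h := hg' b
      have : b⁻¹ * a ^ i * b = a ^ i := by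
        have h3 : a ^ i * b ^ j * b = a ^ i * b * b ^ j := by group
        rw [h3] at h
        have h4 : b * a ^ i = a ^ i * b := by
          apply mul_right_cancel (b := b ^ j); rw [← h]; group
        rw [mul_assoc, ← h4]; group
      rw [k1] at this
      simpa using this
    have e2 : c ^ j = 1 := by
      have h := hg' a
      have : a⁻¹ * b ^ j * a = b ^ j := by
        have h4 : a * b ^ j = b ^ j * a := by
          apply mul_left_cancel (a := a ^ i)
          rw [← mul_assoc, ← mul_assoc, ← h]; group
        rw [mul_assoc, ← h4]; group
      rw [k2] at this
      simpa using this
    have d1 : a ^ i = 1 := by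
      rw [← orderOf_dvd_iff_zpow_eq_one] at e1 ⊢
      rwa [ha, ← hc]
    have d2 : b ^ j = 1 := by
      rw [← orderOf_dvd_iff_zpow_eq_one] at e2 ⊢
      rwa [hb, ← hc]
    rw [d1, d2, one_mul, one_mul]
    apply Subgroup.zpow_mem
    have : c = ⁅a⁻¹, b⁻¹⁆ := by rw [hcdef, commutatorElement_def]; group
    rw [this]
    exact Subgroup.commutator_mem_commutator (Subgroup.mem_top _) (Subgroup.mem_top _)
  · rw [commutator_def, Subgroup.commutator_le]
    intro g _ h _
    let f := QuotientGroup.mk' (Subgroup.center G)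
    have hfc : f c = 1 := (QuotientGroup.eq_one_iff c).mpr hcz
    have hab : Commute (f a) (f b) := by
      have : a * b = b * a * c := by rw [hcdef]; group
      have := congrArg f this
      rw [map_mul, map_mul, map_mul, hfc, mul_one] at this
      exact this
    have : f ⁅g, h⁆ = 1 := by
      rw [map_commutatorElement, commutatorElement_eq_one_iff_commute]
      obtain ⟨i, j, k, rfl⟩ := nf g
      obtain ⟨i', j', k', rfl⟩ := nf h
      simp only [map_mul, map_zpow, hfc, one_zpow, mul_one]
      have A : ∀ x y : ℤ, Commute (f a ^ x) (f b ^ y) := fun x y => hab.zpow_zpow x y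
      have B : ∀ x y : ℤ, Commute (f a ^ x) (f a ^ y) := fun x y => (Commute.refl _).zpow_zpow x y
      have C : ∀ x y : ℤ, Commute (f b ^ x) (f b ^ y) := fun x y => (Commute.refl _).zpow_zpow x y
      exact ((B _ _).mul_right (A _ _)).mul_left (((A _ _).symm).mul_right (C _ _))
    exact (QuotientGroup.eq_one_iff _).mp this
end
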